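/- arXiv:math/9905076 — 2 statements merged into one kernel-verified Lean document; each statement's English description precedes it below -/
import Mathlib

section
/- Let p0 = (0, −3), p1 = (8, 3), p2 = (4, −4), p3 = (−5, −5), p4 = (−5, −2), p5 = (3, −1), p6 = (−5, −9), p7 = (8, 5), p8 = (5, 8), p9 = (−1, 4) in ℂ². If f ∈ ℂ[x, y] is a polynomial of total degree at most 13 such that every partial derivative of f of total order at most 4 (including f itself) vanishes at p0, and every partial derivative of f of total order at most 3 (including f itself) vanishes at each of p1, …, p9, then f = 0. Consequently the linear system L(13, 5, 9, 4) is empty for ten points in general position. -/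
open MvPolynomial

/-- The differential operator `∂x^a ∂y^b` on `ℂ[x,y]`. -/
noncomputable def derivOp2 (a b : ℕ) :
    MvPolynomial (Fin 2) ℂ →ₗ[ℂ] MvPolynomial (Fin 2) ℂ :=
  ((pderiv (0 : Fin 2)).toLinearMap ^ a * (pderiv (1 : Fin 2)).toLinearMap ^ b :
    Module.End ℂ (MvPolynomial (Fin 2) ℂ))

/-- The ten specific points of the affine plane used for `L(13, 5, 9, 4)`. -/
def pts : Fin 10 → Fin 2 → ℂ :=
  ![![0, -3], ![8, 3], ![4, -4], ![-5, -5], ![-5, -2], ![3, -1], ![-5, -9], ![8, 5],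
    ![5, 8], ![-1, 4]]

namespace Cert

/-- Evaluate a natural number to a literal before passing it on. -/
def force {α : Type} (x : ℕ) (k : ℕ → α) : α :=
  Nat.rec (motive := fun _ => α) (k 0) (fun n _ => k (n + 1)) x

theorem force_eq {α : Type} (x : ℕ) (k : ℕ → α) : force x k = k x := by
  cases x <;> rfl

/-- Pairs `(i, j)` with `i + j ≤ d`. -/
def pairs (d : ℕ) : List (ℕ × ℕ) :=
  (List.range (d + 1)).flatMap fun i => (List.range (d + 1 - i)).map fun j => (i, j)

theorem mem_pairs (d i j : ℕ) : (i, j) ∈ pairs d ↔ i + j ≤ d := by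
  simp only [pairs, List.mem_flatMap, List.mem_range, List.mem_map, Prod.mk.injEq]
  constructor
  · rintro ⟨i', h1, j', h2, rfl, rfl⟩
    omega
  · intro h
    exact ⟨i, by omega, j, by omega, rfl, rfl⟩

/-- The exponents of the monomials of degree at most 13. -/
def mons : List (ℕ × ℕ) := pairs 13

/-- A multiplicity condition: point (shifted by `(10, 10)`) and derivative orders. -/
structure Cnd where
  u : ℕ
  v : ℕ
  a : ℕ
  b : ℕ

/-- The nine points of multiplicity four, shifted by `(10, 10)`. -/
def npts : List (ℕ × ℕ) :=
  [(18, 13), (14, 6), (5, 5), (5, 8), (13, 9), (5, 1), (18, 15), (15, 18), (9, 14)]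

/-- The list of all conditions. -/
def cnds : List Cnd :=
  (pairs 4).map (fun q => ⟨10, 7, q.1, q.2⟩) ++
    npts.flatMap fun P => (pairs 3).map fun q => ⟨P.1, P.2, q.1, q.2⟩

/-- Matrix entry modulo 97. -/
def entry (c : Cnd) (m : ℕ × ℕ) : ℕ :=
  Nat.descFactorial m.1 c.a * Nat.descFactorial m.2 c.b *
    (c.u + 87) ^ (m.1 - c.a) * (c.v + 87) ^ (m.2 - c.b) % 97

/-- Pack a list of digits in base `2 ^ 20`. -/
def pack : List ℕ → ℕ
  | [] => 0
  | x :: l => x + 1048576 * pack l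

/-- Linear combination of the list with the base 100 digits of `n` as coefficients. -/
def comb : List ℕ → ℕ → ℕ → ℕ
  | [], _, acc => acc
  | r :: l, n, acc =>
    force (n / 100) fun n' => force (acc + n % 100 * r) fun acc' => comb l n' acc'

/-- Check that digit number `j` of `s` is `1` modulo 97 if `j = i` and `0` otherwise. -/
def chk : List (ℕ × ℕ) → ℕ → ℕ → ℕ → Bool
  | [], _, _, _ => true
  | _ :: l, s, i, j =>
    Nat.beq (s % 1048576 % 97) (cond (Nat.beq j i) 1 0) &&
      force (s / 1048576) fun s' => force (j + 1) fun j' => chk l s' i j'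

/-- Evaluate all members of a list. -/
def forceList {α : Type} : List ℕ → (List ℕ → α) → α
  | [], k => k []
  | x :: l, k => force x fun x' => forceList l fun l' => k (x' :: l')

theorem forceList_eq {α : Type} (l : List ℕ) (k : List ℕ → α) : forceList l k = k l := by
  induction l generalizing k with
  | nil => rfl
  | cons x l ih => simp [forceList, force_eq, ih]

/-- Check all rows. -/
def chkAll (Rs : List ℕ) : List ℕ → ℕ → Bool
  | [], _ => true
  | n :: l, i =>
    (force (comb Rs n 0) fun s => chk mons s i 0) && force (i + 1) fun i' => chkAll Rs l i'

/-- The packed rows of the matrix modulo 97. -/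
def rows : List ℕ := cnds.map fun c => pack (mons.map (entry c))

/-- The rows of the inverse matrix modulo 97, in base 100. -/
def inv : List ℕ :=
  [ 353400426572223170002677758345898513896407398564754645636462708485496225957212466119029294123355359025610873946436710603690306408076542808522244024143382073135774566923596970307118874359837976513983110396013694,
    404034554195708209448888698323623420756238822124571346125132234781104476033151097149122623117478479302082211800980095212636991751082279106239265703950941175795879573066925182100510570872635612926217696186122645,
    645359780051308783427774415286764519288400810622870913678090287248854533462293494112504231963352126417294118786266011551935557611303147377934140103519745158366976621322644855958127568559911989322012895411499313,
    615842088658103022060628900707137436034795165713898500909252523624477653344574923500078980122083498847056460278248897304445939172040445173507485455082481810667538274888196951305571714233467735054719458753799400,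
    777514848890778884089639851093680705915326358467345039067317578849703147165784197304671019336593144720380461222840583879967443275441960176382854381978456070846550636833234216657632591392777917737347590992134730,
    124205281225626494264587557029561456856458338410000192659052156536951371632561010473155759856138270251731557287080240968531883475163414051312619810069286876280207560038154160254371197311281766458383296432641371,
    320331109382362401277529640689384324278064188166931738076269705128309241454753373134103566301584908115478605060483018785887146371284637409295683715202565322567148157314332737441639912730527194558727674206517964,
    423668550492927856562495891077821461645704345249507127073806131306446427430743067770071137287341843340548453036230632917745823880806296628095163723433724880319015462766842211893575171107251026630039110123717639,
    659541073104293204391446772271257573024377040113800901156242022723316804721206650469958589703186594544576334791121873359240029401946520612267218909678331604546031682112861565588044161468386685683767707575845362,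
    407971453322734516392496505327627933518368915929649682858112094580013262537803400660309468138306034322945676252347438919224796160600792001172926813025082785413358418394762107854413782245002861754810122959436589,
    165690870212518340414237947512134365020330080227090703187445496958425322891687474553906106594119910747125655608128288901819678724643827240355371726161879178310930473093749081405695141750677714893230146105384108,
    455217526246655324067787558810634821215219862377297672611996714018326314122786703354264388812507293792359558456187288157818368300953022268731408780108599219858921123382842001122681200829593625808903398971626021,
    673764191384293088564072573044737186761203167513634109439021525523037534943857413322346285642616387026543202283672027802386081477245685357347585724692413886199075875765083265433903241379186538485958421839077759,
    39052151867535517865257786096152280465361149421431107190453534788396281810710852980084640032280045282820963491149680826912644613193454385141166767172249430053626954615520476367268643725292334583645338982861912,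
    670801779228718121220186013136344687032833883858920082806550882095584326102910414728430756337486037131494670006833649157735569159317658444946418860242515008933566829682911233225244758272364609393841512351302343,
    881002701235692266631989801918496080091687814880645927309628948789480233450210308749339253527778189577205268213567112291955226702743280174215487647532657602925853478025615124448127114318467528540721901088138056,
    509037810984092929120751616827478658091914835165557126700648858135375917399606663516514510903902282970110414168249310027834857901028666621302828176655649184271644689274083573566142439112905442711570168244834702,
    467256677883344623889437960508832775524235623895358633672924205472636570305776794402326687942129924967275485491137469315602251619638862012366673147871209367539163547738596061556564312131551693825287291188712494,
    946926816806968801278174053636300569296514089336555366924808883214536259820838000323943946622536552511738834656001887272016823273307639501544677361070540578548517379013290694151609425155894013346357268138269343,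
    221017270378790352230632508694204568243965024212363792029384875139692596156619321342023433225455711674387337247542660738522802060791273400362982947010872836803843472644335458932839759488041167802137693872721143,
    453626451842219235087004110960153767634600283565374683402267364464047430162683686939392604937768668449420858719586422333034826885742143105024014678783137574606649460050174202276548085302080071697816881179792163,
    128016900693762753241009157768020115036009738157918744018834863405956233472420325444462901570536300274450560177910798031218222673342825172137777402258717343038643858074258106191964442457950286668956749401726642,
    208689149256871062123304349645060114745912933204085368824214244623523134822372600871032365054490826781583873821217324788274468518682222263450544685183407834077595033242112849114052535239216528737931162659181513,
    213111235224694484927978881213362395930432241249700949666179346325472376611700076473910957471928806183791652217800127316295450656749637156894975018575216318041174323581471794521689796234092489311526625988650337,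
    182764295831135112365918739333752612091492308960597217847188897026378677572172573029900009832089442540906871895839877208748521789411334559060008346939803878113777647585049559164139525282201551941959527093815378,
    953679124156776039736076949055933841536627872740953608927414048945685944759290464621303340391767585203176192015439005906923537508161955715139090501291578513203673549490284211581083007202866502702711627990550096,
    156214938075213869810363514435880674273587914364019317227434641590001558027167000451277938174052724906581065425336358080183746156202444310895157938190431072211374263316128944547183072888734288266505683178233121,
    509540437496234306112744459557417733299481330816103291157494614859208824263054878878047490502951233265222760295207291941605756091904042475046647700005640461196305185237315218498250844993515478302205327407437809,
    75419078731199103305816016818517247876205769662684013441195606421537757248163703979893416553402927433463048311071672114866314408615391158003878404349841643081351178060356467671413911933859205851590504819372717,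
    639503212809779616773238058871405032508552690850671855097709421531443021340348610454396837490707922547677623681644022395730560219227960612668913062685874429259561630411502449800334124468032471093355609588330135,
    362531818401823164687365800100691915887580917792823049621734030643692903856459822908079156718236722005232495894959732130850639185147570271276088255526273908474193940152139384297835310381255171661929951466546073,
    908169483742166064143428034003308292475954318087874001224439834554437495165525401463317692047553692058065947543000842012347854387403150291177545364030719433356135766478321095779357036587863346766569259551544369,
    728756220462648547776771702125284188576415571415471378278242683121735437013622743404258243820092860953203350507566683932792437870725255936265614204585098207867841835594063681331519338196647126171840966686871064,
    333361346916110308158063723208935979369161365027090229437977150244237612369668703468467707443066771262117172765376555616208979525996836340867016827876692040057320666473229494761463893642816992335664454464878279,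
    769495661573341417092474892708144776480286559522240535515179236439705322731706358550328704256149913174956589919186773071690977841921224982280823696329789469460225669070281975700620375675610041832786107864838514,
    29120203615744823249486008464937425547708475581252267555070299205563929732183310627519037503445185520797752095828378102322277031053640718229296849221511337602757925300329623311055726770681619515307176659357425,
    137577032734557977051296503493022951668233219635628748829149034100593437899059752559574669656711900039806736547328644227667388144284314580968426188850950102619069198845588950047321425540358310236154690273196640,
    70450009505043391453244027441480826182341683317183525354956745865141631855768722074371787273132015891568295757346757258292890858010175244067477784705508790821979377343804023494982424906358359519502048445885366,
    661578126746890092492758509588361600707819142326601646531359563911369609025867300636760080558781920005684600731559373054507247689428383886633787955389485332332631392655568971790522166143733718726351767370822207,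
    78404511816257919711991800915325745653520571917047955408603060226579127525519040764728010732543552692342110663991409494034508364532247232029088175184140414380832757109067023075125758138883729755324682386802423,
    884419497032566734825922109191177362300762241910541912133482214841843844714212270559642906729411791793025835936962003760354150913165137596944541961083379072484520655033539283217952413288869165249288757569297619,
    701930959038012838203741361403844058432228298227603686444743836782338908075610373221881907146691766761081983500351466447194159646817301925302272854945543170677124858230605172656217397355588695621583830833747634,
    161319766851636984933884909142484062635196493819307555715036962836813332366477697261748507211172411691539183550568199666201660863834660471784632255924591284778276270848892251632529836030545613268280488145014262,
    57526104813683328537134307617020306154046628566778328529696615814700982890796177753875993603141948161550105029238602621101037083817028721030216699451183661935310813958481293476308769360931477430628417752265016,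
    211438476172572019427515968123242205609092441225775650901726462445473068426735431766848752683786725283708139505235203227534340881542040376604278215788675310873469774743065489106513767374857647525320081983179101,
    890835032001265746535280910145379528567386876591912694841947468590222673097088625418595295412777385735791535637923580590134515758516937696051967894176066751223229441494568617492654521000925760630073684690437412,
    264431387241328820145267504848126229363733265978077019598307455233686815281394012745780732794786961104277518579328062166676755947777670623255090090393738871735482554511819542944339303917147893044745876385929637,
    812716247300459309867184187985466126922237868714502793256075963128536689282509283356485196865127037968131552223627399021518127690975937747129293521611873768371224122692626004084828554654797046317029244301775525,
    437955246552688774380085089443580091224095430534148266798862907788878001250455670128535516638971717911538026224418497030357919749181096744795892694927832815674020565238335387274204644581615482792669524962271146,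
    207366461942549515083868536658064652091944596055254420603620006473180986502461037291421429528453809443021527969429080409787795824217306039068292857679260253850234802863095038581989243513511370761595734706088041,
    319547844079842883804344671652944654133009231912965219908113040500895266461461118464354189273790713883837322616455603022533573592342539338256195759467149487620446020051790849295930828011345242062679760361749638,
    509203062251027567621023430832917827076989411604315523261845511668064294825784692826902595611185926729572701812744456128026877456926572636494769027486458022186632391880694141484846260091903159477890247781029681,
    607264000782648740351256422704371785610230059575328965285828622909498611483692966844245652299230527630225639639460660069001728380674780854158368546854133758112936603996353028024063495990083759345717735060921072,
    729559805924484708841122391096203052127627813908713504063141593186764360800120831583564594114651724714474164110931798182036533461089766105728808674193738826037431133488022463244478731051511715327164284680958142,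
    592829579026560148038171135266294760547156511056039453071909038183935736236593090469536389685810273350961784443626397085618289788287394386663019531382230432916225695805643527211295110027530684551517966616799352,
    598722850646607376713295365483332248067038566513364831359324549237130440844561560171731609894936811145846275153323830229834793185356654043828608026190404004768965838228334617842202571758628655415372132680626251,
    420523917367039622928559879615611204566603341487901763638432155252746283180775082057951653640491082318733489422935340348746009203851502134067307820418025207637115279003050303703985715408539123927821558951523954,
    616022394707810235538411156432782250138163387033125362903472293329326633798467154938024490580709388266803962349640505133885736368180211879488280585864754260319005273190520124382293181601672761127845492850942915,
    730969738451758580830601037957563423176668542662218772556576027168494547496959613480090068593986880958255414262903794358502379257278230784497950715188011053628470361111386377861437311679176411496658193223415459,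
    882037936437726569139283655172228119139615551544751241042260222502347988936329138208706024264112861183166946155508407960164905171318179648616929330564937515362473531174171086523085339427538687098613089148111862,
    561306604354926803359076857221230277570601181803106848107076181796636987015427611476860384099128051221361118506004342045740501505615143320712982504710571459090385761396602686351226098554122334961647150364301753,
    881579635376281504242772775082037824861937663471162796907939468237575781505223820612814326952854797629223730916074695747782220180936122712213360022864290409852852149480686526448829029514520159410144028239595423,
    345326619358753402623146471861302961760331949571162289523470175930819325199505232909575171668777794187120538321276400580837126610395296410430734459531187511136528844101665768219009260471626985827425585024109089,
    498252439188939307874092211856810881134866824920182462900045270391915008036560607513227383038687048868112873857665004782472358141043213543127996486912778511150607766263718477455304529371707091496735357314051853,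
    426796126033392914683830585460003875792007290204752418831827196364219580482671253361671096645159671130938331360512920629291452060528314958919242869016398171188632906121480423964906889426696229460759660557350925,
    108375182817056932799264639238064614914226205107260068901390304143155079471457821987887932386669220963506637526684020352543517842490570774742820762244813049686276390945211643075580383024907385215603455748153912,
    913127632684265543618618024590138574381991231523286827710048697925884395195537392796903694423785524373478930622733814395668312667834855784365142050358270607844317889521601610310956793527535016100961535984027145,
    163023728292027332355085775213931417715429952350178990308365654042624019424685677721276945318039434559419421548838066142407555758896206991903786195466115373098262468578425104272868663337153306381858217876890834,
    687125267880236809341141529030551182023648924035636261411146267459695458958352520412162867620123198763586028826124480703790269065149095270160635924432498895000422537238774271826263140736222482408570949204431447,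
    239319801773206361497021579021900977161272921044223349886589458137481479955703254421465833466394077312452042776217242995083907746687353347171209447761813369494588307175063062950720862152604567736717835986364660,
    605277302172065910487571011184096067422106601219113394892528166478598772091582839403323603579412480931167874527613361434092021859116109501938259612159600227397904081500851617724194306839316338247858397269412493,
    394340113359567637039195870914951487636342695251041431350608388030099678085530237123035935039304744984963526342669057054860682521641001683906339472807179316017787835927238991321310210078508819697558841084009511,
    821176121928554144750483374330236706573015071833694435627405940558563115663287775341803055933569189453811473415706501566949337732250550524123863241844790332915812105401932906771688177018918108515479914985449077,
    312238817872848881014377826871006562673729910608073671563618212591500756023938830882209355951995621385397980910680099128268742581171819405896557127392880388548854771200566418097512400210321804510554856867565619,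
    666623647542960915763731669042262563134734340384527305033737752018382146280802714417670194082077783452327679676747708625926314787054823119903355031403918602578870858963092180625816226387291401621474473012065601,
    875969715038628258760054083444658322103980721320028920028979514970718281632308368603710643057626442763941107295612777176530865075911911344574365791171397642260835694538516936952717172652075015762060710713667670,
    117215886217934152778375332494566052639206752647413584323683029595080138945490713134277343441508238392271402725189536143560378828779487592720164105191283750812082012003082785082479662645206785852142027511428059,
    258650358840653854226844236705933927214695643895396688027995058392410885524496334684966671527015806749852096798725224263536154286502816912747129288081024713606164387226864450141578157029536828084386881256739443,
    374391884805900796777900846549745546532147435721419122163417150305733692959300552455368231029086358243310539278757681801422300195434658276718035913660241293915950312636423427700441896585217401087568915691386861,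
    186576149043496588308369860340635668416236800182407996569413325365089434567329856269115125405851492093801033358526367205271788390154315045715956865602556640151380248236298324194861308067471723905718614146083828,
    87295850777965479450764123472413185866841062782661283743252449048056487104668766134138204355256685176507054007770874652386488814335067950588785072378802146428207417075056826751736022281290139076845056260286362,
    847501171506374660651236436135566889322639891002147496481269727105720175799192380749248779448759040066756921284379778033388002028672534888858551719464337279360256790128704835898626313471814106382670786913047744,
    722325025652944385092152965415402970967018198102369381470446801215649272403322852341599534773053922335285571558223069626435362330225014158129223952247168684681836290332416738674323920542783965950952272517183276,
    553975082746106783035113493685653243713907861047074625366249899576815650746158366748254858424573571100541311901266885238310442469622340524625881387475781355724535010846809529127852328663624423530154786683576953,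
    755044377447195696967519412847944640913065280125954926608771239549634603716853414561254745460306166717257571456507004414042042851626518896001689877139264980158439895450867586075301547964118721695408352779679281,
    435430531844923478358645775254546464946718735061428836547541213394267990397485494508681792250754461894678759593959889048547688897417866858234012190409913951016718128912245068486706897407241991177653741653153234,
    732819249459933432560406939269737656370054742800338028316206066147659544592366883418054718011663292067072090729175457620481350245262125660778378848795768503591482902451802528912337522551635845409535102008841570,
    106566164160295139888293136804330672731270728668004485745330940101728274530446602334382969230927190191197111031747946948571956746804809626403370332653438400559331115766951110252611001433409262669220470551349005,
    57579222928517579724871035229785205806733137030007130728393824173782051228437927983346102578649584770766407732135193126866877070889631930368114756752691909817896066357498521618121167360740346835463481249174550,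
    807968443036003583072487299451361294296308361527253189066782696758665387820406478907457503129027685757401417777676493152034995685124253471667948652831565552158847025842840243577065607679586432912873101415284855,
    529578250863562450422204105803763211727232871884186518846743928002785682114431267930511974827105892980328531062058304357494472486660752533222640506693054455803164509035953014159277128827708328342174082722799286,
    153165545954337011480683210216462344534209323804402685873724732770167377743119109616386080353910396182040246007564001727123180126012266924253940666955063955263592319450384666329017947302782409814163902370094302,
    834079215450849225937847898876242602194213948377304702407640072625921654540409167248946491932354133183076960093858750678749228276240667878112535053150085495734327449416671860300690930441621386815257898120107141,
    17489430065757079115207851445395001224240435451276666612445942290159531193168534860346447924678371996610553646000885771142521753419852527238389585296057938227321751423410204420295170218587903387384465434467353,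
    559228612023028542759157013348511911030758324108450925488531823386961335105128026761820249736437731516473785325495658426783165786559480746396411337525778706891823899014166565285521176023526165212472752509792657,
    921280770543504939837558300556097942499296682952953913734166122735549188442129955296517065918073294723516914405535220121546442076136437375663246935144113986671251068792494175062810062192292504592250020960240090,
    127659134509401639594149165866068817694566436474536163039061527009504590153567663286851855710168779158510652305387180151951287340914412505886023245434541557160213663673811858727504161755846159165467703083353418,
    31724408557613853178016599420251996427616485815275108849437113836252654687437403882759454857867061038681776888659612963429075040969774382282319874772805775285774202520103050914567633359281751946639235553564490,
    288608435465143626216246686843248329884539802665482291944943326010703631812728602576638121194102963852747793644258334695223574051122545938853485055501694410900722092695900677919242552478890967292041683876903049,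
    924150067908634204766893410609437395511611542841889053835271704229361974146026147576912057503848121008888720134396051909556682851011307638270668308578148611751971504996064448290491280227752987118581192634486255,
    921296557130591457441463414007625192637361098710954346960996201603473600267887244150887224515196071659084791274616199311933782729181698811371880173987048054020148073119932991260911251066515736855393461775682775,
    960973875679925051350726778233109377183760330734824550064325418504757373237590201644162501442970433262327581241906890894226207526141728880234841213544694149591937938741713180412931698131356926324577864086322372,
    763231396403010595966147273900470874405354425978897544776777612795881121891561468583371209125190522723553712899300746120315375211407085252044550604407479165245618743166384900238681805211172030952733049433448725,
    261700332167838435052678231000408558054483619492373884964128189029823132013959803432326575852303784376059203380710245641774138954369754524028934530700828249633044122785350970482227280479503463140483588820086988,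
    744853680628940538904780410442095113561358318350529268611936291833516983673919911977708548653447372179549339755377456437368781359686718779345531130000195337187640448283580359805732283712651928074113681340833855]

set_option maxRecDepth 100000 in
theorem check : forceList rows (fun Rs => chkAll Rs inv 0) = true := by
  decide +kernel

theorem comb_pack (cs : List Cnd) (ms : List (ℕ × ℕ)) (n : ℕ) (g : ℕ × ℕ → ℕ) :
    comb (cs.map fun c => pack (ms.map (entry c))) n (pack (ms.map g)) =
      pack (ms.map fun m => comb (cs.map fun c => entry c m) n (g m)) := by
  induction cs generalizing n g with
  | nil => simp [comb]
  | cons c cs ih =>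
    simp only [List.map_cons, comb, force_eq]
    rw [← ih]
    congr 1
    clear ih
    induction ms with
    | nil => simp [pack]
    | cons m ms ih =>
      simp only [List.map_cons, pack]
      rw [← ih]
      ring

theorem pack_zero (ms : List (ℕ × ℕ)) : pack (ms.map fun _ => 0) = 0 := by
  induction ms with
  | nil => rfl
  | cons m ms ih => simp only [List.map_cons, pack, ih]

theorem comb_le (cs : List Cnd) (m : ℕ × ℕ) (n acc : ℕ) :
    comb (cs.map fun c => entry c m) n acc ≤ acc + cs.length * (99 * 96) := by
  induction cs generalizing n acc with
  | nil => simp [comb]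
  | cons c cs ih =>
    simp only [List.map_cons, comb, force_eq, List.length_cons]
    refine (ih _ _).trans ?_
    have h1 : n % 100 ≤ 99 := by omega
    have h2 : entry c m ≤ 96 := by unfold entry; omega
    have := Nat.mul_le_mul h1 h2
    linarith

theorem chk_spec (ms : List (ℕ × ℕ)) (g : ℕ × ℕ → ℕ) (hg : ∀ m, g m < 1048576) (i j : ℕ)
    (h : chk ms (pack (ms.map g)) i j = true) (t : ℕ) (ht : t < ms.length) :
    g ms[t] % 97 = if j + t = i then 1 else 0 := by
  induction ms generalizing j t with
  | nil => simp at ht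
  | cons m ms ih =>
    simp only [List.map_cons, chk, force_eq, pack, Bool.and_eq_true] at h
    have h1 : (g m + 1048576 * pack (ms.map g)) % 1048576 = g m := by
      have := hg m
      omega
    have h2 : (g m + 1048576 * pack (ms.map g)) / 1048576 = pack (ms.map g) := by
      have := hg m
      omega
    rw [h1, h2] at h
    cases t with
    | zero =>
      have h3 := Nat.eq_of_beq_eq_true h.1
      simp only [List.getElem_cons_zero, h3, Nat.add_zero]
      by_cases hji : j = i
      · simp [hji]
      · have : Nat.beq j i = false := by
          rw [← Bool.not_eq_true]
          exact fun hh => hji (Nat.eq_of_beq_eq_true hh)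
        simp [hji, this]
    | succ t =>
      have := ih (j + 1) h.2 t (by simpa using ht)
      simp only [List.getElem_cons_succ, this]
      congr 1
      simp only [eq_iff_iff]
      omega

theorem chkAll_spec (Rs l : List ℕ) (i : ℕ) (h : chkAll Rs l i = true) (t : ℕ)
    (ht : t < l.length) : chk mons (comb Rs l[t] 0) (i + t) 0 = true := by
  induction l generalizing i t with
  | nil => simp at ht
  | cons n l ih =>
    simp only [chkAll, force_eq, Bool.and_eq_true] at h
    cases t with
    | zero => simpa using h.1
    | succ t =>
      have := ih (i + 1) h.2 t (by simpa using ht)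
      rw [List.getElem_cons_succ, ← this]
      congr 1
      omega

theorem mons_length : mons.length = 105 := by decide +kernel
theorem cnds_length : cnds.length = 105 := by decide +kernel
theorem inv_length : inv.length = 105 := by decide +kernel
theorem mons_nodup : mons.Nodup := by decide +kernel

theorem inv_spec (i j : ℕ) (hi : i < inv.length) (hj : j < mons.length) :
    comb (cnds.map fun c => entry c mons[j]) inv[i] 0 % 97 = if j = i then 1 else 0 := by
  have h := check
  rw [forceList_eq] at h
  have h1 := chkAll_spec _ _ _ h i hi
  have h2 := comb_pack cnds mons inv[i] (fun _ => 0)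
  rw [pack_zero] at h2
  unfold rows at h1
  rw [h2] at h1
  have h3 := chk_spec mons (fun m => comb (cnds.map fun c => entry c m) inv[i] 0) (fun m => by
    refine (comb_le cnds m _ 0).trans_lt ?_
    rw [cnds_length]
    norm_num) _ _ h1 j hj
  simpa using h3

theorem comb_sum (l : List ℕ) (n acc : ℕ) :
    comb l n acc = acc + ∑ k : Fin l.length, n / 100 ^ (k : ℕ) % 100 * l[k] := by
  induction l generalizing n acc with
  | nil => simp [comb]
  | cons r l ih =>
    simp only [comb, force_eq]
    rw [ih]
    simp only [List.length_cons]
    rw [Fin.sum_univ_succ]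
    simp [Nat.div_div_eq_div_mul, pow_succ', add_assoc]

/-- Integer matrix entry. -/
def entryZ (c : Cnd) (m : ℕ × ℕ) : ℤ :=
  (Nat.descFactorial m.1 c.a : ℤ) * (Nat.descFactorial m.2 c.b : ℤ) *
    ((c.u : ℤ) - 10) ^ (m.1 - c.a) * ((c.v : ℤ) - 10) ^ (m.2 - c.b)

theorem entry_cast (c : Cnd) (m : ℕ × ℕ) : (entry c m : ZMod 97) = (entryZ c m : ZMod 97) := by
  unfold entry entryZ
  rw [ZMod.natCast_mod]
  push_cast
  have h : (87 : ZMod 97) = -10 := by decide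
  rw [h]
  simp only [sub_eq_add_neg]

/-- The `k`-th condition. -/
def cnd (k : Fin 105) : Cnd := cnds[(k : ℕ)]'(by rw [cnds_length]; exact k.2)

/-- The `j`-th monomial. -/
def mon (j : Fin 105) : ℕ × ℕ := mons[(j : ℕ)]'(by rw [mons_length]; exact j.2)

/-- The matrix of the conditions. -/
def M : Matrix (Fin 105) (Fin 105) ℤ := fun k j => entryZ (cnd k) (mon j)

/-- The inverse matrix modulo 97. -/
def N : Matrix (Fin 105) (Fin 105) (ZMod 97) := fun i k =>
  ((inv[(i : ℕ)]'(by rw [inv_length]; exact i.2) / 100 ^ (k : ℕ) % 100 : ℕ) : ZMod 97)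

theorem N_mul_M : N * M.map (Int.castRingHom (ZMod 97)) = 1 := by
  ext i j
  have h := inv_spec i j (by rw [inv_length]; exact i.2) (by rw [mons_length]; exact j.2)
  rw [comb_sum, zero_add] at h
  have h2 := congrArg (Nat.cast : ℕ → ZMod 97) h
  rw [ZMod.natCast_mod] at h2
  push_cast at h2
  rw [Matrix.mul_apply, Matrix.one_apply]
  have e : (i = j) ↔ ((j : ℕ) = (i : ℕ)) := by
    rw [Fin.ext_iff, eq_comm]
  simp only [e]
  rw [← h2]
  have hl : 105 = (cnds.map fun c => entry c mons[(j : ℕ)]).length := by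
    rw [List.length_map, cnds_length]
  refine Fintype.sum_equiv (finCongr hl) _ _ fun k => ?_
  simp [N, M, mon, cnd, entry_cast]

theorem det_M : M.det ≠ 0 := by
  intro h
  have h1 := congrArg Matrix.det N_mul_M
  rw [Matrix.det_mul, Matrix.det_one, ← RingHom.mapMatrix_apply, ← RingHom.map_det, h] at h1
  rw [map_zero, mul_zero] at h1
  exact absurd h1 (by decide)

theorem pderiv_pow_monomial (i : Fin 2) (n : ℕ) (s : Fin 2 →₀ ℕ) (c : ℂ) :
    ((pderiv i).toLinearMap ^ n : Module.End ℂ (MvPolynomial (Fin 2) ℂ)) (monomial s c) =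
      monomial (s - Finsupp.single i n) (c * (Nat.descFactorial (s i) n : ℂ)) := by
  induction n with
  | zero => simp
  | succ n ih =>
    rw [pow_succ', Module.End.mul_apply, ih]
    simp only [Derivation.coeFn_coe, pderiv_monomial]
    rw [tsub_tsub, ← Finsupp.single_add, Nat.descFactorial_succ]
    congr 1
    simp
    ring

/-- The exponent vector of a pair. -/
noncomputable def expo (m : ℕ × ℕ) : Fin 2 →₀ ℕ := Finsupp.single 0 m.1 + Finsupp.single 1 m.2

theorem expo_zero (m : ℕ × ℕ) : expo m 0 = m.1 := by simp [expo]
theorem expo_one (m : ℕ × ℕ) : expo m 1 = m.2 := by simp [expo]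

theorem eval_derivOp2_monomial (P : Fin 2 → ℂ) (a b : ℕ) (m : ℕ × ℕ) (c : ℂ) :
    eval P (derivOp2 a b (monomial (expo m) c)) =
      (Nat.descFactorial m.1 a : ℂ) * (Nat.descFactorial m.2 b : ℂ) *
        P 0 ^ (m.1 - a) * P 1 ^ (m.2 - b) * c := by
  unfold derivOp2
  rw [Module.End.mul_apply, pderiv_pow_monomial, pderiv_pow_monomial, eval_monomial,
    Finsupp.prod_fintype _ _ (by simp), Fin.prod_univ_two]
  simp [expo_zero, expo_one]
  ring

theorem mon_injective : Function.Injective mon := by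
  intro i j h
  have := (List.Nodup.getElem_inj_iff mons_nodup).1 h
  exact Fin.ext this

theorem expo_mon_injective : Function.Injective fun j => expo (mon j) := by
  intro i j h
  apply mon_injective
  have h0 := DFunLike.congr_fun h 0
  have h1 := DFunLike.congr_fun h 1
  simp only [expo_zero, expo_one] at h0 h1
  exact Prod.ext h0 h1

theorem expand (f : MvPolynomial (Fin 2) ℂ) (hdeg : f.totalDegree ≤ 13) :
    f = ∑ j : Fin 105, monomial (expo (mon j)) (coeff (expo (mon j)) f) := by
  conv_lhs => rw [f.as_sum]
  rw [← Finset.sum_image (s := Finset.univ) (g := fun j => expo (mon j))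
    (f := fun s => monomial s (coeff s f)) (fun _ _ _ _ h => expo_mon_injective h)]
  refine Finset.sum_subset ?_ fun s _ hs => ?_
  · intro s hs
    have h1 := (le_totalDegree hs).trans hdeg
    rw [Finsupp.sum_fintype _ _ (by simp), Fin.sum_univ_two] at h1
    have h2 : (s 0, s 1) ∈ mons := (mem_pairs 13 _ _).2 h1
    obtain ⟨t, ht, h3⟩ := List.mem_iff_getElem.1 h2
    refine Finset.mem_image.2 ⟨⟨t, by rw [← mons_length]; exact ht⟩, Finset.mem_univ _, ?_⟩
    have h4 : mon ⟨t, by rw [← mons_length]; exact ht⟩ = (s 0, s 1) := h3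
    simp only [h4]
    ext q
    fin_cases q
    · exact expo_zero _
    · exact expo_one _
  · rw [notMem_support_iff.1 hs, monomial_zero]

theorem cond_of_mem (f : MvPolynomial (Fin 2) ℂ)
    (h0 : ∀ a b : ℕ, a + b ≤ 4 → eval (pts 0) (derivOp2 a b f) = 0)
    (h : ∀ i : Fin 9, ∀ a b : ℕ, a + b ≤ 3 → eval (pts i.succ) (derivOp2 a b f) = 0)
    (c : Cnd) (hc : c ∈ cnds) :
    eval ![(c.u : ℂ) - 10, (c.v : ℂ) - 10] (derivOp2 c.a c.b f) = 0 := by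
  rw [cnds, List.mem_append, List.mem_map, List.mem_flatMap] at hc
  rcases hc with ⟨⟨a, b⟩, hq, rfl⟩ | ⟨⟨u, v⟩, hP, hq⟩
  · have h1 := h0 a b ((mem_pairs _ _ _).1 hq)
    convert h1 using 3
    simp [pts]
    norm_num
  · rw [List.mem_map] at hq
    obtain ⟨⟨a, b⟩, hq, rfl⟩ := hq
    have key : ∃ i : Fin 9, pts i.succ = ![(u : ℂ) - 10, (v : ℂ) - 10] := by
      simp only [npts, List.mem_cons, Prod.mk.injEq, List.not_mem_nil, or_false] at hP
      rcases hP with ⟨rfl, rfl⟩ | ⟨rfl, rfl⟩ | ⟨rfl, rfl⟩ | ⟨rfl, rfl⟩ | ⟨rfl, rfl⟩ | ⟨rfl, rfl⟩ |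
        ⟨rfl, rfl⟩ | ⟨rfl, rfl⟩ | ⟨rfl, rfl⟩
      · exact ⟨0, by simp [pts]; norm_num⟩
      · exact ⟨1, by simp [pts]; norm_num⟩
      · exact ⟨2, by simp [pts]; norm_num⟩
      · exact ⟨3, by simp [pts]; norm_num⟩
      · exact ⟨4, by simp [pts]; norm_num⟩
      · exact ⟨5, by simp [pts]; norm_num⟩
      · exact ⟨6, by simp [pts]; norm_num⟩
      · exact ⟨7, by simp [pts]; norm_num⟩
      · exact ⟨8, by simp [pts]; norm_num⟩
    obtain ⟨i, hi⟩ := key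
    rw [← hi]
    exact h i a b ((mem_pairs _ _ _).1 hq)

end Cert

/-- The system `L(13, 5, 9, 4)` is empty for the ten specific points `pts`: any
polynomial of degree at most 13 with multiplicity at least 5 at `pts 0` and at least 4
at `pts 1, …, pts 9` is zero.  (Hence `L(13, 5, 9, 4)` is empty for points in general
position.) -/
theorem L_13_5_9_4_empty (f : MvPolynomial (Fin 2) ℂ)
    (hdeg : f.totalDegree ≤ 13)
    (h0 : ∀ a b : ℕ, a + b ≤ 4 → eval (pts 0) (derivOp2 a b f) = 0)
    (h : ∀ i : Fin 9, ∀ a b : ℕ, a + b ≤ 3 → eval (pts i.succ) (derivOp2 a b f) = 0) :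
    f = 0 := by
  have hf := Cert.expand f hdeg
  have hdet : (Cert.M.map (Int.castRingHom ℂ)).det ≠ 0 := by
    rw [← RingHom.mapMatrix_apply, ← RingHom.map_det]
    simpa using Cert.det_M
  have hz : (fun j => coeff (Cert.expo (Cert.mon j)) f) = 0 := by
    apply Matrix.eq_zero_of_mulVec_eq_zero hdet
    ext k
    have h1 := Cert.cond_of_mem f h0 h (Cert.cnd k) (List.getElem_mem _)
    rw [hf, map_sum, map_sum] at h1
    simp only [Cert.eval_derivOp2_monomial] at h1
    rw [Matrix.mulVec, dotProduct, Pi.zero_apply, ← h1]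
    refine Finset.sum_congr rfl fun j _ => ?_
    simp [Cert.M, Cert.entryZ]
  rw [hf]
  refine Finset.sum_eq_zero fun j _ => ?_
  have := congrFun hz j
  simp only [Pi.zero_apply] at this
  rw [this, monomial_zero]
end

section
/- Let d ≥ 1, n ≥ 1, m0 ≥ 0 be integers. For nonzero vectors p0, p1, …, pn ∈ ℂ³, let V(p0, …, pn) be the ℂ-vector space of homogeneous polynomials F ∈ ℂ[x, y, z] of degree d such that all partial derivatives of F of total order < m0 vanish at p0 and all partial derivatives of total order < 4 (including F itself) vanish at each of p1, …, pn. Define ℓ = (the minimum over all tuples (p0, …, pn) of nonzero vectors of dim_ℂ V(p0, …, pn)) − 1, v = d(d+3)/2 − m0(m0+1)/2 − 10n, and e = max(−1, v). Then ℓ > e if and only if (d, m0, n) satisfies one of the following: (i) m0 = d and d ≥ 4n; (ii) m0 = d − 1 and 2d ≥ 7n; (iii) m0 = d − 2 and 3d ≥ 9n + 1; (iv) there is an integer e' ≥ 1 with (d, m0, n) equal to one of (6e', 6e'−2, 2e'), (5e', 5e'−3, 2e'), (5e'+1, 5e'−2, 2e'), (4e', 4e'−4, 2e'), (4e'+1,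 4e'−3, 2e'), (4e'+2, 4e'−2, 2e'); or (v) (d, m0, n) is one of (5,0,2), (6,1,2), (8,3,4), (9,4,4), (12,7,6), (15,10,8), (6,0,2), (6,0,3), (8,2,4), (12,6,7), (9,2,5), (8,0,5), (9,1,5), (9,0,5). -/
open MvPolynomial

/-- The differential operator `∂x^a ∂y^b ∂z^c` on `ℂ[x,y,z]`. -/
noncomputable def derivOp (a b c : ℕ) :
    MvPolynomial (Fin 3) ℂ →ₗ[ℂ] MvPolynomial (Fin 3) ℂ :=
  ((pderiv (0 : Fin 3)).toLinearMap ^ a * (pderiv (1 : Fin 3)).toLinearMap ^ b *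
    (pderiv (2 : Fin 3)).toLinearMap ^ c : Module.End ℂ (MvPolynomial (Fin 3) ℂ))

/-- The submodule of polynomials all of whose partial derivatives of total order `< m`
vanish at `p`, i.e. having multiplicity at least `m` at `p`. -/
noncomputable def multPoint (m : ℕ) (p : Fin 3 → ℂ) :
    Submodule ℂ (MvPolynomial (Fin 3) ℂ) :=
  ⨅ (a : ℕ) (b : ℕ) (c : ℕ) (_ : a + b + c < m),
    LinearMap.ker ((aeval p).toLinearMap.comp (derivOp a b c))

/-- The quasi-homogeneous linear system `L(d, m0, n, 4)` at the points `p0, p 0, …`: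
homogeneous forms of degree `d` with multiplicity at least `m0` at `p0` and at
least `4` at each `p i`. -/
noncomputable def linSys (d m0 : ℕ) {n : ℕ} (p0 : Fin 3 → ℂ) (p : Fin n → Fin 3 → ℂ) :
    Submodule ℂ (MvPolynomial (Fin 3) ℂ) :=
  homogeneousSubmodule (Fin 3) ℂ d ⊓ multPoint m0 p0 ⊓ ⨅ i, multPoint 4 (p i)

namespace QH

/-! ### Semicontinuity of injectivity -/

theorem semicont {R ι : Type} [Fintype ι] [DecidableEq ι] (M : R → ι → Polynomial ℂ)
    (h : ∀ f : ι → ℂ, (∀ r, ∑ u, f u * (M r u).eval 0 = 0) → f = 0) :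
    ∃ s : ℂ, s ≠ 0 ∧ ∀ f : ι → ℂ, (∀ r, ∑ u, f u * (M r u).eval s = 0) → f = 0 := by
  classical
  let v : R → (ι → ℂ) := fun r u => (M r u).eval 0
  have hspan : Submodule.span ℂ (Set.range v) = ⊤ := by
    by_contra hne
    obtain ⟨φ, hφ0, hφ⟩ := Submodule.exists_le_ker_of_lt_top _ (lt_top_iff_ne_top.mpr hne)
    apply hφ0
    have h0 : (fun u => φ (Pi.single u 1)) = (0 : ι → ℂ) := by
      apply h
      intro r
      have h1 : φ (v r) = 0 := hφ (Submodule.subset_span ⟨r, rfl⟩)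
      have h2 : v r = ∑ u, (v r u) • (Pi.single u (1 : ℂ) : ι → ℂ) := by
        ext x
        simp [Finset.sum_apply, Pi.single_apply]
      rw [h2, map_sum] at h1
      refine Eq.trans ?_ h1
      refine Finset.sum_congr rfl fun u _ => ?_
      simp [v, mul_comm]
    apply LinearMap.pi_ext'
    intro u
    ext
    simpa using congrFun h0 u
  obtain ⟨b, hb⟩ : ∃ e : ι → R, LinearIndependent ℂ (fun u => v (e u)) := by
    obtain ⟨b, hbs, hbspan, hbli⟩ := exists_linearIndependent ℂ (Set.range v)
    have htop : ⊤ ≤ Submodule.span ℂ (Set.range (Subtype.val : b → (ι → ℂ))) := by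
      rw [Subtype.range_coe, hbspan, hspan]
    let B := Module.Basis.mk hbli htop
    let B0 := Pi.basisFun ℂ ι
    let e := B0.indexEquiv B
    choose g hg using fun x : b => hbs x.2
    refine ⟨fun u => g (e u), ?_⟩
    have : (fun u => v (g (e u))) = (Subtype.val : b → (ι → ℂ)) ∘ e := by
      funext u; exact hg (e u)
    rw [this]
    exact hbli.comp _ e.injective
  let A : Matrix ι ι (Polynomial ℂ) := Matrix.of fun i j => M (b i) j
  have hev : ∀ s : ℂ, (A.det).eval s = (Matrix.of fun i j => (M (b i) j).eval s).det := by
    intro s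
    have := RingHom.map_det (Polynomial.evalRingHom s) A
    simpa [RingHom.mapMatrix_apply, Matrix.map, A] using this
  have hdet0 : (A.det).eval 0 ≠ 0 := by
    rw [hev]
    have := (Matrix.linearIndependent_rows_iff_isUnit
      (A := (Matrix.of fun i j => (M (b i) j).eval 0 : Matrix ι ι ℂ))).mp hb
    exact ((Matrix.isUnit_iff_isUnit_det _).mp this).ne_zero
  have hdet : A.det ≠ 0 := by
    rintro h0
    simp [h0] at hdet0
  obtain ⟨s, hs⟩ := Infinite.exists_notMem_finset (insert (0 : ℂ) A.det.roots.toFinset)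
  simp only [Finset.mem_insert, Multiset.mem_toFinset, not_or] at hs
  refine ⟨s, hs.1, fun f hf => ?_⟩
  have hsd : (A.det).eval s ≠ 0 := fun h0 => hs.2 ((Polynomial.mem_roots hdet).mpr h0)
  rw [hev] at hsd
  apply Matrix.eq_zero_of_mulVec_eq_zero hsd
  funext i
  simp only [Matrix.mulVec, dotProduct, Matrix.of_apply, Pi.zero_apply]
  refine Eq.trans ?_ (hf (b i))
  exact Finset.sum_congr rfl fun u _ => mul_comm _ _

/-! ### Conditions imposed by points on spans of monomials -/

/-- Value at the lattice point `u` of the affine function with coefficients `A`. -/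
noncomputable def aff (A : ℂ × ℂ × ℂ) (u : ℕ × ℕ) : ℂ := A.1 + A.2.1 * (u.1 : ℂ) + A.2.2 * (u.2 : ℂ)

/-- Product of three affine functions. -/
noncomputable def cub (Q : (ℂ × ℂ × ℂ) × (ℂ × ℂ × ℂ) × (ℂ × ℂ × ℂ)) (u : ℕ × ℕ) : ℂ :=
  aff Q.1 u * aff Q.2.1 u * aff Q.2.2 u

/-- Monomial with exponent `u` at the point `p`. -/
noncomputable def mon (p : ℂ × ℂ) (u : ℕ × ℕ) : ℂ := p.1 ^ u.1 * p.2 ^ u.2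

abbrev Tri := (ℂ × ℂ × ℂ) × (ℂ × ℂ × ℂ) × (ℂ × ℂ × ℂ)

/-- The `n` quadruple points can be chosen such that no nonzero polynomial supported in `E` is
quadruple at all of them. -/
def GoodF (E : Finset (ℕ × ℕ)) (n : ℕ) : Prop :=
  ∃ p : Fin n → ℂ × ℂ, (∀ k, (p k).1 ≠ 0 ∧ (p k).2 ≠ 0) ∧
    ∀ f : ℕ × ℕ → ℂ, (∀ k, ∀ Q : Tri, ∑ u ∈ E, f u * (cub Q u * mon (p k) u) = 0) →
      ∀ u ∈ E, f u = 0

theorem GoodF.mono {E E' : Finset (ℕ × ℕ)} {n : ℕ} (h : GoodF E n) (hs : E' ⊆ E) : GoodF E' n := by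
  classical
  obtain ⟨p, hp, hf⟩ := h
  refine ⟨p, hp, fun f hfv u hu => ?_⟩
  have := hf (fun u => if u ∈ E' then f u else 0) (fun k Q => by
    refine Eq.trans ?_ (hfv k Q)
    rw [← Finset.sum_subset hs]
    · exact Finset.sum_congr rfl fun u hu => by simp [hu]
    · intro u _ hu; simp [hu]) u (hs hu)
  simpa [hu] using this

/-- Main degeneration lemma. -/
theorem degen {E1 E2 : Finset (ℕ × ℕ)} {n1 n2 : ℕ} (hdisj : Disjoint E1 E2) (h1 : GoodF E1 n1)
    (α β : ℤ) (p2 : Fin n2 → ℂ × ℂ) (hp2 : ∀ k, (p2 k).1 ≠ 0 ∧ (p2 k).2 ≠ 0)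
    {R2 : Type} (row : R2 → Fin n2 × Tri) (ρ : R2 → ℤ) (col : ℕ × ℕ → ℕ)
    (h2 : ∀ r, ∀ u ∈ E1, cub (row r).2 u ≠ 0 → ρ r < α * u.1 + β * u.2)
    (h3 : ∀ r, ∀ u ∈ E2, cub (row r).2 u ≠ 0 → ρ r ≤ α * u.1 + β * u.2 + col u)
    (h4 : ∀ g : ℕ × ℕ → ℂ, (∀ r, ∑ u ∈ E2, (if α * u.1 + β * u.2 + col u = ρ r then
        g u * (cub (row r).2 u * mon (p2 (row r).1) u) else 0) = 0) → ∀ u ∈ E2, g u = 0) :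
    GoodF (E1 ∪ E2) (n1 + n2) := by
  classical
  obtain ⟨p1, hp1, hf1⟩ := h1
  let E := E1 ∪ E2
  let co : ℕ × ℕ → ℕ := fun u => if u ∈ E2 then col u else 0
  let M : (Fin n1 × Tri) ⊕ R2 → E → Polynomial ℂ := fun r u => match r with
    | .inl q => Polynomial.C (cub q.2 u * mon (p1 q.1) u) * Polynomial.X ^ (co u)
    | .inr r => Polynomial.C (cub (row r).2 u * mon (p2 (row r).1) u) *
        Polynomial.X ^ (α * u.1.1 + β * u.1.2 + co u - ρ r).toNat
  have hE2 : ∀ u ∈ E2, co u = col u := fun u hu => by simp [co, hu]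
  have hE1 : ∀ u ∈ E1, co u = 0 := fun u hu => by
    simp [co, Finset.disjoint_left.mp hdisj hu]
  have key : ∀ f : E → ℂ, (∀ r, ∑ u, f u * (M r u).eval 0 = 0) → f = 0 := by
    intro f hf
    let g : ℕ × ℕ → ℂ := fun u => if h : u ∈ E then f ⟨u, h⟩ else 0
    have hg : ∀ (F : ℕ × ℕ → ℂ), ∑ u : E, f u * F u = ∑ u ∈ E, g u * F u := by
      intro F
      rw [← Finset.sum_coe_sort E]
      refine Finset.sum_congr rfl fun u _ => ?_
      simp [g]
    have hg2 : ∀ u ∈ E2, g u = 0 := by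
      apply h4
      intro r
      have := hf (.inr r)
      simp only [M, Polynomial.eval_mul, Polynomial.eval_C, Polynomial.eval_pow,
        Polynomial.eval_X] at this
      rw [hg (fun u => (cub (row r).2 u * mon (p2 (row r).1) u *
        0 ^ (α * u.1 + β * u.2 + co u - ρ r).toNat)), Finset.sum_union hdisj] at this
      have hz : ∑ u ∈ E1, g u * (cub (row r).2 u * mon (p2 (row r).1) u *
        0 ^ (α * u.1 + β * u.2 + co u - ρ r).toNat) = 0 := by
        refine Finset.sum_eq_zero fun u hu => ?_
        by_cases hc : cub (row r).2 u = 0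
        · simp [hc]
        · have := h2 r u hu hc
          rw [zero_pow, mul_zero, mul_zero]
          rw [hE1 u hu]
          omega
      rw [hz, zero_add] at this
      refine Eq.trans ?_ this
      refine Finset.sum_congr rfl fun u hu => ?_
      rw [hE2 u hu]
      by_cases hc : cub (row r).2 u = 0
      · simp [hc]
      · have := h3 r u hu hc
        split_ifs with heq
        · have : (α * u.1 + β * u.2 + col u - ρ r).toNat = 0 := by omega
          rw [this]; simp
        · rw [zero_pow (by omega)]; simp
    have hg1 : ∀ u ∈ E1, g u = 0 := by
      apply hf1
      intro k Q
      have := hf (.inl (k, Q))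
      simp only [M, Polynomial.eval_mul, Polynomial.eval_C, Polynomial.eval_pow,
        Polynomial.eval_X] at this
      rw [hg (fun u => cub Q u * mon (p1 k) u * 0 ^ co u), Finset.sum_union hdisj] at this
      have hz : ∑ u ∈ E2, g u * (cub Q u * mon (p1 k) u * 0 ^ co u) = 0 :=
        Finset.sum_eq_zero fun u hu => by simp [hg2 u hu]
      rw [hz, add_zero] at this
      refine Eq.trans ?_ this
      refine Finset.sum_congr rfl fun u hu => ?_
      simp [hE1 u hu]
    funext u
    have : g u = 0 := by
      rcases Finset.mem_union.mp u.2 with h | h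
      · exact hg1 _ h
      · exact hg2 _ h
    simpa [g] using this
  obtain ⟨s, hs, hinj⟩ := semicont M key
  refine ⟨Fin.append p1 (fun k => (s ^ α * (p2 k).1, s ^ β * (p2 k).2)), ?_, ?_⟩
  · intro k
    refine Fin.addCases (fun i => ?_) (fun i => ?_) k
    · rw [Fin.append_left]; exact hp1 i
    · rw [Fin.append_right]
      exact ⟨mul_ne_zero (zpow_ne_zero _ hs) (hp2 i).1, mul_ne_zero (zpow_ne_zero _ hs) (hp2 i).2⟩
  · intro f hf u hu
    have := hinj (fun u => f u * (s ^ co u)⁻¹) (fun r => by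
      rcases r with ⟨k, Q⟩ | r
      · have h0 := hf (Fin.castAdd n2 k) Q
        rw [Fin.append_left, ← Finset.sum_coe_sort (E1 ∪ E2)] at h0
        refine Eq.trans ?_ h0
        refine Finset.sum_congr rfl fun u _ => ?_
        simp only [M, Polynomial.eval_mul, Polynomial.eval_C, Polynomial.eval_pow,
          Polynomial.eval_X]
        have : s ^ co u ≠ 0 := pow_ne_zero _ hs
        field_simp
      · have h0 := hf (Fin.natAdd n1 (row r).1) (row r).2
        rw [Fin.append_right, ← Finset.sum_coe_sort (E1 ∪ E2)] at h0
        have h0' := congrArg (fun z => s ^ (- ρ r) * z) h0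
        simp only [mul_zero] at h0'
        rw [Finset.mul_sum] at h0'
        refine Eq.trans ?_ h0'
        refine Finset.sum_congr rfl fun u _ => ?_
        simp only [M, Polynomial.eval_mul, Polynomial.eval_C, Polynomial.eval_pow,
          Polynomial.eval_X]
        by_cases hc : cub (row r).2 u = 0
        · simp [hc]
        have hge : ρ r ≤ α * u.1.1 + β * u.1.2 + co u := by
          rcases Finset.mem_union.mp u.2 with h | h
          · rw [hE1 _ h]; have := h2 r u h hc; push_cast; omega
          · rw [hE2 _ h]; exact h3 r u h hc
        have e1 : s ^ (α * u.1.1 + β * u.1.2 + co u - ρ r).toNat =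
            s ^ (- ρ r) * (s ^ α) ^ u.1.1 * (s ^ β) ^ u.1.2 * s ^ co u := by
          rw [← zpow_natCast, Int.toNat_of_nonneg (by omega)]
          rw [← zpow_natCast (s ^ α), ← zpow_natCast (s ^ β), ← zpow_natCast s (co u),
            ← zpow_mul, ← zpow_mul, ← zpow_add₀ hs, ← zpow_add₀ hs, ← zpow_add₀ hs]
          congr 1; ring
        rw [e1]
        have : s ^ co u ≠ 0 := pow_ne_zero _ hs
        simp only [mon, mul_pow]
        field_simp)
    have h5 := congrFun this ⟨u, hu⟩
    simp only [Pi.zero_apply, mul_eq_zero, inv_eq_zero] at h5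
    exact h5.resolve_right (pow_ne_zero _ hs)

end QH

namespace QH

/-! ### Elementary operations -/

theorem GoodF.map {E : Finset (ℕ × ℕ)} {n : ℕ} (h : GoodF E n) (φ : ℕ × ℕ → ℕ × ℕ)
    (hinj : ∀ u ∈ E, ∀ w ∈ E, φ u = φ w → u = w)
    (hm : ∀ p : ℂ × ℂ, p.1 ≠ 0 → p.2 ≠ 0 → ∃ p' : ℂ × ℂ, p'.1 ≠ 0 ∧ p'.2 ≠ 0 ∧
      ∃ c : ℂ, c ≠ 0 ∧ ∀ u ∈ E, mon p' (φ u) = c * mon p u)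
    (ha : ∀ A, ∃ A', ∀ u ∈ E, aff A' (φ u) = aff A u) : GoodF (E.image φ) n := by
  classical
  obtain ⟨p, hp, hf⟩ := h
  choose p' h1 h2 c hc h3 using fun k => hm (p k) (hp k).1 (hp k).2
  refine ⟨p', fun k => ⟨h1 k, h2 k⟩, fun f hfv u hu => ?_⟩
  obtain ⟨w, hw, rfl⟩ := Finset.mem_image.mp hu
  refine hf (fun u => f (φ u)) (fun k Q => ?_) w hw
  obtain ⟨A1, hA1⟩ := ha Q.1
  obtain ⟨A2, hA2⟩ := ha Q.2.1
  obtain ⟨A3, hA3⟩ := ha Q.2.2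
  have h0 := hfv k (A1, A2, A3)
  rw [Finset.sum_image (fun x hx y hy => hinj x hx y hy)] at h0
  have h4 : c k * ∑ u ∈ E, f (φ u) * (cub Q u * mon (p k) u) = 0 := by
    refine Eq.trans ?_ h0
    rw [Finset.mul_sum]
    refine Finset.sum_congr rfl fun u hu => ?_
    rw [h3 k u hu]
    simp only [cub, hA1 u hu, hA2 u hu, hA3 u hu]
    ring
  exact (mul_eq_zero.mp h4).resolve_left (hc k)

theorem GoodF.swap {E : Finset (ℕ × ℕ)} {n : ℕ} (h : GoodF E n) : GoodF (E.image Prod.swap) n := by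
  refine h.map _ (fun u _ w _ h => Prod.swap_injective h) (fun p h1 h2 => ?_) (fun A => ?_)
  · exact ⟨(p.2, p.1), h2, h1, 1, one_ne_zero, fun u _ => by simp [mon]; ring⟩
  · exact ⟨(A.1, A.2.2, A.2.1), fun u _ => by simp [aff]; ring⟩

/-- Translation. -/
theorem GoodF.shift {E : Finset (ℕ × ℕ)} {n : ℕ} (h : GoodF E n) (s : ℕ × ℕ) :
    GoodF (E.image (fun u => (u.1 + s.1, u.2 + s.2))) n := by
  refine h.map _ (fun u _ w _ h => ?_) (fun p h1 h2 => ?_) (fun A => ?_)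
  · simp only [Prod.mk.injEq] at h; ext <;> omega
  · exact ⟨p, h1, h2, p.1 ^ s.1 * p.2 ^ s.2, mul_ne_zero (pow_ne_zero _ h1) (pow_ne_zero _ h2),
      fun u _ => by simp only [mon, pow_add]; ring⟩
  · exact ⟨(A.1 - A.2.1 * s.1 - A.2.2 * s.2, A.2.1, A.2.2), fun u _ => by
      simp only [aff]; push_cast; ring⟩

/-- Vertical reflection. -/
theorem GoodF.refl {E : Finset (ℕ × ℕ)} {n : ℕ} (h : GoodF E n) (H : ℕ)
    (hH : ∀ u ∈ E, u.2 ≤ H) :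
    GoodF (E.image (fun u => (u.1, H - u.2))) n := by
  refine h.map _ (fun u hu w hw h => ?_) (fun p h1 h2 => ?_) (fun A => ?_)
  · simp only [Prod.mk.injEq] at h; have := hH u hu; have := hH w hw; ext <;> omega
  · refine ⟨(p.1, p.2⁻¹), h1, inv_ne_zero h2, (p.2⁻¹) ^ H, pow_ne_zero _ (inv_ne_zero h2),
      fun u hu => ?_⟩
    have e : H = (H - u.2) + u.2 := by have := hH u hu; omega
    have e2 : p.2⁻¹ ^ H = p.2⁻¹ ^ (H - u.2) * p.2⁻¹ ^ u.2 := by rw [← pow_add, ← e]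
    simp only [mon]
    rw [e2, inv_pow p.2 u.2]
    field_simp
  · refine ⟨(A.1 + A.2.2 * H, A.2.1, -A.2.2), fun u hu => ?_⟩
    simp only [aff]
    rw [Nat.cast_sub (hH u hu)]; ring

/-- Splitting a set by a line. -/
theorem GoodF.split {E1 E2 : Finset (ℕ × ℕ)} {n1 n2 : ℕ} (h1 : GoodF E1 n1) (h2 : GoodF E2 n2)
    (α β c : ℤ) (hE1 : ∀ u ∈ E1, c < α * u.1 + β * u.2) (hE2 : ∀ u ∈ E2, α * u.1 + β * u.2 ≤ c) :
    GoodF (E1 ∪ E2) (n1 + n2) := by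
  have hd : Disjoint E1 E2 := by
    rw [Finset.disjoint_left]
    intro u a b
    have := hE1 u a; have := hE2 u b; omega
  obtain ⟨p2, hp2, hf2⟩ := h2
  refine degen hd h1 α β p2 hp2 (R2 := Fin n2 × Tri) id (fun _ => c)
    (fun u => (c - (α * u.1 + β * u.2)).toNat) (fun r u hu _ => hE1 u hu) ?_ ?_
  · intro r u hu _
    have := hE2 u hu
    omega
  · intro g hg
    apply hf2
    intro k Q
    refine Eq.trans ?_ (hg (k, Q))
    refine Finset.sum_congr rfl fun u hu => ?_
    have := hE2 u hu
    rw [if_pos (by omega)]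
    rfl

theorem GoodF.more {E : Finset (ℕ × ℕ)} {n m : ℕ} (h : GoodF E n) (hm : n ≤ m) : GoodF E m := by
  obtain ⟨p, hp, hf⟩ := h
  refine ⟨fun k => if hk : k.1 < n then p ⟨k.1, hk⟩ else (1, 1), fun k => ?_, fun f hfv => ?_⟩
  · dsimp only
    split_ifs
    · exact hp _
    · simp
  · refine hf f fun k Q => ?_
    have := hfv ⟨k.1, lt_of_lt_of_le k.2 hm⟩ Q
    simpa using this

theorem goodF_empty (n : ℕ) : GoodF ∅ n :=
  ⟨fun _ => (1, 1), fun _ => by simp, fun f _ u hu => by simp at hu⟩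

/-! ### Moves -/

theorem exTri (L : List (ℂ × ℂ × ℂ)) (h : L.length ≤ 3) :
    ∃ Q : Tri, ∀ u, cub Q u = (L.map (fun A => aff A u)).prod := by
  match L, h with
  | [], _ => exact ⟨((1, 0, 0), (1, 0, 0), (1, 0, 0)), fun u => by simp [cub, aff]⟩
  | [A], _ => exact ⟨(A, (1, 0, 0), (1, 0, 0)), fun u => by simp [cub, aff]⟩
  | [A, B], _ => exact ⟨(A, B, (1, 0, 0)), fun u => by simp [cub, aff]⟩
  | [A, B, C], _ => exact ⟨(A, B, C), fun u => by simp [cub]; ring⟩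

theorem exQ (S1 S2 : Finset ℕ) (h : S1.card + S2.card ≤ 3) :
    ∃ Q : Tri, ∀ u, cub Q u ≠ 0 ↔ u.1 ∉ S1 ∧ u.2 ∉ S2 := by
  obtain ⟨Q, hQ⟩ := exTri (S1.toList.map (fun i => (-(i : ℂ), 1, 0)) ++
    S2.toList.map (fun i => (-(i : ℂ), 0, 1))) (by simpa using h)
  refine ⟨Q, fun u => ?_⟩
  rw [hQ]
  simp only [List.map_append, List.prod_append, List.map_map, ne_eq, mul_eq_zero,
    List.prod_eq_zero_iff, List.mem_map, Function.comp, not_or]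
  have e1 : ∀ i : ℕ, aff (-(i : ℂ), 1, 0) u = 0 ↔ i = u.1 := by
    intro i
    simp only [aff, one_mul, zero_mul, add_zero]
    rw [neg_add_eq_zero]; exact Nat.cast_inj
  have e2 : ∀ i : ℕ, aff (-(i : ℂ), 0, 1) u = 0 ↔ i = u.2 := by
    intro i
    simp only [aff, one_mul, zero_mul, add_zero]
    rw [neg_add_eq_zero]; exact Nat.cast_inj
  simp [e1, e2]

/-- A set with rows `0, …, H-1` of given lengths and offsets. -/
def Sh (H : ℕ) (l o : ℕ → ℕ) : Finset (ℕ × ℕ) :=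
  (Finset.range H).biUnion fun j => (Finset.Ico (o j) (o j + l j)).image (fun i => (i, j))

theorem mem_Sh {H : ℕ} {l o : ℕ → ℕ} {u : ℕ × ℕ} :
    u ∈ Sh H l o ↔ u.2 < H ∧ o u.2 ≤ u.1 ∧ u.1 < o u.2 + l u.2 := by
  simp only [Sh, Finset.mem_biUnion, Finset.mem_range, Finset.mem_image, Finset.mem_Ico]
  constructor
  · rintro ⟨j, hj, i, hi, rfl⟩; exact ⟨hj, hi⟩
  · rintro ⟨h1, h2⟩; exact ⟨u.2, h1, u.1, h2, rfl⟩

def GLi (H : ℕ) (l : ℕ → ℕ) (n : ℕ) : Prop := ∀ o, GoodF (Sh H l o) n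

theorem GLi.tmove {H : ℕ} {l v : ℕ → ℕ} {n : ℕ} (hv4 : ∀ j, v j ≤ 4)
    (hvv : ∀ j j', j < j' → v j' = 0 ∨ (v j' ≠ v j ∧ (v j' < v j ∨ l j ≤ v j)))
    (h : GLi H (fun j => l j - v j) n) : GLi H l (n + 1) := by
  classical
  intro o
  let st : ℕ → ℕ := fun j => o j + (l j - v j)
  let C : Finset (ℕ × ℕ) := Sh H (fun j => min (l j) (v j)) st
  have hdist : ∀ j j', v j = v j' → v j ≠ 0 → j = j' := by
    intro j j' h1 h2
    rcases lt_trichotomy j j' with h3 | h3 | h3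
    · have := hvv j j' h3; omega
    · exact h3
    · have := hvv j' j h3; omega
  have hC : ∀ u, u ∈ C ↔ u.2 < H ∧ st u.2 ≤ u.1 ∧ u.1 < o u.2 + l u.2 := by
    intro u; rw [mem_Sh]; simp only [st]; constructor <;> rintro ⟨a, b, c⟩ <;>
      refine ⟨a, b, ?_⟩ <;> omega
  have hCv : ∀ u ∈ C, 1 ≤ v u.2 := by
    intro u hu; have := (hC u).1 hu; simp only [st] at this; omega
  have hE : Sh H l o = Sh H (fun j => l j - v j) o ∪ C := by
    ext u
    rw [Finset.mem_union, hC, mem_Sh, mem_Sh]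
    simp only [st]
    constructor
    · rintro ⟨a, b, c⟩
      by_cases hlt : u.1 < o u.2 + (l u.2 - v u.2)
      · left; exact ⟨a, b, hlt⟩
      · right; exact ⟨a, by omega, c⟩
    · rintro (⟨a, b, c⟩ | ⟨a, b, c⟩) <;> refine ⟨a, ?_, ?_⟩ <;> omega
  have hdisj : Disjoint (Sh H (fun j => l j - v j) o) C := by
    rw [Finset.disjoint_left]; intro u a b
    rw [hC] at b; rw [mem_Sh] at a; simp only [st] at b; omega
  obtain ⟨M, hM⟩ : ∃ M : ℕ, ∀ j < H, o j + l j < M := by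
    refine ⟨(Finset.range H).sup (fun j => o j + l j) + 1, fun j hj => ?_⟩
    exact Nat.lt_succ_of_le (Finset.le_sup (f := fun j => o j + l j) (Finset.mem_range.mpr hj))
  have hst : ∀ j < H, st j < M := by
    intro j hj; have := hM j hj; simp only [st]; omega
  -- the largest row with v at least x
  let J : ℕ → ℕ := fun x => Nat.findGreatest (fun j => x ≤ v j) (H - 1)
  have hJ : ∀ u ∈ C, J (v u.2) < H ∧ v u.2 ≤ v (J (v u.2)) ∧ u.2 ≤ J (v u.2) := by
    intro u hu
    have h1 := ((hC u).1 hu).1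
    refine ⟨?_, ?_, ?_⟩
    · have := Nat.findGreatest_le (P := fun j => v u.2 ≤ v j) (H - 1)
      simp only [J]; omega
    · exact Nat.findGreatest_spec (P := fun j => v u.2 ≤ v j) (m := u.2) (by omega) le_rfl
    · exact Nat.le_findGreatest (by omega) le_rfl
  have hJmax : ∀ x j, j < H → x ≤ v j → j ≤ J x := fun x j hj hx =>
    Nat.le_findGreatest (by omega) hx
  have hQ : ∀ c : ℕ × ℕ, ∃ Q : Tri, c ∈ C → ∀ u, cub Q u ≠ 0 ↔
      u.1 ∉ (Finset.Ico (st c.2) (o c.2 + l c.2)).erase c.1 ∧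
      u.2 ∉ (Finset.range H).filter (fun j => v c.2 < v j) := by
    intro c
    by_cases hc : c ∈ C
    · have hb := (hC c).1 hc
      obtain ⟨Q, hQ⟩ := exQ ((Finset.Ico (st c.2) (o c.2 + l c.2)).erase c.1)
        ((Finset.range H).filter (fun j => v c.2 < v j)) (by
          have c1 : ((Finset.Ico (st c.2) (o c.2 + l c.2)).erase c.1).card ≤ v c.2 - 1 := by
            rw [Finset.card_erase_of_mem (by rw [Finset.mem_Ico]; exact hb.2), Nat.card_Ico]
            simp only [st]; omega
          have c2 : ((Finset.range H).filter (fun j => v c.2 < v j)).card ≤ 4 - v c.2 := by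
            have : ((Finset.range H).filter (fun j => v c.2 < v j)).card ≤
                (Finset.Ioc (v c.2) 4).card := by
              apply Finset.card_le_card_of_injOn v
              · intro j hj
                simp only [Finset.coe_filter, Set.mem_ofPred_eq] at hj
                simp only [Finset.coe_Ioc, Set.mem_Ioc]
                exact ⟨hj.2, hv4 j⟩
              · intro j hj j' hj' heq
                simp only [Finset.coe_filter, Set.mem_ofPred_eq] at hj
                exact hdist j j' heq (by omega)
            simpa using this
          have := hCv c hc; have := hv4 c.2
          omega)
      exact ⟨Q, fun _ => hQ⟩
    · exact ⟨default, fun h => absurd h hc⟩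
  choose q hq using hQ
  have hqc : ∀ c ∈ C, ∀ u ∈ C, cub (q c) u ≠ 0 → u = c ∨ v u.2 < v c.2 := by
    intro c hc u hu hne
    obtain ⟨h1, h2⟩ := (hq c hc u).1 hne
    have hbu := (hC u).1 hu
    simp only [Finset.mem_filter, Finset.mem_range, not_and, not_lt] at h2
    have h3 := h2 hbu.1
    rcases Nat.lt_or_eq_of_le h3 with h4 | h4
    · right; exact h4
    · left
      have h5 := hdist _ _ h4 (by have := hCv u hu; omega)
      rw [Finset.mem_erase, Finset.mem_Ico, ← h5] at h1
      have h6 : u.1 = c.1 := by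
        by_contra hne
        exact h1 ⟨hne, hbu.2⟩
      exact Prod.ext h6 h5
  have hcc : ∀ c ∈ C, cub (q c) c ≠ 0 := by
    intro c hc
    rw [hq c hc c]
    simp
  let ρ : ℕ × ℕ → ℤ := fun c => (M : ℤ) * (J (v c.2) : ℕ) - (st (J (v c.2)) : ℕ)
  have hρw : ∀ u ∈ C, (-1) * (u.1 : ℤ) + M * u.2 ≤ ρ u := by
    intro u hu
    obtain ⟨h1, h2, h3⟩ := hJ u hu
    have hbu := (hC u).1 hu
    have h6 := hst _ h1
    simp only [ρ]
    rcases Nat.lt_or_eq_of_le h3 with h4 | h4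
    · have : (M : ℤ) * (u.2 + 1 : ℕ) ≤ M * (J (v u.2) : ℕ) := by
        apply mul_le_mul_of_nonneg_left _ (by positivity); exact_mod_cast h4
      push_cast at this
      nlinarith
    · rw [← h4]
      have := hbu.2.1
      zify at this
      linarith
  rw [hE]
  refine degen hdisj (h o) (-1) M (fun _ => (1, 1)) (fun _ => by simp) (R2 := {c // c ∈ C})
    (fun c => (0, q c.1)) (fun c => ρ c.1) (fun u => (ρ u - ((-1) * u.1 + M * u.2)).toNat) ?_ ?_ ?_
  · rintro ⟨c, hc⟩ u hu hne
    obtain ⟨h1, h2⟩ := (hq c hc u).1 hne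
    rw [mem_Sh] at hu
    simp only [Finset.mem_filter, Finset.mem_range, not_and, not_lt] at h2
    have h3 := h2 hu.1
    have hbc := (hC c).1 hc
    obtain ⟨j1, j2, j3⟩ := hJ c hc
    have hle : J (v c.2) ≤ u.2 := by
      by_contra hgt
      have := hvv u.2 (J (v c.2)) (by omega)
      have := hCv c hc
      omega
    simp only [ρ]
    rcases Nat.lt_or_eq_of_le hle with h4 | h4
    · have : (M : ℤ) * (J (v c.2) + 1 : ℕ) ≤ M * (u.2 : ℕ) := by
        apply mul_le_mul_of_nonneg_left _ (by positivity); exact_mod_cast h4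
      push_cast at this
      have h7 := hM u.2 hu.1
      have h8 : u.1 < M := by omega
      nlinarith
    · rw [h4]
      have h8 : u.1 < st u.2 := hu.2.2
      zify at h8
      linarith
  · rintro ⟨c, hc⟩ u hu hne
    have h0 := hρw u hu
    have h00 : ρ c ≤ ρ u := by
      rcases hqc c hc u hu hne with rfl | hlt
      · exact le_rfl
      · obtain ⟨j1, j2, j3⟩ := hJ c hc
        obtain ⟨k1, k2, k3⟩ := hJ u hu
        have := hJmax (v u.2) (J (v c.2)) j1 (by omega)
        simp only [ρ]
        rcases Nat.lt_or_eq_of_le this with h4 | h4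
        · have : (M : ℤ) * (J (v c.2) + 1 : ℕ) ≤ M * (J (v u.2) : ℕ) := by
            apply mul_le_mul_of_nonneg_left _ (by positivity); exact_mod_cast h4
          push_cast at this
          have h7 := hst _ k1
          nlinarith
        · rw [h4]
    dsimp only
    omega
  · intro g hg
    have main : ∀ x, ∀ u ∈ C, v u.2 = x → g u = 0 := by
      intro x
      induction x using Nat.strong_induction_on with
      | _ x ih =>
        intro c hc hx
        have := hg ⟨c, hc⟩
        dsimp only at this
        rw [Finset.sum_eq_single c] at this
        · have h0 := hρw c hc
          rw [if_pos (by omega)] at this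
          simp only [mon, one_pow, mul_one] at this
          exact (mul_eq_zero.mp this).resolve_right (hcc c hc)
        · intro b hb hbc
          split_ifs
          · by_cases h5 : cub (q c) b = 0
            · simp [h5]
            · rcases hqc c hc b hb h5 with h6 | h6
              · exact absurd h6 hbc
              · rw [ih _ (by omega) b hb rfl]; simp
          · rfl
        · intro h; exact absurd hc h
    intro u hu
    exact main _ u hu rfl

theorem GLi.rev {H : ℕ} {l : ℕ → ℕ} {n : ℕ} (h : GLi H (fun j => l (H - 1 - j)) n) : GLi H l n := by
  intro o
  have := (h (fun j => o (H - 1 - j))).refl (H - 1) (fun u hu => by rw [mem_Sh] at hu; omega)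
  refine this.mono fun u hu => ?_
  rw [mem_Sh] at hu
  rw [Finset.mem_image]
  refine ⟨(u.1, H - 1 - u.2), ?_, ?_⟩
  · rw [mem_Sh]
    have e : H - 1 - (H - 1 - u.2) = u.2 := by omega
    simp only [e]
    exact ⟨by omega, hu.2⟩
  · have e : H - 1 - (H - 1 - u.2) = u.2 := by omega
    simp only [e]

theorem GLi.split {H : ℕ} {l lA lB : ℕ → ℕ} {n1 n2 : ℕ} (J : ℕ) (hA : ∀ j, J < j → lA j = 0)
    (hB : ∀ j, j < J → lB j = 0) (hl : ∀ j, l j ≤ lA j + lB j) (h1 : GLi H lA n1)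
    (h2 : GLi H lB n2) : GLi H l (n1 + n2) := by
  intro o
  obtain ⟨M, hM⟩ : ∃ M : ℕ, ∀ j < H, o j + lA j + lB j < M := by
    refine ⟨(Finset.range H).sup (fun j => o j + lA j + lB j) + 1, fun j hj => ?_⟩
    exact Nat.lt_succ_of_le
      (Finset.le_sup (f := fun j => o j + lA j + lB j) (Finset.mem_range.mpr hj))
  have := GoodF.split (h2 (fun j => o j + lA j)) (h1 o) 1 M (M * J + o J + lA J - 1) ?_ ?_
  · rw [add_comm]
    refine this.mono fun u hu => ?_
    rw [mem_Sh] at hu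
    rw [Finset.mem_union, mem_Sh, mem_Sh]
    have := hl u.2
    by_cases h : u.1 < o u.2 + lA u.2
    · right; exact ⟨hu.1, hu.2.1, h⟩
    · left; exact ⟨hu.1, by omega, by omega⟩
  · intro u hu
    rw [mem_Sh] at hu
    have h3 := hM u.2 hu.1
    by_cases h4 : u.2 < J
    · have := hB _ h4; omega
    · rcases Nat.lt_or_eq_of_le (not_lt.mp h4) with h5 | h5
      · have hJ := hM J (by omega)
        have : (M : ℤ) * (J + 1 : ℕ) ≤ M * (u.2 : ℕ) := by
          apply mul_le_mul_of_nonneg_left _ (by positivity); exact_mod_cast h5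
        push_cast at this
        zify at hJ
        nlinarith
      · subst h5
        have := hu.2.1
        zify at this
        linarith
  · intro u hu
    rw [mem_Sh] at hu
    have h3 := hM u.2 hu.1
    by_cases h4 : J < u.2
    · have := hA _ h4; omega
    · rcases Nat.lt_or_eq_of_le (not_lt.mp h4) with h5 | h5
      · have : (M : ℤ) * (u.2 + 1 : ℕ) ≤ M * (J : ℕ) := by
          apply mul_le_mul_of_nonneg_left _ (by positivity); exact_mod_cast h5
        push_cast at this
        have h8 : u.1 < M := by omega
        zify at h8
        nlinarith
      · subst h5
        have := hu.2.2
        zify at this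
        linarith

/-! ### Certificates -/

inductive Cert
  | done : Cert
  | T : List ℕ → Cert → Cert
  | R : Cert → Cert
  | S : ℕ → ℕ → ℕ → Cert → Cert → Cert

def subL : List ℕ → List ℕ → List ℕ
  | [], _ => []
  | L, [] => L
  | x :: L, y :: v => (x - y) :: subL L v

def okT : List ℕ → List ℕ → Bool
  | [], _ => true
  | x :: v, L => decide (x ≤ 4) &&
      (v.all fun y => decide (y = 0 ∨ (y ≠ x ∧ (y < x ∨ L.headD 0 ≤ x)))) && okT v L.tail

/-- Lower part of a split. -/
def lowL : ℕ → ℕ → List ℕ → List ℕ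
  | _, _, [] => []
  | 0, x, y :: L => min x y :: L.map (fun _ => 0)
  | J + 1, x, y :: L => y :: lowL J x L

def uppL : ℕ → ℕ → List ℕ → List ℕ
  | _, _, [] => []
  | 0, x, y :: L => (y - x) :: L
  | J + 1, x, _ :: L => 0 :: uppL J x L

def chk : Cert → List ℕ → ℕ → Bool
  | .done, L, _ => L.all fun x => decide (x = 0)
  | .T v c, L, n => decide (1 ≤ n) && (okT v L && chk c (subL L v) (n - 1))
  | .R c, L, n => chk c L.reverse n
  | .S J x n1 c1 c2, L, n => decide (n1 ≤ n) &&
      (chk c1 (lowL J x L) n1 && chk c2 (uppL J x L) (n - n1))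

theorem subL_length : ∀ L v : List ℕ, (subL L v).length = L.length
  | [], v => by simp [subL]
  | x :: L, [] => by simp [subL]
  | x :: L, y :: v => by simp [subL, subL_length L v]

theorem subL_getD : ∀ (L v : List ℕ) (j : ℕ), (subL L v).getD j 0 = L.getD j 0 - v.getD j 0
  | [], v, j => by simp [subL]
  | x :: L, [], j => by simp [subL]
  | x :: L, y :: v, 0 => by simp [subL]
  | x :: L, y :: v, j + 1 => by simpa [subL] using subL_getD L v j

theorem okT_le : ∀ (v L : List ℕ), okT v L = true → ∀ j, v.getD j 0 ≤ 4
  | [], L, _, j => by simp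
  | x :: v, L, h, 0 => by simp [okT] at h; simp; omega
  | x :: v, L, h, j + 1 => by
      simp [okT] at h
      simpa using okT_le v L.tail h.2 j

theorem okT_spec : ∀ (v L : List ℕ), okT v L = true → ∀ j j', j < j' → v.getD j' 0 = 0 ∨
    (v.getD j' 0 ≠ v.getD j 0 ∧ (v.getD j' 0 < v.getD j 0 ∨ L.getD j 0 ≤ v.getD j 0))
  | [], L, _, j, j', _ => by simp
  | x :: v, L, h, j, 0, hj => by omega
  | x :: v, L, h, 0, j' + 1, hj => by
      simp only [okT, Bool.and_eq_true, List.all_eq_true, decide_eq_true_eq] at h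
      by_cases hlt : j' < v.length
      · have := h.1.2 (v.getD j' 0) (by
          rw [List.getD_eq_getElem _ _ hlt]; exact List.getElem_mem hlt)
        simp only [List.getD_cons_succ, List.getD_cons_zero]
        cases L <;> simpa using this
      · left
        simp only [List.getD_cons_succ]
        rw [List.getD_eq_default _ _ (by omega)]
  | x :: v, L, h, j + 1, j' + 1, hj => by
      simp only [okT, Bool.and_eq_true] at h
      have := okT_spec v L.tail h.2 j j' (by omega)
      simp only [List.getD_cons_succ]
      cases L <;> simpa using this

theorem lowL_length : ∀ (J x : ℕ) (L : List ℕ), (lowL J x L).length = L.length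
  | _, _, [] => by simp [lowL]
  | 0, x, y :: L => by simp [lowL]
  | J + 1, x, y :: L => by simp [lowL, lowL_length J x L]

theorem uppL_length : ∀ (J x : ℕ) (L : List ℕ), (uppL J x L).length = L.length
  | _, _, [] => by simp [uppL]
  | 0, x, y :: L => by simp [uppL]
  | J + 1, x, y :: L => by simp [uppL, uppL_length J x L]

theorem lowL_zero : ∀ (J x : ℕ) (L : List ℕ) (j : ℕ), J < j → (lowL J x L).getD j 0 = 0
  | _, _, [], j, _ => by simp [lowL]
  | J, x, y :: L, 0, h => by omega
  | 0, x, y :: L, j + 1, h => by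
      simp only [lowL, List.getD_cons_succ]
      by_cases hlt : j < L.length
      · rw [List.getD_eq_getElem _ _ (by simpa using hlt)]; simp
      · rw [List.getD_eq_default _ _ (by simpa using hlt)]
  | J + 1, x, y :: L, j + 1, h => by
      simpa [lowL] using lowL_zero J x L j (by omega)

theorem uppL_zero : ∀ (J x : ℕ) (L : List ℕ) (j : ℕ), j < J → (uppL J x L).getD j 0 = 0
  | _, _, [], j, _ => by simp [uppL]
  | 0, x, y :: L, j, h => by omega
  | J + 1, x, y :: L, 0, h => by simp [uppL]
  | J + 1, x, y :: L, j + 1, h => by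
      simpa [uppL] using uppL_zero J x L j (by omega)

theorem low_upp : ∀ (J x : ℕ) (L : List ℕ) (j : ℕ),
    L.getD j 0 ≤ (lowL J x L).getD j 0 + (uppL J x L).getD j 0
  | _, _, [], j => by simp
  | 0, x, y :: L, 0 => by simp [lowL, uppL]; omega
  | 0, x, y :: L, j + 1 => by simp [lowL, uppL]
  | J + 1, x, y :: L, 0 => by simp [lowL, uppL]
  | J + 1, x, y :: L, j + 1 => by simpa [lowL, uppL] using low_upp J x L j

theorem chk_sound : ∀ (c : Cert) (L : List ℕ) (n : ℕ), chk c L n = true →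
    GLi L.length (fun j => L.getD j 0) n
  | .done, L, n, h => by
      intro o
      have : Sh L.length (fun j => L.getD j 0) o = ∅ := by
        apply Finset.eq_empty_of_forall_notMem
        intro u hu
        rw [mem_Sh] at hu
        simp only [chk, List.all_eq_true, decide_eq_true_eq] at h
        have := h (L.getD u.2 0) (by
          rw [List.getD_eq_getElem _ _ hu.1]; exact List.getElem_mem hu.1)
        omega
      rw [this]; exact goodF_empty n
  | .T v c, L, n, h => by
      simp only [chk, Bool.and_eq_true, decide_eq_true_eq] at h
      obtain ⟨h1, h2, h3⟩ := h
      have ih := chk_sound c _ _ h3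
      obtain ⟨m, rfl⟩ : ∃ m, n = m + 1 := ⟨n - 1, by omega⟩
      refine GLi.tmove (v := fun j => v.getD j 0) (okT_le v L h2) (okT_spec v L h2) ?_
      rw [subL_length] at ih
      simpa only [subL_getD, Nat.add_sub_cancel] using ih
  | .R c, L, n, h => by
      have ih := chk_sound c L.reverse n h
      apply GLi.rev
      rw [List.length_reverse] at ih
      intro o
      refine (ih o).mono fun u hu => ?_
      rw [mem_Sh] at hu ⊢
      rw [List.getD_eq_getElem _ _ (by rw [List.length_reverse]; exact hu.1), List.getElem_reverse]
      rw [List.getD_eq_getElem _ _ (by omega)] at hu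
      exact hu
  | .S J x n1 c1 c2, L, n, h => by
      simp only [chk, Bool.and_eq_true, decide_eq_true_eq] at h
      have i1 := chk_sound c1 _ _ h.2.1
      have i2 := chk_sound c2 _ _ h.2.2
      rw [lowL_length] at i1
      rw [uppL_length] at i2
      have := GLi.split J (lowL_zero J x L) (uppL_zero J x L) (low_upp J x L) i1 i2
      rwa [Nat.add_sub_cancel' h.1] at this

end QH

namespace QH

/-! ### Trapezoids and rectangles -/

theorem Sh_card (H : ℕ) (l o : ℕ → ℕ) : (Sh H l o).card = ∑ j ∈ Finset.range H, l j := by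
  rw [Sh, Finset.card_biUnion]
  · refine Finset.sum_congr rfl fun j _ => ?_
    rw [Finset.card_image_of_injective _ (fun x y h => (Prod.ext_iff.mp h).1)]
    simp
  · intro i _ j _ hij
    rw [Function.onFun, Finset.disjoint_left]
    intro u hu hu'
    simp only [Finset.mem_image] at hu hu'
    obtain ⟨x, _, rfl⟩ := hu
    obtain ⟨y, _, h⟩ := hu'
    exact hij (Prod.ext_iff.mp h).2.symm

/-- The exponents of forms of degree `a + k - 1` having multiplicity `a - 1` at `(0,0,1)`. -/
def TF (a k : ℕ) : Finset (ℕ × ℕ) := Sh (k + 1) (fun j => a + k - j) (fun _ => 0)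

theorem mem_TF {a k : ℕ} {u : ℕ × ℕ} : u ∈ TF a k ↔ u.2 ≤ k ∧ u.1 + u.2 < a + k := by
  rw [TF, mem_Sh]; constructor <;> intro h
  · exact ⟨by omega, by omega⟩
  · refine ⟨by omega, by omega, by omega⟩

def Rect (h w : ℕ) : Finset (ℕ × ℕ) := Sh h (fun _ => w) (fun _ => 0)

theorem mem_Rect {h w : ℕ} {u : ℕ × ℕ} : u ∈ Rect h w ↔ u.2 < h ∧ u.1 < w := by
  rw [Rect, mem_Sh]; simp

theorem TF_card (a k : ℕ) : 2 * (TF a k).card = (k + 1) * (2 * a + k) := by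
  rw [TF, Sh_card, ← Finset.sum_range_reflect]
  have : ∀ j ∈ Finset.range (k + 1), a + k - (k + 1 - 1 - j) = a + j := by
    intro j hj; rw [Finset.mem_range] at hj; omega
  rw [Finset.sum_congr rfl this, Finset.sum_add_distrib, mul_add]
  have h2 := Finset.sum_range_id_mul_two (k + 1)
  simp only [Finset.sum_const, Finset.card_range, smul_eq_mul, Nat.add_sub_cancel] at *
  nlinarith

theorem TF_mono {a a' k : ℕ} (h : a ≤ a') : TF a k ⊆ TF a' k := by
  intro u hu; rw [mem_TF] at *; omega

/-- The conditions are independent on some subset. -/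
def Surj (D : Finset (ℕ × ℕ)) (n : ℕ) : Prop := ∃ E ⊆ D, E.card = 10 * n ∧ GoodF E n

theorem Surj.toGood {D : Finset (ℕ × ℕ)} {n : ℕ} (h : Surj D n) (hc : D.card ≤ 10 * n) :
    GoodF D n := by
  obtain ⟨E, h1, h2, h3⟩ := h
  rwa [Finset.eq_of_subset_of_card_le h1 (by omega)] at h3

theorem Surj.mono {D D' : Finset (ℕ × ℕ)} {n : ℕ} (h : Surj D n) (hs : D ⊆ D') : Surj D' n := by
  obtain ⟨E, h1, h2, h3⟩ := h
  exact ⟨E, h1.trans hs, h2, h3⟩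

theorem surj_zero (D : Finset (ℕ × ℕ)) : Surj D 0 := ⟨∅, by simp, by simp, goodF_empty 0⟩

/-- Either of the two types of independence. -/
def Ty (b : Bool) (D : Finset (ℕ × ℕ)) (n : ℕ) : Prop := if b then Surj D n else GoodF D n

theorem Ty.split {b : Bool} {D1 D2 : Finset (ℕ × ℕ)} {n1 n2 : ℕ} (h1 : Ty b D1 n1)
    (h2 : Ty b D2 n2) (α β c : ℤ) (hE1 : ∀ u ∈ D1, c < α * u.1 + β * u.2)
    (hE2 : ∀ u ∈ D2, α * u.1 + β * u.2 ≤ c) : Ty b (D1 ∪ D2) (n1 + n2) := by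
  cases b
  · exact GoodF.split h1 h2 α β c hE1 hE2
  · obtain ⟨E1, a1, a2, a3⟩ := h1
    obtain ⟨E2, b1, b2, b3⟩ := h2
    refine ⟨E1 ∪ E2, Finset.union_subset_union a1 b1, ?_,
      GoodF.split a3 b3 α β c (fun u hu => hE1 u (a1 hu)) (fun u hu => hE2 u (b1 hu))⟩
    rw [Finset.card_union_of_disjoint, a2, b2]; · ring
    rw [Finset.disjoint_left]
    intro u h h'
    have := hE1 u (a1 h); have := hE2 u (b1 h'); omega

theorem Ty.shift {b : Bool} {D : Finset (ℕ × ℕ)} {n : ℕ} (h : Ty b D n) (s : ℕ × ℕ) :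
    Ty b (D.image (fun u => (u.1 + s.1, u.2 + s.2))) n := by
  cases b
  · exact GoodF.shift h s
  · obtain ⟨E, h1, h2, h3⟩ := h
    refine ⟨_, Finset.image_subset_image h1, ?_, h3.shift s⟩
    rw [Finset.card_image_of_injective _ (fun u w h => ?_), h2]
    simp only [Prod.mk.injEq] at h; ext <;> omega

theorem Ty.stackV {b : Bool} {A B D : Finset (ℕ × ℕ)} {n1 n2 : ℕ} (h1 : Ty b A n1)
    (h2 : Ty b B n2) (J : ℕ) (hA : ∀ u ∈ A, u.2 < J)
    (hD : ∀ u, u ∈ D ↔ u ∈ A ∨ (J ≤ u.2 ∧ (u.1, u.2 - J) ∈ B)) : Ty b D (n1 + n2) := by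
  have := Ty.split (h2.shift (0, J)) h1 0 1 ((J : ℤ) - 1) (fun u hu => ?_) (fun u hu => ?_)
  · rw [add_comm]
    convert this using 1
    ext u
    rw [hD, Finset.mem_union, or_comm, Finset.mem_image]
    refine or_congr_left ⟨?_, ?_⟩
    · rintro ⟨h3, h4⟩
      exact ⟨_, h4, Prod.ext (by simp) (by simp; omega)⟩
    · rintro ⟨w, hw, rfl⟩
      refine ⟨by simp, ?_⟩
      simpa using hw
  · rw [Finset.mem_image] at hu
    obtain ⟨w, _, rfl⟩ := hu
    simp only; push_cast; omega
  · have := hA u hu; omega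

theorem Ty.stackH {b : Bool} {A B D : Finset (ℕ × ℕ)} {n1 n2 : ℕ} (h1 : Ty b A n1)
    (h2 : Ty b B n2) (J : ℕ) (hA : ∀ u ∈ A, u.1 < J)
    (hD : ∀ u, u ∈ D ↔ u ∈ A ∨ (J ≤ u.1 ∧ (u.1 - J, u.2) ∈ B)) : Ty b D (n1 + n2) := by
  have := Ty.split (h2.shift (J, 0)) h1 1 0 ((J : ℤ) - 1) (fun u hu => ?_) (fun u hu => ?_)
  · rw [add_comm]
    convert this using 1
    ext u
    rw [hD, Finset.mem_union, or_comm, Finset.mem_image]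
    refine or_congr_left ⟨?_, ?_⟩
    · rintro ⟨h3, h4⟩
      exact ⟨_, h4, Prod.ext (by simp; omega) (by simp)⟩
    · rintro ⟨w, hw, rfl⟩
      refine ⟨by simp, ?_⟩
      simpa using hw
  · rw [Finset.mem_image] at hu
    obtain ⟨w, _, rfl⟩ := hu
    simp only; push_cast; omega
  · have := hA u hu; omega

theorem Ty.ofSurj {b : Bool} {D : Finset (ℕ × ℕ)} {n : ℕ} (h : Surj D n)
    (hc : D.card ≤ 10 * n) : Ty b D n := by
  cases b
  · exact h.toGood hc
  · exact h

theorem Ty.ofGood {b : Bool} {D : Finset (ℕ × ℕ)} {n : ℕ} (h : GoodF D n)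
    (hc : D.card = 10 * n) : Ty b D n := Ty.ofSurj ⟨D, subset_rfl, hc, h⟩ hc.le

theorem Ty.hor {b : Bool} {a k1 k2 n1 n2 : ℕ} (h1 : Ty b (TF (a + k2 + 1) k1) n1)
    (h2 : Ty b (TF a k2) n2) : Ty b (TF a (k1 + k2 + 1)) (n1 + n2) := by
  refine Ty.stackV h1 h2 (k1 + 1) (fun u hu => ?_) (fun u => ?_)
  · rw [mem_TF] at hu; omega
  · rw [mem_TF, mem_TF, mem_TF]
    simp only; omega

theorem Ty.rect {b : Bool} {a k w n1 n2 : ℕ} (h1 : Ty b (Rect (k + 1) w) n1)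
    (h2 : Ty b (TF a k) n2) : Ty b (TF (a + w) k) (n1 + n2) := by
  refine Ty.stackH h1 h2 w (fun u hu => ?_) (fun u => ?_)
  · rw [mem_Rect] at hu; omega
  · rw [mem_Rect, mem_TF, mem_TF]
    simp only; omega

theorem rect_addh {b : Bool} {h1 h2 w n1 n2 : ℕ} (a1 : Ty b (Rect h1 w) n1)
    (a2 : Ty b (Rect h2 w) n2) : Ty b (Rect (h1 + h2) w) (n1 + n2) := by
  refine Ty.stackV a1 a2 h1 (fun u hu => ?_) (fun u => ?_)
  · rw [mem_Rect] at hu; omega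
  · rw [mem_Rect, mem_Rect, mem_Rect]
    simp only; omega

theorem rect_addw {b : Bool} {h w1 w2 n1 n2 : ℕ} (a1 : Ty b (Rect h w1) n1)
    (a2 : Ty b (Rect h w2) n2) : Ty b (Rect h (w1 + w2)) (n1 + n2) := by
  refine Ty.stackH a1 a2 w1 (fun u hu => ?_) (fun u => ?_)
  · rw [mem_Rect] at hu; omega
  · rw [mem_Rect, mem_Rect, mem_Rect]
    simp only; omega

theorem rect_mulw {b : Bool} {h w n : ℕ} (a : Ty b (Rect h w) n) (m : ℕ) :
    Ty b (Rect h (w * m)) (n * m) := by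
  induction m with
  | zero =>
    have : Rect h (w * 0) = ∅ := by
      apply Finset.eq_empty_of_forall_notMem; intro u hu; rw [mem_Rect] at hu; omega
    rw [this]
    cases b
    · exact goodF_empty _
    · exact surj_zero _
  | succ m ih => rw [Nat.mul_succ, Nat.mul_succ]; exact rect_addw ih a

theorem rect_mulh {b : Bool} {h w n : ℕ} (a : Ty b (Rect h w) n) (m : ℕ) :
    Ty b (Rect (h * m) w) (n * m) := by
  induction m with
  | zero =>
    have : Rect (h * 0) w = ∅ := by
      apply Finset.eq_empty_of_forall_notMem; intro u hu; rw [mem_Rect] at hu; omega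
    rw [this]
    cases b
    · exact goodF_empty _
    · exact surj_zero _
  | succ m ih => rw [Nat.mul_succ, Nat.mul_succ]; exact rect_addh ih a

theorem rect_card (h w : ℕ) : (Rect h w).card = h * w := by simp [Rect, Sh_card]

/-! ### Certificates as lists of moves -/

def mvs : List (List ℕ) → Cert
  | [] => .done
  | [] :: r => .R (mvs r)
  | v :: r => .T v (mvs r)

/-- Pointwise comparison of lists. -/
def leL : List ℕ → List ℕ → Bool
  | [], _ => true
  | x :: L, [] => decide (x = 0) && leL L []
  | x :: L, y :: M => decide (x ≤ y) && leL L M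

theorem leL_getD : ∀ (L M : List ℕ), leL L M = true → ∀ j, L.getD j 0 ≤ M.getD j 0
  | [], M, _, j => by simp
  | x :: L, [], h, 0 => by simp [leL] at h; simp [h.1]
  | x :: L, [], h, j + 1 => by simp [leL] at h; simpa using leL_getD L [] h.2 j
  | x :: L, y :: M, h, 0 => by simp [leL] at h; simpa using h.1
  | x :: L, y :: M, h, j + 1 => by simp [leL] at h; simpa using leL_getD L M h.2 j

theorem GLi.le {L M : List ℕ} {n : ℕ} (h : GLi M.length (fun j => M.getD j 0) n)
    (hle : leL L M = true) : GLi L.length (fun j => L.getD j 0) n := by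
  intro o
  refine (h o).mono fun u hu => ?_
  rw [mem_Sh] at *
  have := leL_getD L M hle u.2
  refine ⟨?_, hu.2.1, by omega⟩
  by_contra hlt
  have h2 := List.getD_eq_default M 0 (not_lt.mp hlt)
  omega

theorem GLi.revL {L : List ℕ} {n : ℕ} (h : GLi L.reverse.length (fun j => L.reverse.getD j 0) n) :
    GLi L.length (fun j => L.getD j 0) n := by
  rw [List.length_reverse] at h
  apply GLi.rev
  intro o
  refine (h o).mono fun u hu => ?_
  rw [mem_Sh] at hu ⊢
  rw [List.getD_eq_getElem _ _ (by rw [List.length_reverse]; exact hu.1), List.getElem_reverse]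
  rw [List.getD_eq_getElem _ _ (by omega)] at hu
  exact hu

theorem sum_getD (L : List ℕ) : ∑ j ∈ Finset.range L.length, L.getD j 0 = L.sum := by
  induction L with
  | nil => simp
  | cons x L ih =>
    rw [List.length_cons, Finset.sum_range_succ', List.sum_cons, add_comm]
    simpa using ih

/-- Rectangles by certificates. -/
theorem rect_cert {b : Bool} (h w n : ℕ) (c : List (List ℕ))
    (hc : chk (mvs c) (List.replicate h w) n = true) (hn : h * w = 10 * n) :
    Ty b (Rect h w) n := by
  refine Ty.ofGood ?_ (by rw [rect_card, hn])
  have := chk_sound _ _ _ hc (fun _ => 0)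
  refine this.mono fun u hu => ?_
  rw [mem_Rect] at hu
  rw [mem_Sh]
  simp [hu.1, hu.2]

theorem rect_cert' (h w n : ℕ) (c : List (List ℕ))
    (hc : chk (mvs c) (List.replicate h w) n = true) :
    Ty false (Rect h w) n := by
  have := chk_sound _ _ _ hc (fun _ => 0)
  refine this.mono fun u hu => ?_
  rw [mem_Rect] at hu
  rw [mem_Sh]
  simp [hu.1, hu.2]

/-- Row lengths of trapezoids. -/
def TL (a k : ℕ) : List ℕ := (List.range (k + 1)).map fun j => a + k - j

/-- Column lengths of trapezoids. -/
def TLt (a k : ℕ) : List ℕ := (List.range (a + k)).map fun j => min (k + 1) (a + k - j)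

theorem TL_getD (a k j : ℕ) (h : j < k + 1) : (TL a k).getD j 0 = a + k - j := by
  rw [TL, List.getD_eq_getElem _ _ (by simpa using h)]; simp

theorem TLt_getD (a k j : ℕ) (h : j < a + k) : (TLt a k).getD j 0 = min (k + 1) (a + k - j) := by
  rw [TLt, List.getD_eq_getElem _ _ (by simpa using h)]; simp

theorem goodT_of_TL {a k n : ℕ} (h : GLi (TL a k).length (fun j => (TL a k).getD j 0) n) :
    GoodF (TF a k) n := by
  refine (h (fun _ => 0)).mono fun u hu => ?_
  rw [mem_TF] at hu
  rw [mem_Sh]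
  have : (TL a k).length = k + 1 := by simp [TL]
  have h2 := TL_getD a k u.2 (by omega)
  omega

theorem goodT_of_TLt {a k n : ℕ} (h : GLi (TLt a k).length (fun j => (TLt a k).getD j 0) n) :
    GoodF (TF a k) n := by
  refine (h (fun _ => 0)).swap.mono fun u hu => ?_
  rw [mem_TF] at hu
  rw [Finset.mem_image]
  refine ⟨(u.2, u.1), ?_, rfl⟩
  rw [mem_Sh]
  have : (TLt a k).length = a + k := by simp [TLt]
  simp only
  have h2 := TLt_getD a k u.1 (by omega)
  omega

theorem surjT_of_TL {a k n : ℕ} {L : List ℕ} (h : GLi L.length (fun j => L.getD j 0) n)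
    (hs : L.sum = 10 * n) (hle : leL L (TL a k) = true) : Surj (TF a k) n := by
  refine ⟨_, fun u hu => ?_, ?_, h (fun _ => 0)⟩
  · rw [mem_Sh] at hu
    rw [mem_TF]
    have h1 := leL_getD _ _ hle u.2
    by_cases h3 : u.2 < k + 1
    · have h2 := TL_getD a k u.2 h3
      omega
    · have h2 : (TL a k).getD u.2 0 = 0 :=
        List.getD_eq_default _ _ (by simp only [TL, List.length_map, List.length_range]; omega)
      omega
  · rw [Sh_card, sum_getD, hs]

theorem surjT_of_TLt {a k n : ℕ} {L : List ℕ} (h : GLi L.length (fun j => L.getD j 0) n)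
    (hs : L.sum = 10 * n) (hle : leL L (TLt a k) = true) : Surj (TF a k) n := by
  refine ⟨_, fun u hu => ?_, ?_, (h (fun _ => 0)).swap⟩
  · rw [Finset.mem_image] at hu
    obtain ⟨w, hw, rfl⟩ := hu
    rw [mem_Sh] at hw
    rw [mem_TF]
    have h1 := leL_getD _ _ hle w.2
    simp only [Prod.fst_swap, Prod.snd_swap]
    by_cases h3 : w.2 < a + k
    · have h2 := TLt_getD a k w.2 h3
      omega
    · have h2 : (TLt a k).getD w.2 0 = 0 :=
        List.getD_eq_default _ _ (by simp only [TLt, List.length_map, List.length_range]; omega)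
      omega
  · rw [Finset.card_image_of_injective _ Prod.swap_injective, Sh_card, sum_getD, hs]

/-- Row lengths in the four orientations. -/
def orient (o : ℕ) (a k : ℕ) : List ℕ :=
  match o with
  | 0 => TL a k
  | 1 => (TL a k).reverse
  | 2 => TLt a k
  | _ => (TLt a k).reverse

theorem good_orient {o a k n : ℕ}
    (h : GLi (orient o a k).length (fun j => (orient o a k).getD j 0) n) : GoodF (TF a k) n := by
  match o with
  | 0 => exact goodT_of_TL h
  | 1 => exact goodT_of_TL h.revL
  | 2 => exact goodT_of_TLt h
  | o + 3 => exact goodT_of_TLt (GLi.revL h)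

def chkI (o a k n : ℕ) (L : List ℕ) (c : Cert) : Bool :=
  leL (orient o a k) L && chk c L n

theorem chkI_sound {o a k n : ℕ} {L : List ℕ} {c : Cert} (h : chkI o a k n L c = true) :
    GoodF (TF a k) n := by
  simp only [chkI, Bool.and_eq_true] at h
  exact good_orient (GLi.le (chk_sound _ _ _ h.2) h.1)

def chkS (o a k n : ℕ) (L : List ℕ) (c : Cert) : Bool :=
  leL L (if o = 0 then TL a k else TLt a k) && (decide (L.sum = 10 * n) && chk c L n)

theorem chkS_sound {o a k n : ℕ} {L : List ℕ} {c : Cert} (h : chkS o a k n L c = true) :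
    Surj (TF a k) n := by
  simp only [chkS, Bool.and_eq_true, decide_eq_true_eq] at h
  have := chk_sound _ _ _ h.2.2
  by_cases ho : o = 0
  · rw [if_pos ho] at h
    exact surjT_of_TL this h.2.1 h.1
  · rw [if_neg ho] at h
    exact surjT_of_TLt this h.2.1 h.1

/-! ### Small rectangles -/

theorem rect_4_5 {b : Bool} : Ty b (Rect 4 5) 2 := rect_cert 4 5 2 [[4,3,2,1],[1,2,3,4]] (by decide) rfl
theorem rect_5_4 {b : Bool} : Ty b (Rect 5 4) 2 :=
  rect_cert 5 4 2 [[4,3,2,1],[0,1,2,3,4]] (by decide) rfl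
theorem rect_6_10 {b : Bool} : Ty b (Rect 6 10) 6 :=
  rect_cert 6 10 6 [[4,3,2,1],[4,3,2,1],[2,4,3,1],[],[4,3,2,1],[4,3,2,1],[],[0,0,1,3,4,2]]
   (by decide) rfl

end QH

namespace QH

theorem rect_7_10 {b : Bool} : Ty b (Rect 7 10) 7 :=
  rect_cert 7 10 7 [[4,3,2,1],[4,3,2,1],[2,4,3,1],[0,0,3,4,2,1],[],[4,3,2,1],[4,3,2,1],[],
    [0,0,0,1,4,3,2]] (by decide) rfl

theorem rect_9_10 {b : Bool} : Ty b (Rect 9 10) 9 := by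
  have h := chk_sound (mvs [[4,3,2,1],[4,3,2,1],[1,3,4,2],[0,0,1,4,3,2],[0,0,0,1,4,3,2],
    [0,0,0,0,2,4,3,1],[],[4,3,2,1],[4,3,2,1],[],[0,0,0,0,0,0,2,4,3,1]])
    (List.replicate 10 9) 9 (by decide) (fun _ => 0)
  refine Ty.ofGood (h.swap.mono fun u hu => ?_) (by rw [rect_card])
  rw [mem_Rect] at hu
  rw [Finset.mem_image]
  refine ⟨(u.2, u.1), ?_, rfl⟩
  rw [mem_Sh]
  simp only [List.length_replicate]
  refine ⟨hu.2, Nat.zero_le _, ?_⟩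
  rw [List.getD_eq_getElem _ _ (by rw [List.length_replicate]; exact hu.2), List.getElem_replicate]
  omega

theorem rect_4_10 {b : Bool} : Ty b (Rect 4 10) 4 := by
  have h : Ty b (Rect 4 (5 + 5)) (2 + 2) := rect_addw rect_4_5 rect_4_5
  norm_num at h
  exact h

theorem rect_10 {b : Bool} (h : ℕ) (hh : 6 ≤ h) : Ty b (Rect h 10) h := by
  induction h using Nat.strong_induction_on with
  | _ h ih =>
    by_cases h1 : h < 10
    · interval_cases h
      · exact rect_6_10
      · exact rect_7_10
      · have h : Ty b (Rect (4 + 4) 10) (4 + 4) := rect_addh rect_4_10 rect_4_10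
        norm_num at h
        exact h
      · exact rect_9_10
    · have h2 := rect_addh (ih (h - 4) (by omega) (by omega)) rect_4_10
      rwa [Nat.sub_add_cancel (by omega)] at h2

/-! ### Families with at most five rows -/

theorem GoodF.toTy {D : Finset (ℕ × ℕ)} {n : ℕ} (h : Ty false D n) : GoodF D n := h
theorem Ty.toSurj {D : Finset (ℕ × ℕ)} {n : ℕ} (h : Ty true D n) : Surj D n := h

theorem TF_sub_rect (a k w : ℕ) (h : a + k ≤ w) : TF a k ⊆ Rect (k + 1) w := by
  intro u hu; rw [mem_TF] at hu; rw [mem_Rect]; omega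

theorem rect_sub_TF (a k w : ℕ) (h : w ≤ a) : Rect (k + 1) w ⊆ TF a k := by
  intro u hu; rw [mem_Rect] at hu; rw [mem_TF]; omega

theorem TI (a k n : ℕ) (c : Cert) (h : chk c (TL a k) n = true) : GoodF (TF a k) n :=
  goodT_of_TL (chk_sound _ _ _ h)

theorem good0 (a n : ℕ) (h : a ≤ 4 * n) : GoodF (TF a 0) n := by
  have := rect_mulw (rect_cert' 1 4 1 [[4]] (by decide)) n
  rw [one_mul] at this
  exact GoodF.mono this (TF_sub_rect a 0 _ h)

theorem good1 (a n : ℕ) (h : 2 * a + 1 ≤ 7 * n) : GoodF (TF a 1) n := by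
  have key : ∀ e, Ty false (Rect 2 (7 * e)) (2 * e) :=
    rect_mulw (rect_cert' 2 7 2 [[4, 3], [3, 4]] (by decide))
  obtain ⟨e, rfl | rfl⟩ := n.even_or_odd'
  · exact GoodF.mono (key e) (TF_sub_rect a 1 _ (by omega))
  · have := Ty.rect (b := false) (k := 1) (key e) (TI 3 1 1 (mvs [[4, 3]]) (by decide))
    exact GoodF.mono this (TF_mono (by omega))

theorem good2 (a n : ℕ) (h : a + 1 ≤ 3 * n) (h' : ¬ (2 ∣ n ∧ a + 1 = 3 * n)) :
    GoodF (TF a 2) n := by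
  have key : ∀ e, Ty false (Rect 3 (6 * e)) (2 * e) :=
    rect_mulw (rect_cert' 3 6 2 [[4, 3, 2], [2, 3, 4]] (by decide))
  obtain ⟨e, rfl | rfl⟩ := n.even_or_odd'
  · exact GoodF.mono (key e) (TF_sub_rect a 2 _ (by omega))
  · have := Ty.rect (b := false) (k := 2) (key e) (TI 2 2 1 (mvs [[4, 3, 2]]) (by decide))
    exact GoodF.mono this (TF_mono (by omega))

theorem ty3 (b : Bool) (e : ℕ) : Ty b (TF (5 * e + 1) 3) (2 * e + 1) := by
  rw [add_comm (5 * e)]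
  exact Ty.rect (k := 3) (rect_mulw rect_4_5 e)
    (Ty.ofGood (TI 1 3 1 (mvs [[4, 3, 2, 1]]) (by decide)) (by have := TF_card 1 3; omega))

theorem ty4 (b : Bool) (e : ℕ) : Ty b (TF (4 * e) 4) (2 * e + 1) := by
  rw [← zero_add (4 * e)]
  exact Ty.rect (k := 4) (rect_mulw rect_5_4 e)
    (Ty.ofGood (TI 0 4 1 (mvs [[4, 3, 2, 1]]) (by decide)) (by have := TF_card 0 4; omega))

theorem good3 (a n : ℕ) (h : if n % 2 = 0 then a + 3 ≤ 5 * (n / 2) else a ≤ 5 * (n / 2) + 1) :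
    GoodF (TF a 3) n := by
  obtain ⟨e, rfl | rfl⟩ := n.even_or_odd'
  · rw [if_pos (by omega)] at h
    exact GoodF.mono (rect_mulw rect_4_5 e : Ty false _ _) (TF_sub_rect a 3 _ (by omega))
  · rw [if_neg (by omega)] at h
    exact GoodF.mono (ty3 false e) (TF_mono (by omega))

theorem good4 (a n : ℕ) (h : if n % 2 = 0 then a + 4 ≤ 4 * (n / 2) else a ≤ 4 * (n / 2)) :
    GoodF (TF a 4) n := by
  obtain ⟨e, rfl | rfl⟩ := n.even_or_odd'
  · rw [if_pos (by omega)] at h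
    exact GoodF.mono (rect_mulw rect_5_4 e : Ty false _ _) (TF_sub_rect a 4 _ (by omega))
  · rw [if_neg (by omega)] at h
    exact GoodF.mono (ty4 false e) (TF_mono (by omega))

theorem surj3 (a n : ℕ) (h : if n % 2 = 0 then 5 * (n / 2) ≤ a else 5 * (n / 2) + 1 ≤ a) :
    Surj (TF a 3) n := by
  obtain ⟨e, rfl | rfl⟩ := n.even_or_odd'
  · rw [if_pos (by omega)] at h
    exact Surj.mono (rect_mulw rect_4_5 e : Ty true _ _) (rect_sub_TF a 3 _ (by omega))
  · rw [if_neg (by omega)] at h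
    exact Surj.mono (ty3 true e) (TF_mono (by omega))

theorem surj4 (a n : ℕ) (h : 4 * (n / 2) ≤ a) : Surj (TF a 4) n := by
  obtain ⟨e, rfl | rfl⟩ := n.even_or_odd'
  · exact Surj.mono (rect_mulw rect_5_4 e : Ty true _ _) (rect_sub_TF a 4 _ (by omega))
  · exact Surj.mono (ty4 true e) (TF_mono (by omega))

/-! ### The inductive step -/

/-- Sporadic special systems, as triples `(m0 + 1, d - m0, n)`. -/
def spor : List (ℕ × ℕ × ℕ) := [(1,5,2),(2,5,2),(4,5,4),(5,5,4),(8,5,6),(11,5,8),(1,6,2),(1,6,3),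
  (3,6,4),(7,6,7),(3,7,5),(1,8,5),(2,8,5),(1,9,5)]

def isSp (a k n : ℕ) : Bool := spor.any fun t => t.1 == a && (t.2.1 == k && t.2.2 == n)

/-- Critical number of points. -/
def crit (b : Bool) (a k : ℕ) : ℕ :=
  if b then
    let n := (k + 1) * (2 * a + k) / 2 / 10
    if isSp a k n then n - 1 else n
  else
    let n := ((k + 1) * (2 * a + k) / 2 + 9) / 10
    if isSp a k n then n + 1 else n

/-- Known cases. -/
def kn (b : Bool) (a k n : ℕ) : Bool :=
  match k with
  | 0 => if b then n == 0 else Nat.ble a (4 * n)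
  | 1 => if b then n == 0 else Nat.ble (2 * a + 1) (7 * n)
  | 2 => if b then n == 0 else Nat.ble (a + 1) (3 * n) && !(n % 2 == 0 && a + 1 == 3 * n)
  | 3 => if b then (if n % 2 == 0 then Nat.ble (5 * (n / 2)) a else Nat.ble (5 * (n / 2) + 1) a)
      else (if n % 2 == 0 then Nat.ble (a + 3) (5 * (n / 2)) else Nat.ble a (5 * (n / 2) + 1))
  | 4 => if b then Nat.ble (4 * (n / 2)) a
      else (if n % 2 == 0 then Nat.ble (a + 4) (4 * (n / 2)) else Nat.ble a (4 * (n / 2)))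
  | k + 5 => if b then n == crit b a (k + 5) else Nat.ble (crit b a (k + 5)) n

theorem kn_sound (b : Bool) (a k n : ℕ) (h : kn b a k n = true)
    (ih : 5 ≤ k → Ty b (TF a k) (crit b a k)) : Ty b (TF a k) n := by
  match k, h, ih with
  | 0, h, _ =>
    cases b
    · exact good0 a n (by simpa [kn] using h)
    · obtain rfl : n = 0 := by simpa [kn] using h
      exact surj_zero _
  | 1, h, _ =>
    cases b
    · exact good1 a n (by simpa [kn] using h)
    · obtain rfl : n = 0 := by simpa [kn] using h
      exact surj_zero _
  | 2, h, _ =>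
    cases b
    · simp [kn] at h
      exact good2 a n h.1 (by omega)
    · obtain rfl : n = 0 := by simpa [kn] using h
      exact surj_zero _
  | 3, h, _ =>
    cases b
    · exact good3 a n (by simp [kn] at h; split_ifs at * <;> simp_all)
    · exact surj3 a n (by simp [kn] at h; split_ifs at * <;> simp_all)
  | 4, h, _ =>
    cases b
    · exact good4 a n (by simp [kn] at h; split_ifs at * <;> simp_all)
    · exact surj4 a n (by simpa [kn] using h)
  | k + 5, h, ih =>
    have := ih (by omega)
    cases b
    · exact GoodF.more this (by simpa [kn] using h)
    · obtain rfl : n = _ := by simpa [kn] using h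
      exact this

structure Entry where
  b : Bool
  a : ℕ
  k : ℕ
  n : ℕ
  o : ℕ
  L : List ℕ
  c : Cert

def entries : List Entry := [
  ⟨false, 2, 5, 3, 3, [1, 2, 3, 4, 5, 6, 6, 3],
    mvs [[1,2,3,4], [0,0,0,0,4,3,2,1], [], [2,4,3,1]]⟩,
  ⟨false, 5, 5, 5, 1, [5, 6, 7, 8, 9, 10, 5],
    mvs [[4,3,2,1], [1,3,4,2], [], [4,3,2,1], [1,4,3,2], [], [0,0,1,2,4,3]]⟩,
  ⟨true, 6, 5, 5, 0, [10, 10, 9, 8, 7, 6],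
    mvs [[], [4,3,2,1], [2,4,3,1], [], [4,3,2,1], [4,3,2,1], [], [0,0,1,3,4,2]]⟩,
  ⟨false, 7, 5, 6, 2, [6, 6, 7, 6, 6, 8, 6, 5, 4, 3, 2, 1],
    mvs [[4,3,2,1], [2,3,4,1], [0,0,1,4,3,2], [], [1,2,3,4], [0,0,0,0,4,3,2,1], [],
    [0,0,0,0,2,4,3,1]]⟩,
  ⟨false, 8, 5, 7, 1, [8, 9, 10, 11, 12, 13, 7],
    mvs [[4,3,2,1], [4,3,2,1], [0,3,4,2,1], [], [4,3,2,1], [3,4,2,1], [0,4,3,2,1], [],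
    [0,0,1,3,4,2]]⟩,
  ⟨true, 9, 5, 6, 0, [14, 13, 11, 7, 8, 7],
    mvs [[], [4,3,2,1], [3,4,2,1], [], [4,3,2,1], [4,3,2,1], [4,3,2,1], [], [0,1,0,3,4,2]]⟩,
  ⟨false, 9, 5, 7, 0, [14, 13, 12, 11, 10, 9, 1],
    mvs [[], [1,4,3,2], [0,4,3,2,1], [0,1,4,3,2], [], [4,3,2,1], [4,3,2,1], [4,3,2,1], [],
    [0,0,0,1,3,4,2]]⟩,
  ⟨true, 10, 5, 7, 0, [10, 14, 13, 12, 11, 10],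
    mvs [[], [4,3,2,1], [4,3,2,1], [2,4,3,1], [], [4,3,2,1], [4,3,2,1], [2,4,3,1], [],
    [0,1,2,3,4]]⟩,
  ⟨false, 10, 5, 8, 2, [6, 6, 6, 6, 6, 6, 6, 6, 6, 6, 5, 4, 3, 2, 1, 5],
    mvs [[4,3,2,1], [2,3,4,1], [0,0,0,4,3,2,1], [0,0,0,0,3,4,2,1], [0,0,0,0,0,0,3,4,2,1],
    [0,0,0,0,0,0,0,1,4,3,2], [], [4,1,2,3], [], [0,0,0,0,0,0,0,0,0,2,3,4,0,0,0,1]]⟩,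
  ⟨true, 12, 5, 8, 1, [6, 6, 6, 6, 6, 6, 6, 6, 6, 6, 6, 6, 5, 3],
    mvs [[4,3,2,1], [2,3,4,1], [0,0,0,4,3,2,1], [0,0,0,0,3,4,2,1], [0,0,0,0,0,0,3,4,2,1],
    [0,0,0,0,0,0,0,1,4,3,2], [], [3,4,2,1], [], [0,0,0,0,0,0,0,0,0,2,3,4,1]]⟩,
  ⟨false, 14, 5, 10, 2, [6, 6, 6, 6, 7, 6, 6, 6, 6, 6, 6, 6, 6, 6, 5, 4, 3, 2, 1],
    mvs [[4,3,2,1], [2,3,4,1], [0,0,0,4,3,2,1], [0,0,0,0,4,3,2,1], [0,0,0,0,0,1,3,4,2], [],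
    [1,2,3,4], [0,0,0,0,4,3,2,1], [0,0,0,0,1,3,4,2], [0,0,0,0,0,0,0,3,4,2,1], [],
    [0,0,0,0,0,0,0,1,3,4,2]]⟩,
  ⟨true, 15, 5, 10, 1, [6, 6, 6, 6, 6, 6, 6, 6, 6, 6, 6, 6, 6, 6, 6, 5, 4, 1],
    mvs [[4,3,2,1], [2,3,4,1], [0,0,0,4,3,2,1], [0,0,0,0,3,4,2,1], [0,0,0,0,0,0,3,4,2,1],
    [0,0,0,0,0,0,0,1,4,3,2], [0,0,0,0,0,0,0,0,0,2,4,3,1], [0,0,0,0,0,0,0,0,0,0,0,3,4,2,1],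
    [0,0,0,0,0,0,0,0,0,0,0,0,1,4,3,2], [0,0,0,0,0,0,0,0,0,0,0,0,0,0,2,3,4,1]]⟩,
  ⟨true, 18, 5, 12, 1, [6, 6, 6, 6, 6, 6, 6, 6, 6, 6, 6, 6, 6, 6, 6, 6, 6, 6, 5, 4, 3],
    mvs [[4,3,2,1], [2,3,4,1], [0,0,0,4,3,2,1], [0,0,0,0,3,4,2,1], [0,0,0,0,0,0,3,4,2,1],
    [0,0,0,0,0,0,0,1,4,3,2], [0,0,0,0,0,0,0,0,0,2,4,3,1], [0,0,0,0,0,0,0,0,0,0,0,3,4,2,1],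
    [0,0,0,0,0,0,0,0,0,0,0,0,1,4,3,2], [], [3,4,2,1], [0,0,3,4,2,1], [],
    [0,0,0,0,0,0,0,0,0,0,0,0,0,0,2,3,4,1]]⟩,
  ⟨true, 21, 5, 14, 1, [6, 6, 6, 6, 6, 6, 6, 6, 6, 6, 6, 6, 6, 6, 6, 6, 6, 6, 6, 6, 6, 5, 4,
    3, 2],
    mvs [[4,3,2,1], [2,3,4,1], [0,0,0,4,3,2,1], [0,0,0,0,3,4,2,1], [0,0,0,0,0,0,3,4,2,1],
    [0,0,0,0,0,0,0,1,4,3,2], [0,0,0,0,0,0,0,0,0,2,4,3,1], [0,0,0,0,0,0,0,0,0,0,0,3,4,2,1],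
    [0,0,0,0,0,0,0,0,0,0,0,0,1,4,3,2], [], [2,3,4,1], [0,0,0,4,3,2,1], [0,0,0,0,3,4,2,1],
    [0,0,0,0,0,0,3,4,2,1], [], [0,0,0,0,0,0,0,0,0,0,0,0,0,0,2,3,4,1]]⟩,
  ⟨true, 4, 6, 4, 0, [9, 6, 8, 5, 5, 4, 3],
    mvs [[], [3,4,2,1], [], [4,3,2,1], [4,3,2,1], [], [0,0,3,2,4,0,1]]⟩,
  ⟨false, 4, 6, 5, 3, [1, 2, 3, 4, 5, 6, 7, 7, 7, 7, 1],
    mvs [[], [1,4,3,2], [0,3,4,2,1], [], [1,2,3,4], [0,0,0,0,4,3,2,1], [], [0,0,0,2,4,3,1]]⟩,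
  ⟨false, 5, 6, 6, 1, [5, 6, 7, 8, 9, 10, 11, 4],
    mvs [[4,3,2,1], [1,3,4,2], [], [4,3,2,1], [0,4,3,2,1], [0,4,3,2,1], [], [0,0,1,3,4,2]]⟩,
  ⟨true, 6, 6, 6, 1, [4, 7, 7, 7, 7, 7, 6, 5, 4, 3, 2, 1],
    mvs [[4,3,2,1], [0,4,3,2,1], [0,0,2,4,3,1], [], [1,2,3,4], [0,0,0,0,4,3,2,1], [],
    [0,0,0,0,2,4,3,1]]⟩,
  ⟨true, 7, 6, 6, 1, [4, 7, 7, 7, 7, 7, 6, 5, 4, 3, 2, 1],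
    mvs [[4,3,2,1], [0,4,3,2,1], [0,0,2,4,3,1], [], [1,2,3,4], [0,0,0,0,4,3,2,1], [],
    [0,0,0,0,2,4,3,1]]⟩,
  ⟨true, 8, 6, 7, 0, [7, 13, 12, 11, 10, 9, 8],
    mvs [[], [4,3,2,1], [4,3,2,1], [0,3,4,2,1], [], [4,3,2,1], [3,4,2,1], [0,4,3,2,1], [],
    [0,0,1,3,4,2]]⟩,
  ⟨true, 9, 6, 8, 0, [11, 14, 13, 12, 11, 10, 9],
    mvs [[], [4,3,2,1], [4,3,2,1], [], [4,3,2,1], [4,3,2,1], [3,4,2,1], [0,4,3,2,1],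
    [0,0,4,3,2,1], [], [1,3,4,2]]⟩,
  ⟨false, 9, 6, 9, 1, [9, 10, 11, 12, 13, 14, 15, 6],
    mvs [[4,3,2,1], [4,3,2,1], [], [4,3,2,1], [2,4,3,1], [0,4,3,2,1], [0,4,3,2,1],
    [0,0,3,4,2,1], [0,0,0,3,4,2,1], [], [1,3,4,2]]⟩,
  ⟨true, 10, 6, 9, 0, [15, 15, 14, 13, 12, 11, 10],
    mvs [[], [4,3,2,1], [4,3,2,1], [2,4,3,1], [0,1,4,3,2], [], [4,3,2,1], [4,3,2,1],
    [4,3,2,1], [3,4,2,1], [], [0,0,1,3,4,2]]⟩,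
  ⟨true, 11, 6, 9, 1, [7, 7, 7, 7, 7, 7, 7, 7, 7, 7, 7, 6, 5, 2],
    mvs [[4,3,2,1], [3,4,2,1], [0,0,3,4,2,1], [0,0,0,1,4,3,2], [0,0,0,0,1,3,4,2],
    [0,0,0,0,0,0,1,4,3,2], [0,0,0,0,0,0,0,1,4,3,2], [0,0,0,0,0,0,0,0,0,2,4,3,1],
    [0,0,0,0,0,0,0,0,0,0,1,3,4,2]]⟩,
  ⟨false, 11, 6, 10, 0, [17, 16, 15, 14, 13, 12, 11, 2],
    mvs [[], [2,4,3,1], [0,4,3,2,1], [0,3,4,2,1], [0,0,2,4,3,1], [0,0,0,4,3,2,1], [],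
    [4,3,2,1], [4,3,2,1], [4,3,2,1], [4,3,2,1], [], [0,0,0,0,2,4,3,1]]⟩,
  ⟨true, 13, 6, 11, 1, [7, 7, 7, 7, 7, 7, 7, 7, 7, 7, 7, 7, 7, 6, 5, 4, 3, 1],
    mvs [[4,3,2,1], [3,4,2,1], [0,0,3,4,2,1], [0,0,0,1,4,3,2], [0,0,0,0,1,3,4,2],
    [0,0,0,0,0,0,1,4,3,2], [0,0,0,0,0,0,0,1,4,3,2], [0,0,0,0,0,0,0,0,0,2,4,3,1], [],
    [1,3,4,2], [0,0,0,3,4,2,1], [], [0,0,0,0,0,0,0,0,0,0,1,3,4,2]]⟩,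
  ⟨true, 17, 6, 14, 1, [7, 7, 7, 7, 7, 7, 7, 7, 7, 7, 7, 7, 7, 7, 7, 7, 7, 6, 5, 4, 3, 2, 1],
    mvs [[4,3,2,1], [3,4,2,1], [0,0,3,4,2,1], [0,0,0,1,4,3,2], [0,0,0,0,1,3,4,2],
    [0,0,0,0,0,0,1,4,3,2], [0,0,0,0,0,0,0,1,4,3,2], [0,0,0,0,0,0,0,0,0,2,4,3,1], [],
    [1,2,3,4], [0,0,0,0,4,3,2,1], [0,0,0,0,1,3,4,2], [0,0,0,0,0,0,1,4,3,2],
    [0,0,0,0,0,0,0,0,4,3,2,1], [], [0,0,0,0,0,0,0,0,0,0,1,3,4,2]]⟩,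
  ⟨true, 4, 7, 6, 0, [11, 10, 9, 8, 7, 6, 5, 4],
    mvs [[], [4,3,2,1], [], [4,3,2,1], [4,3,2,1], [3,4,2,1], [0,0,3,4,2,1], [], [0,2,3,4,1]]⟩,
  ⟨false, 5, 7, 7, 1, [5, 6, 7, 8, 9, 10, 11, 12, 2],
    mvs [[4,3,2,1], [1,3,4,2], [0,0,1,4,3,2], [0,0,0,1,4,3,2], [], [2,4,3,1], [0,4,3,2,1],
    [], [0,0,0,0,1,2,3,4]]⟩,
  ⟨true, 8, 7, 9, 1, [8, 8, 8, 8, 8, 8, 8, 8, 7, 6, 5, 4, 3, 1],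
    mvs [[4,3,2,1], [4,3,2,1], [0,2,4,3,1], [0,0,0,3,4,2,1], [0,0,0,0,3,4,2,1],
    [0,0,0,0,0,2,4,3,1], [], [1,3,4,2], [0,0,0,3,4,2,1], [], [0,0,0,0,0,0,1,3,4,2]]⟩,
  ⟨true, 4, 8, 7, 0, [10, 11, 10, 9, 8, 7, 6, 5, 4],
    mvs [[], [4,3,2,1], [0,2,4,3,1], [0,0,0,3,4,2,1], [0,0,0,0,3,4,2,1], [], [4,3,2,1],
    [4,3,2,1], [], [0,0,0,0,0,1,3,4,2]]⟩,
  ⟨false, 5, 8, 9, 1, [5, 6, 7, 8, 9, 10, 11, 12, 13, 9],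
    mvs [[4,3,2,1], [1,3,4,2], [0,0,1,4,3,2], [0,0,0,1,4,3,2], [0,0,0,0,2,4,3,1], [],
    [4,3,2,1], [4,3,2,1], [1,4,3,2], [], [0,0,0,0,0,1,2,4,3]]⟩,
  ⟨true, 6, 8, 9, 1, [9, 9, 9, 9, 9, 9, 8, 7, 6, 5, 4, 3, 2, 1],
    mvs [[4,3,2,1], [4,3,2,1], [1,3,4,2], [0,0,1,4,3,2], [0,0,0,1,4,3,2], [0,0,0,0,2,4,3,1],
    [], [1,2,3,4], [0,0,0,0,4,3,2,1], [], [0,0,0,0,0,0,2,4,3,1]]⟩,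
  ⟨false, 7, 8, 10, 1, [7, 8, 9, 10, 11, 12, 13, 14, 15, 1],
    mvs [[4,3,2,1], [3,4,2,1], [0,1,4,3,2], [0,0,1,4,3,2], [0,0,0,1,4,3,2],
    [0,0,0,0,2,4,3,1], [], [1,4,3,2], [0,4,3,2,1], [0,4,3,2,1], [], [0,0,0,0,0,1,2,4,3]]⟩,
  ⟨false, 8, 8, 11, 0, [16, 15, 14, 14, 13, 11, 10, 9, 8],
    mvs [[], [4,3,2,1], [4,3,2,1], [0,3,4,2,1], [0,0,2,4,3,1], [0,0,0,3,4,2,1],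
    [0,0,0,0,4,3,2,1], [0,0,0,0,1,4,3,2], [], [4,3,2,1], [4,3,2,1], [4,3,2,1], [],
    [0,0,0,0,0,1,2,3,4]]⟩,
  ⟨true, 9, 8, 11, 0, [10, 16, 15, 14, 13, 12, 11, 10, 9],
    mvs [[], [4,3,2,1], [4,3,2,1], [], [4,3,2,1], [4,3,2,1], [2,4,3,1], [0,4,3,2,1],
    [0,2,4,3,1], [0,0,1,4,3,2], [0,0,0,2,4,3,1], [0,0,0,0,4,3,2,1], [], [1,3,4,2]]⟩,
  ⟨false, 9, 8, 12, 1, [9, 10, 11, 12, 13, 14, 15, 16, 17, 3],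
    mvs [[4,3,2,1], [4,3,2,1], [1,4,3,2], [0,0,4,3,2,1], [0,0,0,4,3,2,1], [0,0,0,1,4,3,2],
    [0,0,0,0,4,3,2,1], [], [3,4,2,1], [0,4,3,2,1], [0,4,3,2,1], [0,4,3,2,1], [],
    [0,0,0,0,0,2,3,4,1]]⟩,
  ⟨true, 10, 8, 12, 0, [12, 17, 16, 15, 14, 13, 12, 11, 10],
    mvs [[], [4,3,2,1], [4,3,2,1], [2,4,3,1], [], [4,3,2,1], [4,3,2,1], [4,3,2,1],
    [0,4,3,2,1], [0,4,3,2,1], [0,0,4,3,2,1], [0,0,0,4,3,2,1], [0,0,0,1,4,3,2], [],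
    [0,1,2,4,3]]⟩,
  ⟨false, 10, 8, 13, 2, [9, 9, 9, 9, 9, 9, 9, 9, 9, 9, 8, 7, 6, 5, 4, 3, 2, 1, 4],
    mvs [[4,3,2,1], [4,3,2,1], [1,3,4,2], [0,0,1,4,3,2], [0,0,0,1,4,3,2], [0,0,0,0,2,4,3,1],
    [0,0,0,0,0,0,4,3,2,1], [0,0,0,0,0,0,0,4,3,2,1], [0,0,0,0,0,0,0,1,4,3,2],
    [0,0,0,0,0,0,0,0,0,3,4,2,1], [0,0,0,0,0,0,0,0,0,0,1,4,3,2],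
    [0,0,0,0,0,0,0,0,0,0,0,1,2,3,4], [0,0,0,0,0,0,0,0,0,0,0,0,0,0,0,3,2,1,4]]⟩,
  ⟨false, 4, 9, 9, 2, [10, 10, 10, 10, 9, 8, 7, 6, 5, 4, 3, 2, 1, 5],
    mvs [[4,3,2,1], [4,3,2,1], [2,4,3,1], [0,0,3,4,2,1], [0,0,0,3,4,2,1], [0,0,0,0,3,4,2,1],
    [0,0,0,0,0,1,4,3,2], [], [4,1,2,3], [], [0,0,0,0,0,0,0,2,3,4,0,0,0,1]]⟩,
  ⟨false, 3, 10, 9, 1, [3, 4, 5, 6, 7, 8, 9, 10, 11, 12, 13, 2],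
    mvs [[3,4,2,1], [0,0,3,4,2,1], [0,0,0,1,4,3,2], [0,0,0,0,1,4,3,2],
    [0,0,0,0,0,0,4,3,2,1], [], [2,4,3,1], [0,4,3,2,1], [0,4,3,2,1], [],
    [0,0,0,0,0,0,0,3,4,2,1]]⟩,
  ⟨true, 5, 10, 11, 0, [15, 14, 13, 12, 11, 10, 9, 8, 7, 6, 5],
    mvs [[], [4,3,2,1], [1,3,4,2], [0,0,1,4,3,2], [0,0,0,1,4,3,2], [0,0,0,0,2,4,3,1],
    [0,0,0,0,0,1,4,3,2], [0,0,0,0,0,0,2,4,3,1], [], [4,3,2,1], [4,3,2,1], [4,3,2,1], [],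
    [0,0,0,0,0,0,0,1,2,4,3]]⟩,
  ⟨true, 7, 10, 13, 0, [15, 16, 15, 14, 13, 12, 11, 10, 9, 8, 7],
    mvs [[], [4,3,2,1], [3,4,2,1], [0,1,4,3,2], [0,0,1,4,3,2], [0,0,0,1,4,3,2],
    [0,0,0,0,2,4,3,1], [0,0,0,0,0,3,4,2,1], [0,0,0,0,0,0,4,3,2,1], [0,0,0,0,0,0,0,4,3,2,1],
    [], [4,3,2,1], [4,3,2,1], [4,3,2,1], [], [0,0,0,0,0,0,0,1,3,4,2]]⟩,
  ⟨true, 3, 11, 10, 1, [12, 12, 12, 11, 10, 9, 8, 7, 6, 5, 4, 3, 1],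
    mvs [[4,3,2,1], [4,3,2,1], [4,3,2,1], [0,3,4,2,1], [0,0,2,4,3,1], [0,0,0,2,4,3,1],
    [0,0,0,0,2,4,3,1], [], [1,3,4,2], [0,0,0,3,4,2,1], [], [0,0,0,0,0,1,3,4,2]]⟩,
  ⟨true, 5, 12, 14, 0, [14, 16, 15, 14, 13, 12, 11, 10, 9, 8, 7, 6, 5],
    mvs [[], [4,3,2,1], [1,3,4,2], [0,0,1,4,3,2], [0,0,0,1,4,3,2], [0,0,0,0,2,4,3,1],
    [0,0,0,0,0,1,4,3,2], [0,0,0,0,0,0,2,4,3,1], [0,0,0,0,0,0,0,4,3,2,1],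
    [0,0,0,0,0,0,0,0,4,3,2,1], [0,0,0,0,0,0,0,0,1,4,3,2], [], [4,3,2,1], [4,3,2,1],
    [4,3,2,1], [], [0,0,0,0,0,0,0,0,0,1,3,4,2]]⟩,
  ⟨false, 10, 12, 21, 1, [10, 11, 12, 13, 14, 15, 16, 17, 18, 19, 20, 21, 22, 2],
    mvs [[4,3,2,1], [4,3,2,1], [2,4,3,1], [0,1,4,3,2], [0,0,1,4,3,2], [0,0,0,3,4,2,1],
    [0,0,0,0,4,3,2,1], [0,0,0,0,1,4,3,2], [0,0,0,0,0,4,3,2,1], [0,0,0,0,0,0,4,3,2,1],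
    [0,0,0,0,0,0,3,4,2,1], [0,0,0,0,0,0,0,4,3,2,1], [0,0,0,0,0,0,0,1,4,3,2],
    [0,0,0,0,0,0,0,0,4,3,2,1], [0,0,0,0,0,0,0,0,2,4,3,1], [], [2,4,3,1], [0,4,3,2,1],
    [0,4,3,2,1], [0,4,3,2,1], [0,4,3,2,1], [], [0,0,0,0,0,0,0,0,0,1,3,4,2]]⟩,
  ⟨true, 5, 13, 16, 0, [17, 17, 16, 15, 14, 13, 12, 11, 10, 9, 8, 7, 6, 5],
    mvs [[], [4,3,2,1], [1,3,4,2], [0,0,1,4,3,2], [0,0,0,1,4,3,2], [0,0,0,0,2,4,3,1],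
    [0,0,0,0,0,1,4,3,2], [0,0,0,0,0,0,2,4,3,1], [0,0,0,0,0,0,0,4,3,2,1],
    [0,0,0,0,0,0,0,0,4,3,2,1], [0,0,0,0,0,0,0,0,1,4,3,2], [0,0,0,0,0,0,0,0,0,4,3,2,1], [],
    [4,3,2,1], [4,3,2,1], [4,3,2,1], [4,3,2,1], [], [0,0,0,0,0,0,0,0,0,0,2,3,4,1]]⟩,
  ⟨true, 3, 14, 15, 0, [17, 16, 15, 14, 13, 12, 11, 10, 9, 8, 7, 6, 5, 4, 3],
    mvs [[], [3,4,2,1], [0,0,3,4,2,1], [0,0,0,1,4,3,2], [0,0,0,0,1,4,3,2],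
    [0,0,0,0,0,0,4,3,2,1], [0,0,0,0,0,0,0,4,3,2,1], [0,0,0,0,0,0,0,1,4,3,2],
    [0,0,0,0,0,0,0,0,2,4,3,1], [0,0,0,0,0,0,0,0,0,2,4,3,1], [0,0,0,0,0,0,0,0,0,0,3,4,2,1],
    [], [4,3,2,1], [4,3,2,1], [4,3,2,1], [4,3,2,1], [], [0,0,0,0,0,0,0,0,0,0,0,2,4,3,1]]⟩,
  ⟨false, 3, 15, 17, 1, [3, 4, 5, 6, 7, 8, 9, 10, 11, 12, 13, 14, 15, 16, 17, 18, 2],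
    mvs [[3,4,2,1], [0,0,3,4,2,1], [0,0,0,1,4,3,2], [0,0,0,0,1,4,3,2],
    [0,0,0,0,0,0,4,3,2,1], [0,0,0,0,0,0,0,4,3,2,1], [0,0,0,0,0,0,0,1,4,3,2], [], [2,4,3,1],
    [0,4,3,2,1], [0,4,3,2,1], [0,4,3,2,1], [0,2,4,3,1], [0,0,1,4,3,2], [0,0,0,2,4,3,1],
    [0,0,0,0,4,3,2,1], [0,0,0,0,0,4,3,2,1], [], [0,0,0,0,0,0,0,0,1,3,4,2]]⟩,
  ⟨true, 2, 16, 17, 0, [18, 17, 16, 15, 14, 13, 12, 11, 10, 9, 8, 7, 6, 5, 4, 3, 2],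
    mvs [[], [2,3,4,1], [0,0,0,4,3,2,1], [0,0,0,0,3,4,2,1], [0,0,0,0,0,1,4,3,2],
    [0,0,0,0,0,0,1,4,3,2], [0,0,0,0,0,0,0,1,4,3,2], [], [4,3,2,1], [4,3,2,1], [4,3,2,1],
    [4,3,2,1], [2,4,3,1], [0,1,4,3,2], [0,0,1,4,3,2], [0,0,0,3,4,2,1], [0,0,0,0,4,3,2,1],
    [0,0,0,0,1,4,3,2], [], [0,0,0,0,0,0,0,0,1,3,4,2]]⟩,
  ⟨true, 3, 19, 25, 0, [22, 21, 20, 19, 18, 17, 16, 15, 14, 13, 12, 11, 10, 9, 8, 7, 6, 5, 4, 3],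
    mvs [[], [3,4,2,1], [0,0,3,4,2,1], [0,0,0,1,4,3,2], [0,0,0,0,1,4,3,2],
    [0,0,0,0,0,0,4,3,2,1], [0,0,0,0,0,0,0,4,3,2,1], [0,0,0,0,0,0,0,1,4,3,2],
    [0,0,0,0,0,0,0,0,2,4,3,1], [0,0,0,0,0,0,0,0,0,2,4,3,1], [0,0,0,0,0,0,0,0,0,0,3,4,2,1],
    [0,0,0,0,0,0,0,0,0,0,0,4,3,2,1], [0,0,0,0,0,0,0,0,0,0,0,2,4,3,1],
    [0,0,0,0,0,0,0,0,0,0,0,0,4,3,2,1], [0,0,0,0,0,0,0,0,0,0,0,0,1,4,3,2],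
    [0,0,0,0,0,0,0,0,0,0,0,0,0,3,4,2,1], [0,0,0,0,0,0,0,0,0,0,0,0,0,0,4,3,2,1],
    [0,0,0,0,0,0,0,0,0,0,0,0,0,0,2,4,3,1], [0,0,0,0,0,0,0,0,0,0,0,0,0,0,0,4,3,2,1],
    [0,0,0,0,0,0,0,0,0,0,0,0,0,0,0,2,4,3,1], [], [4,3,2,1], [4,3,2,1], [4,3,2,1], [4,3,2,1],
    [4,3,2,1], [], [0,0,0,0,0,0,0,0,0,0,0,0,0,0,0,0,1,3,4,2]]⟩,
  ⟨true, 10, 20, 42, 0, [30, 29, 28, 27, 26, 25, 24, 23, 22, 21, 20, 19, 18, 17, 16, 15, 14,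
    13, 12, 11, 10],
    mvs [[], [4,3,2,1], [4,3,2,1], [2,4,3,1], [], [4,3,2,1], [4,3,2,1], [4,3,2,1],
    [4,3,2,1], [4,3,2,1], [4,3,2,1], [4,3,2,1], [2,4,3,1], [0,4,3,2,1], [0,0,4,3,2,1],
    [0,0,4,3,2,1], [0,0,0,4,3,2,1], [0,0,0,4,3,2,1], [0,0,0,3,4,2,1], [0,0,0,0,4,3,2,1],
    [0,0,0,0,4,3,2,1], [0,0,0,0,3,4,2,1], [0,0,0,0,0,4,3,2,1], [0,0,0,0,0,3,4,2,1],
    [0,0,0,0,0,0,4,3,2,1], [0,0,0,0,0,0,4,3,2,1], [0,0,0,0,0,0,0,4,3,2,1],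
    [0,0,0,0,0,0,0,4,3,2,1], [0,0,0,0,0,0,0,2,4,3,1], [0,0,0,0,0,0,0,0,4,3,2,1],
    [0,0,0,0,0,0,0,0,2,4,3,1], [0,0,0,0,0,0,0,0,0,4,3,2,1], [0,0,0,0,0,0,0,0,0,1,4,3,2],
    [0,0,0,0,0,0,0,0,0,0,4,3,2,1], [0,0,0,0,0,0,0,0,0,0,1,4,3,2],
    [0,0,0,0,0,0,0,0,0,0,0,4,3,2,1], [0,0,0,0,0,0,0,0,0,0,0,1,4,3,2],
    [0,0,0,0,0,0,0,0,0,0,0,0,3,4,2,1], [0,0,0,0,0,0,0,0,0,0,0,0,0,4,3,2,1],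
    [0,0,0,0,0,0,0,0,0,0,0,0,0,1,4,3,2], [0,0,0,0,0,0,0,0,0,0,0,0,0,0,4,3,2,1],
    [0,0,0,0,0,0,0,0,0,0,0,0,0,0,0,4,3,2,1], [0,0,0,0,0,0,0,0,0,0,0,0,0,0,0,2,4,3,1], [],
    [0,1,3,4,2]]⟩,
  ⟨true, 5, 8, 8, 0, [12, 12, 11, 10, 9, 8, 7, 6, 5],
    .S 4 5 5 (mvs [[4,3,2,1], [4,3,2,1], [4,3,2,1], [], [0,0,0,0,4,3,2,1], [], [0,2,3,4,1]])
    (mvs [[0,0,0,0,4,3,2,1], [0,0,0,0,0,4,3,2,1], [0,0,0,0,0,1,2,3,4]])⟩,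
  ⟨true, 2, 11, 9, 0, [13, 12, 11, 10, 9, 8, 7, 6, 5, 4, 3, 2],
    .S 4 4 5 (mvs [[4,3,2,1], [4,3,2,1], [4,3,2,1], [], [0,0,0,0,0,0,0,4,3,2,1], [],
    [1,2,3,4]]) (mvs [[0,0,0,0,4,3,2,1], [0,0,0,0,1,4,3,2], [0,0,0,0,0,1,2,3,4],
    [0,0,0,0,0,0,0,0,1,4,3,2]])⟩]

def Entry.chk (e : Entry) : Bool :=
  if e.b then chkS e.o e.a e.k e.n e.L e.c else chkI e.o e.a e.k e.n e.L e.c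

theorem Entry.sound {e : Entry} (h : e.chk = true) : Ty e.b (TF e.a e.k) e.n := by
  unfold Entry.chk at h
  cases hb : e.b
  · rw [hb] at h; exact chkI_sound h
  · rw [hb] at h; exact chkS_sound h

theorem entries_chk : entries.all Entry.chk = true := by decide +kernel

def inBase (b : Bool) (a k n : ℕ) : Bool :=
  entries.any fun e => e.b == b && (e.a == a && (e.k == k && e.n == n))

theorem inBase_sound {b : Bool} {a k n : ℕ} (h : inBase b a k n = true) : Ty b (TF a k) n := by
  simp only [inBase, List.any_eq_true, Bool.and_eq_true, beq_iff_eq] at h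
  obtain ⟨e, he, rfl, rfl, rfl, rfl⟩ := h
  exact Entry.sound (List.all_eq_true.mp entries_chk e he)

/-- Horizontal cut. -/
def stepH (b : Bool) (a k n w n1 : ℕ) : Bool :=
  Nat.ble n1 n && (kn b (a + (k - w) + 1) (w - 1) n1 && kn b a (k - w) (n - n1))

def stepR (b : Bool) (a k n w n1 : ℕ) : Bool :=
  Nat.ble (w + 1) a && (Nat.ble n1 n && kn b (a - w) k (n - n1))

def stepOK (b : Bool) (a k : ℕ) : Bool :=
  let n := crit b a k
  (!b && ((k + 1) * (2 * a + k) == 20 * n && crit true a k == n)) ||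
  ((((k + 1) % 5 == 0 && stepR b a k n 4 ((k + 1) / 5 * 2)) ||
  ((k + 1) % 4 == 0 && stepR b a k n 5 ((k + 1) / 4 * 2))) ||
  (stepR b a k n 10 (k + 1) ||
  ((List.range k).any (fun w =>
    let n1 := (w + 1) * (2 * (a + (k - (w + 1)) + 1) + w) / 2 / 10
    stepH b a k n (w + 1) n1 || stepH b a k n (w + 1) (n1 + 1)) ||
  inBase b a k n)))

theorem steps : ((List.range 25).all fun k => (List.range 21).all fun a =>
    stepOK true (a + 1) (k + 5) && stepOK false (a + 1) (k + 5)) = true := by decide +kernel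

theorem stepR_sound {b : Bool} {a k n w n1 : ℕ} (h : stepR b a k n w n1 = true)
    (hr : Ty b (Rect (k + 1) w) n1)
    (ih : ∀ a', 1 ≤ a' → a' < a → 5 ≤ k → Ty b (TF a' k) (crit b a' k)) (hw : 1 ≤ w) :
    Ty b (TF a k) n := by
  simp only [stepR, Bool.and_eq_true, Nat.ble_eq] at h
  obtain ⟨h1, h2, h3⟩ := h
  have h4 := Ty.rect hr (kn_sound b (a - w) k (n - n1) h3 (ih (a - w) (by omega) (by omega)))
  rwa [Nat.sub_add_cancel (by omega), Nat.add_sub_cancel' h2] at h4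

theorem stepH_sound {b : Bool} {a k n w n1 : ℕ} (h : stepH b a k n w n1 = true)
    (hw : 1 ≤ w) (hk : w ≤ k) (ha : 1 ≤ a)
    (ih : ∀ k' a', 1 ≤ a' → k' < k → 5 ≤ k' → Ty b (TF a' k') (crit b a' k')) :
    Ty b (TF a k) n := by
  simp only [stepH, Bool.and_eq_true, Nat.ble_eq] at h
  obtain ⟨h1, h2, h3⟩ := h
  have h4 := Ty.hor (kn_sound b _ _ _ h2 (ih _ _ (by omega) (by omega)))
    (kn_sound b _ _ _ h3 (ih _ _ ha (by omega)))
  rwa [show w - 1 + (k - w) + 1 = k by omega, Nat.add_sub_cancel' h1] at h4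

theorem stepOK_sound {b : Bool} {a k : ℕ} (h : stepOK b a k = true) (ha : 1 ≤ a) (hk : 5 ≤ k)
    (hS : b = false → Ty true (TF a k) (crit true a k))
    (ih1 : ∀ a', 1 ≤ a' → a' < a → Ty b (TF a' k) (crit b a' k))
    (ih2 : ∀ k' a', 1 ≤ a' → k' < k → 5 ≤ k' → Ty b (TF a' k') (crit b a' k')) :
    Ty b (TF a k) (crit b a k) := by
  simp only [stepOK, Bool.or_eq_true] at h
  rcases h with h | (h | h) | h | h | h
  · simp only [Bool.and_eq_true, Bool.not_eq_true', beq_iff_eq] at h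
    have h2 := hS h.1
    rw [h.2.2] at h2
    refine Ty.ofSurj h2 ?_
    have := TF_card a k
    omega
  · simp only [Bool.and_eq_true, beq_iff_eq] at h
    refine stepR_sound h.2 ?_ (fun a' h1 h2 _ => ih1 a' h1 h2) (by omega)
    have := rect_mulh (b := b) rect_5_4 ((k + 1) / 5)
    rwa [mul_comm 5, mul_comm 2, Nat.div_mul_cancel (Nat.dvd_of_mod_eq_zero h.1)] at this
  · simp only [Bool.and_eq_true, beq_iff_eq] at h
    refine stepR_sound h.2 ?_ (fun a' h1 h2 _ => ih1 a' h1 h2) (by omega)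
    have := rect_mulh (b := b) rect_4_5 ((k + 1) / 4)
    rwa [mul_comm 4, mul_comm 2, Nat.div_mul_cancel (Nat.dvd_of_mod_eq_zero h.1)] at this
  · exact stepR_sound h (rect_10 (k + 1) (by omega)) (fun a' h1 h2 _ => ih1 a' h1 h2) (by omega)
  · simp only [List.any_eq_true, List.mem_range, Bool.or_eq_true] at h
    obtain ⟨w, hw, h | h⟩ := h
    · exact stepH_sound h (by omega) (by omega) ha ih2
    · exact stepH_sound h (by omega) (by omega) ha ih2
  · exact inBase_sound h

theorem isSp_large {a k n : ℕ} (h : 12 ≤ a ∨ 10 ≤ k) : isSp a k n = false := by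
  by_contra hc
  rw [Bool.not_eq_false] at hc
  simp [isSp, spor] at hc
  omega

theorem crit_large {b : Bool} {a k : ℕ} (h : 12 ≤ a ∨ 10 ≤ k) : crit b a k =
    if b then (k + 1) * (2 * a + k) / 2 / 10 else ((k + 1) * (2 * a + k) / 2 + 9) / 10 := by
  simp [crit, isSp_large h]

theorem main_step (b : Bool) (hS : b = false → ∀ k a, 5 ≤ k → 1 ≤ a → Ty true (TF a k) (crit true a k)) :
    ∀ k a, 5 ≤ k → 1 ≤ a → Ty b (TF a k) (crit b a k) := by
  intro k
  induction k using Nat.strong_induction_on with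
  | _ k ihk =>
    intro a
    induction a using Nat.strong_induction_on with
    | _ a iha =>
      intro hk ha
      by_cases hk30 : 30 ≤ k
      · have h1 := ihk 19 (by omega) (a + (k - 20) + 1) (by omega) (by omega)
        have h2 := ihk (k - 20) (by omega) a (by omega) ha
        have h3 := Ty.hor h1 h2
        rw [show 19 + (k - 20) + 1 = k by omega] at h3
        convert h3 using 1
        rw [crit_large (by omega), crit_large (by omega), crit_large (by omega)]
        obtain ⟨j, rfl⟩ : ∃ j, k = j + 20 := ⟨k - 20, by omega⟩
        rw [Nat.add_sub_cancel]
        have e1 : (j + 20 + 1) * (2 * a + (j + 20)) =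
          (j + 1) * (2 * a + j) + 20 * (2 * (a + j + 1) + 19) := by ring
        rw [e1]
        have e2 : (19 + 1) * (2 * (a + j + 1) + 19) = 20 * (2 * (a + j + 1) + 19) := by ring
        rw [e2]
        generalize (j + 1) * (2 * a + j) = X
        generalize (2 * (a + j + 1) + 19) = Y
        split_ifs <;> omega
      · by_cases ha22 : 22 ≤ a
        · have h1 := iha (a - 10) (by omega) hk (by omega)
          have h3 := Ty.rect (rect_10 (k + 1) (by omega)) h1
          rw [Nat.sub_add_cancel (by omega)] at h3
          convert h3 using 1
          rw [crit_large (by omega), crit_large (by omega)]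
          obtain ⟨j, rfl⟩ : ∃ j, a = j + 10 := ⟨a - 10, by omega⟩
          rw [Nat.add_sub_cancel]
          have e1 : (k + 1) * (2 * (j + 10) + k) =
            (k + 1) * (2 * j + k) + 20 * (k + 1) := by ring
          rw [e1]
          generalize (k + 1) * (2 * j + k) = X
          split_ifs <;> omega
        · have h0 := List.all_eq_true.mp steps (k - 5) (by rw [List.mem_range]; omega)
          have h1 := List.all_eq_true.mp h0 (a - 1) (by rw [List.mem_range]; omega)
          rw [Nat.sub_add_cancel ha, Nat.sub_add_cancel hk, Bool.and_eq_true] at h1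
          have h2 : stepOK b a k = true := by cases b; exacts [h1.2, h1.1]
          exact stepOK_sound h2 ha hk (fun hb => hS hb k a hk ha)
            (fun a' h1 h2 => iha a' h2 hk h1) (fun k' a' h1 h2 h3 => ihk k' h2 a' h3 h1)

theorem mainS (k a : ℕ) (hk : 5 ≤ k) (ha : 1 ≤ a) : Surj (TF a k) (crit true a k) :=
  main_step true (fun h => by simp at h) k a hk ha

theorem mainI (k a : ℕ) (hk : 5 ≤ k) (ha : 1 ≤ a) : GoodF (TF a k) (crit false a k) :=
  main_step false (fun _ => mainS) k a hk ha

end QH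

namespace QH

abbrev Pol := MvPolynomial (Fin 3) ℂ

theorem pd_comm (i j : Fin 3) (F : Pol) : pderiv i (pderiv j F) = pderiv j (pderiv i F) := by
  ext s
  simp only [coeff_pderiv]
  rw [show s + Finsupp.single i 1 + Finsupp.single j 1 = s + Finsupp.single j 1 + Finsupp.single i 1
    from add_right_comm _ _ _]
  by_cases h : i = j
  · subst h; rfl
  · have h1 : (Finsupp.single i 1 : Fin 3 →₀ ℕ) j = 0 := by simp [h]
    have h2 : (Finsupp.single j 1 : Fin 3 →₀ ℕ) i = 0 := by simp [Ne.symm h]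
    simp only [Finsupp.add_apply, h1, h2, add_zero]
    ring

/-- Recursive description of having multiplicity at least `m` at `p`. -/
def isM : ℕ → (Fin 3 → ℂ) → Pol → Prop
  | 0, _, _ => True
  | m + 1, p, F => aeval p F = 0 ∧ ∀ i, isM m p (pderiv i F)

noncomputable abbrev pdl (i : Fin 3) : Module.End ℂ Pol := (pderiv i).toLinearMap

theorem pdl_comm (i j : Fin 3) : Commute (pdl i) (pdl j) := by
  apply LinearMap.ext
  intro F
  exact pd_comm i j F

theorem derivOp2 (a b c : ℕ) (F : Pol) : derivOp a b c (pderiv 2 F) = derivOp a b (c + 1) F := by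
  have : (derivOp a b c : Module.End ℂ Pol) * pdl 2 = derivOp a b (c + 1) := by
    simp only [derivOp, pow_succ, mul_assoc]
  exact LinearMap.congr_fun this F

theorem derivOp1 (a b c : ℕ) (F : Pol) : derivOp a b c (pderiv 1 F) = derivOp a (b + 1) c F := by
  have : (derivOp a b c : Module.End ℂ Pol) * pdl 1 = derivOp a (b + 1) c := by
    simp only [derivOp, pow_succ, mul_assoc]
    rw [((pdl_comm 1 2).pow_right c).eq]
  exact LinearMap.congr_fun this F

theorem derivOp0 (a b c : ℕ) (F : Pol) : derivOp a b c (pderiv 0 F) = derivOp (a + 1) b c F := by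
  have : (derivOp a b c : Module.End ℂ Pol) * pdl 0 = derivOp (a + 1) b c := by
    simp only [derivOp, pow_succ, mul_assoc]
    rw [← ((pdl_comm 0 2).pow_right c).eq, ← mul_assoc (pdl 1 ^ b), ← mul_assoc (pdl 0),
      ((pdl_comm 0 1).pow_right b).eq]
  exact LinearMap.congr_fun this F

theorem mem_multPoint {m : ℕ} {p : Fin 3 → ℂ} {F : Pol} :
    F ∈ multPoint m p ↔ ∀ a b c, a + b + c < m → aeval p (derivOp a b c F) = 0 := by
  simp [multPoint, Submodule.mem_iInf]

theorem derivOp_zero (F : Pol) : derivOp 0 0 0 F = F := by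
  simp [derivOp]

theorem mem_mult {m : ℕ} {p : Fin 3 → ℂ} {F : Pol} : F ∈ multPoint m p ↔ isM m p F := by
  rw [mem_multPoint]
  induction m generalizing F with
  | zero => simp [isM]
  | succ m ih =>
    simp only [isM, ← ih]
    constructor
    · intro h
      refine ⟨by simpa [derivOp_zero] using h 0 0 0 (by omega), ?_⟩
      intro i a b c habc
      fin_cases i
      · simpa [← derivOp0] using h (a + 1) b c (by omega)
      · simpa [← derivOp1] using h a (b + 1) c (by omega)
      · simpa [← derivOp2] using h a b (c + 1) (by omega)
    · rintro ⟨h0, h⟩ a b c habc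
      rcases c with _ | c
      · rcases b with _ | b
        · rcases a with _ | a
          · simpa [derivOp_zero] using h0
          · rw [← derivOp0]; exact h 0 a 0 0 (by omega)
        · rw [← derivOp1]; exact h 1 a b 0 (by omega)
      · rw [← derivOp2]; exact h 2 a b c (by omega)

theorem isM.succ {m : ℕ} {p : Fin 3 → ℂ} {F : Pol} (h : isM (m + 1) p F) : isM m p F := by
  induction m generalizing F with
  | zero => trivial
  | succ m ih => exact ⟨h.1, fun i => ih (h.2 i)⟩

theorem isM.add {m : ℕ} {p : Fin 3 → ℂ} {F G : Pol} (h : isM m p F) (h' : isM m p G) :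
    isM m p (F + G) := by
  rw [← mem_mult] at *
  exact Submodule.add_mem _ h h'

theorem isM.sub {m : ℕ} {p : Fin 3 → ℂ} {F G : Pol} (h : isM m p F) (h' : isM m p G) :
    isM m p (F - G) := by
  rw [← mem_mult] at *
  exact Submodule.sub_mem _ h h'

theorem isM.mul {m k : ℕ} {p : Fin 3 → ℂ} {F G : Pol} (h : isM m p F) (h' : isM k p G) :
    isM (m + k) p (F * G) := by
  obtain ⟨N, hN⟩ : ∃ N, m + k = N := ⟨_, rfl⟩
  induction N generalizing m k F G with
  | zero => rw [hN]; trivial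
  | succ N ih =>
    rw [hN]
    refine ⟨?_, fun i => ?_⟩
    · rw [map_mul]
      rcases m with _ | m
      · rcases k with _ | k
        · omega
        · rw [h'.1, mul_zero]
      · rw [h.1, zero_mul]
    · rw [pderiv_mul]
      apply isM.add
      · rcases m with _ | m
        · obtain rfl : k = N + 1 := by omega
          have := ih (m := 0) (k := N) (F := pderiv i F) trivial h'.succ (by omega)
          rwa [zero_add] at this
        · have := ih (h.2 i) h' (by omega)
          rwa [show m + k = N by omega] at this
      · rcases k with _ | k
        · obtain rfl : m = N + 1 := by omega
          have := ih (m := N) (k := 0) (G := pderiv i G) h.succ trivial (by omega)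
          rwa [add_zero] at this
        · have := ih h (h'.2 i) (by omega)
          rwa [show m + k = N by omega] at this

theorem isM.mulL {m : ℕ} {p : Fin 3 → ℂ} {F : Pol} (h : isM m p F) (G : Pol) :
    isM m p (G * F) := by
  have := isM.mul (m := 0) (F := G) trivial h
  rwa [zero_add] at this

theorem isM.cancelX {m : ℕ} {p : Fin 3 → ℂ} {G : Pol} {l : Fin 3} (hl : p l ≠ 0)
    (h : isM m p (X l * G)) : isM m p G := by
  induction m generalizing G with
  | zero => trivial
  | succ m ih =>
    have hG : isM m p G := ih h.succ
    refine ⟨?_, fun i => ?_⟩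
    · have := h.1
      rw [map_mul, aeval_X] at this
      exact (mul_eq_zero.mp this).resolve_left hl
    · apply ih
      have h2 := h.2 i
      rw [pderiv_mul] at h2
      have h3 := isM.sub h2 (hG.mulL (pderiv i (X l)))
      rwa [add_sub_cancel_left] at h3

/-- first-order operator -/
noncomputable def Top (A : ℂ × ℂ × ℂ) (F : Pol) : Pol :=
  C A.1 * F + (C A.2.1 * (X 0 * pderiv 0 F) + C A.2.2 * (X 2 * pderiv 2 F))

theorem isM.Top {m : ℕ} {p : Fin 3 → ℂ} {F : Pol} (h : isM (m + 1) p F) (A : ℂ × ℂ × ℂ) :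
    isM m p (Top A F) :=
  (h.succ.mulL _).add ((((h.2 0).mulL _).mulL _).add (((h.2 2).mulL _).mulL _))

theorem coeff_Xpd (i : Fin 3) (F : Pol) (s : Fin 3 →₀ ℕ) :
    coeff s (X i * pderiv i F) = s i * coeff s F := by
  rw [coeff_X_mul']
  split_ifs with h
  · rw [coeff_pderiv]
    have h1 : 1 ≤ s i := by
      rw [Finsupp.mem_support_iff] at h; omega
    have h2 : s - Finsupp.single i 1 + Finsupp.single i 1 = s :=
      tsub_add_cancel_of_le (by simpa using h1)
    rw [h2]
    have h3 : (s - Finsupp.single i 1 : Fin 3 →₀ ℕ) i = s i - 1 := by simp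
    rw [h3, Nat.cast_sub h1]
    push_cast
    ring
  · rw [Finsupp.notMem_support_iff] at h
    simp [h]

theorem coeff_Top (A : ℂ × ℂ × ℂ) (F : Pol) (s : Fin 3 →₀ ℕ) :
    coeff s (Top A F) = (A.1 + A.2.1 * s 0 + A.2.2 * s 2) * coeff s F := by
  simp only [Top, coeff_add, coeff_C_mul, coeff_Xpd]
  ring

/-- exponents -/
noncomputable def ex (d : ℕ) (u : ℕ × ℕ) : Fin 3 →₀ ℕ :=
  Finsupp.equivFunOnFinite.symm ![u.1, d - u.1 - u.2, u.2]

@[simp] theorem ex0 (d : ℕ) (u : ℕ × ℕ) : ex d u 0 = u.1 := rfl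
@[simp] theorem ex1 (d : ℕ) (u : ℕ × ℕ) : ex d u 1 = d - u.1 - u.2 := rfl
@[simp] theorem ex2 (d : ℕ) (u : ℕ × ℕ) : ex d u 2 = u.2 := rfl

theorem ex_inj (d : ℕ) : Function.Injective (ex d) := by
  intro u v h
  have h0 := DFunLike.congr_fun h 0
  have h2 := DFunLike.congr_fun h 2
  simp only [ex0, ex2] at h0 h2
  exact Prod.ext h0 h2

theorem degree3 (s : Fin 3 →₀ ℕ) : s.degree = s 0 + s 1 + s 2 := by
  rw [Finsupp.degree_eq_sum, Fin.sum_univ_three]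

theorem eq_ex {d : ℕ} {s : Fin 3 →₀ ℕ} (h : s.degree = d) : s = ex d (s 0, s 2) := by
  rw [degree3] at h
  ext i
  fin_cases i
  · rfl
  · simp; omega
  · rfl

theorem coeff_p0 {m d : ℕ} {F : Pol} (hF : F.IsHomogeneous d) (h : isM m ![0, 0, 1] F)
    {s : Fin 3 →₀ ℕ} (hs : s 0 + s 1 < m) : coeff s F = 0 := by
  induction m generalizing d F s with
  | zero => omega
  | succ m ih =>
    by_cases hd : s.degree = d
    swap
    · exact hF.coeff_eq_zero hd
    by_cases h0 : s 0 = 0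
    · by_cases h1 : s 1 = 0
      · have he := h.1
        rw [aeval_def, eval₂_eq', Finset.sum_eq_single s] at he
        · simpa [Fin.prod_univ_three, h0, h1] using he
        · intro t ht hts
          have htd : t.degree = d := by
            by_contra hc
            exact (mem_support_iff.mp ht) (hF.coeff_eq_zero hc)
          by_cases ht0 : t 0 = 0
          · by_cases ht1 : t 1 = 0
            · exfalso; apply hts
              rw [degree3] at hd htd
              ext i; fin_cases i <;> simp <;> omega
            · simp [Fin.prod_univ_three, ht1]
          · simp [Fin.prod_univ_three, ht0]
        · intro hs
          simp [notMem_support_iff.mp hs]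
      · have h2 : s - Finsupp.single 1 1 + Finsupp.single 1 1 = s :=
          tsub_add_cancel_of_le (by simp; omega)
        have h3 := ih hF.pderiv (h.2 1) (s := s - Finsupp.single 1 1) (by simp [h0]; omega)
        rw [coeff_pderiv, h2] at h3
        refine (mul_eq_zero.mp h3).resolve_right ?_
        exact Nat.cast_add_one_ne_zero _
    · have h2 : s - Finsupp.single 0 1 + Finsupp.single 0 1 = s :=
        tsub_add_cancel_of_le (by simp; omega)
      have h3 := ih hF.pderiv (h.2 0) (s := s - Finsupp.single 0 1) (by simp; omega)
      rw [coeff_pderiv, h2] at h3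
      refine (mul_eq_zero.mp h3).resolve_right ?_
      exact Nat.cast_add_one_ne_zero _

end QH

namespace QH

abbrev Hom (d : ℕ) : Submodule ℂ Pol := homogeneousSubmodule (Fin 3) ℂ d

instance homFin (d : ℕ) : FiniteDimensional ℂ (Hom d) :=
  Module.Finite.iff_fg.mpr (homogeneousSubmodule_fg _ _ _)

theorem finOf {d : ℕ} {W : Submodule ℂ Pol} (h : W ≤ Hom d) : FiniteDimensional ℂ W :=
  Submodule.finiteDimensional_of_le h

/-- uniform systems -/
noncomputable def Sys (d m0 m : ℕ) {n : ℕ} (p0 : Fin 3 → ℂ) (p : Fin n → Fin 3 → ℂ) :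
    Submodule ℂ Pol :=
  Hom d ⊓ multPoint m0 p0 ⊓ ⨅ i, multPoint m (p i)

theorem Sys_le {d m0 m n : ℕ} {p0 : Fin 3 → ℂ} {p : Fin n → Fin 3 → ℂ} :
    Sys d m0 m p0 p ≤ Hom d := inf_le_left.trans inf_le_left

theorem mem_Sys {d m0 m n : ℕ} {p0 : Fin 3 → ℂ} {p : Fin n → Fin 3 → ℂ} {F : Pol} :
    F ∈ Sys d m0 m p0 p ↔ F.IsHomogeneous d ∧ isM m0 p0 F ∧ ∀ i, isM m (p i) F := by
  simp only [Sys, Submodule.mem_inf, Submodule.mem_iInf, mem_mult, mem_homogeneousSubmodule,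
    and_assoc]

/-! ### Codimension of a multiplicity condition -/

theorem isM_of_two {i j l : Fin 3} (hij : ∀ f : Fin 3 → Pol, ∑ t, f t = f i + f j + f l)
    (hall : ∀ t, t = i ∨ t = j ∨ t = l)
    {p : Fin 3 → ℂ} (hl : p l ≠ 0) (m : ℕ) {d : ℕ} {F : Pol} (hF : F.IsHomogeneous d)
    (h : ∀ a b, a + b < m → aeval p ((pdl i ^ a * pdl j ^ b) F) = 0) : isM m p F := by
  induction m generalizing d F with
  | zero => trivial
  | succ m ih =>
    have hFm : isM m p F := ih hF (fun a b hab => h a b (by omega))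
    have hi : isM m p (pderiv i F) := by
      apply ih hF.pderiv
      intro a b hab
      have := h (a + 1) b (by omega)
      have e : pdl i ^ (a + 1) * pdl j ^ b = (pdl i ^ a * pdl j ^ b) * pdl i := by
        rw [pow_succ, mul_assoc, ((pdl_comm i j).pow_right b).eq, mul_assoc]
      rw [e] at this
      exact this
    have hj : isM m p (pderiv j F) := by
      apply ih hF.pderiv
      intro a b hab
      have := h a (b + 1) (by omega)
      rw [pow_succ, ← mul_assoc] at this
      exact this
    have hl' : isM m p (pderiv l F) := by
      apply isM.cancelX hl
      have he := hF.sum_X_mul_pderiv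
      rw [hij] at he
      have e2 : X l * pderiv l F = d • F - X i * pderiv i F - X j * pderiv j F := by
        rw [← he]; ring
      rw [e2, nsmul_eq_mul]
      exact ((hFm.mulL _).sub (hi.mulL _)).sub (hj.mulL _)
    refine ⟨by simpa using h 0 0 (by omega), fun t => ?_⟩
    rcases hall t with rfl | rfl | rfl <;> assumption

theorem codim {d m : ℕ} {p : Fin 3 → ℂ} (hp : p ≠ 0) {W : Submodule ℂ Pol} (hW : W ≤ Hom d) :
    2 * Module.finrank ℂ W ≤ 2 * Module.finrank ℂ ↥(W ⊓ multPoint m p) + m * (m + 1) := by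
  obtain ⟨i, j, l, hij, hall, hl⟩ : ∃ i j l : Fin 3,
      (∀ f : Fin 3 → Pol, ∑ t, f t = f i + f j + f l) ∧ (∀ t, t = i ∨ t = j ∨ t = l) ∧ p l ≠ 0 := by
    obtain ⟨l, hl⟩ := Function.ne_iff.mp hp
    fin_cases l
    · exact ⟨1, 2, 0, fun f => by rw [Fin.sum_univ_three]; ring, by decide, hl⟩
    · exact ⟨0, 2, 1, fun f => by rw [Fin.sum_univ_three]; ring, by decide, hl⟩
    · exact ⟨0, 1, 2, fun f => by rw [Fin.sum_univ_three], by decide, hl⟩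
  have := finOf hW
  let I := Σ s : Fin m, Fin (s.1 + 1)
  let φ : W →ₗ[ℂ] (I → ℂ) := LinearMap.pi fun q =>
    ((aeval p).toLinearMap.comp (pdl i ^ q.2.1 * pdl j ^ (q.1.1 - q.2.1))).comp W.subtype
  have hker : (LinearMap.ker φ).map W.subtype ≤ W ⊓ multPoint m p := by
    rintro _ ⟨F, hF, rfl⟩
    refine ⟨F.2, ?_⟩
    rw [SetLike.mem_coe, mem_mult]
    apply isM_of_two hij hall hl m (hW F.2)
    intro a b hab
    have := congrFun (LinearMap.mem_ker.mp hF) ⟨⟨a + b, hab⟩, ⟨a, by simp⟩⟩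
    simpa [φ] using this
  have h1 := LinearMap.finrank_range_add_finrank_ker φ
  have h2 : Module.finrank ℂ (LinearMap.range φ) ≤ Fintype.card I := by
    have := Submodule.finrank_le (LinearMap.range φ)
    rwa [Module.finrank_fintype_fun_eq_card] at this
  have h3 : 2 * Fintype.card I = m * (m + 1) := by
    have e : Fintype.card I = ∑ s ∈ Finset.range m, (s + 1) := by
      rw [Fintype.card_sigma, ← Fin.sum_univ_eq_sum_range (fun s => s + 1)]
      simp
    have e2 := Finset.sum_range_succ' (fun s => s) m
    simp only [add_zero] at e2
    rw [e, ← e2, mul_comm, Finset.sum_range_id_mul_two, Nat.add_sub_cancel, mul_comm]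
  have h4 : Module.finrank ℂ (LinearMap.ker φ) ≤ Module.finrank ℂ ↥(W ⊓ multPoint m p) := by
    have : FiniteDimensional ℂ ↥(W ⊓ multPoint m p) := finOf (inf_le_left.trans hW)
    rw [← Submodule.finrank_map_subtype_eq W (LinearMap.ker φ)]
    exact Submodule.finrank_mono hker
  omega

theorem codims {d m : ℕ} {ι : Type} (s : Finset ι) {p : ι → Fin 3 → ℂ} (hp : ∀ i, p i ≠ 0)
    {W : Submodule ℂ Pol} (hW : W ≤ Hom d) :
    2 * Module.finrank ℂ W ≤ 2 * Module.finrank ℂ ↥(W ⊓ ⨅ i ∈ s, multPoint m (p i))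
      + s.card * (m * (m + 1)) := by
  classical
  induction s using Finset.induction_on with
  | empty =>
    have e : W ⊓ ⨅ i ∈ (∅ : Finset ι), multPoint m (p i) = W := by simp
    rw [e]
    omega
  | insert a s ha ih =>
    rw [Finset.card_insert_of_notMem ha, Finset.iInf_insert]
    have h1 := codim (m := m) (hp a) (W := W ⊓ ⨅ i ∈ s, multPoint m (p i)) (inf_le_left.trans hW)
    rw [show W ⊓ (multPoint m (p a) ⊓ ⨅ i ∈ s, multPoint m (p i)) =
      (W ⊓ ⨅ i ∈ s, multPoint m (p i)) ⊓ multPoint m (p a) by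
        rw [inf_assoc, inf_comm (multPoint m (p a))]]
    nlinarith

theorem finrank_Hom (d : ℕ) : (d + 1) * (d + 2) ≤ 2 * Module.finrank ℂ (Hom d) := by
  let g : TF 1 d → Hom d := fun u => ⟨monomial (ex d u.1) 1, by
    apply isHomogeneous_monomial
    have := mem_TF.mp u.2
    rw [degree3, ex0, ex1, ex2]
    omega⟩
  have hli : LinearIndependent ℂ g := by
    apply LinearIndependent.of_comp (Hom d).subtype
    have h := (basisMonomials (Fin 3) ℂ).linearIndependent.comp (fun u : TF 1 d => ex d u.1)
      ((ex_inj d).comp Subtype.val_injective)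
    have e : ⇑(basisMonomials (Fin 3) ℂ) ∘ (fun u : TF 1 d => ex d u.1) = (Hom d).subtype ∘ g := by
      ext u : 1
      simp [g]
    rw [e] at h
    exact h
  have h1 := hli.fintype_card_le_finrank
  rw [Fintype.card_coe] at h1
  have h2 := TF_card 1 d
  rw [show 2 * 1 + d = d + 2 by ring] at h2
  omega

theorem Sys_lower {d m0 m n : ℕ} {p0 : Fin 3 → ℂ} {p : Fin n → Fin 3 → ℂ} (h0 : p0 ≠ 0)
    (hp : ∀ i, p i ≠ 0) : (d + 1) * (d + 2) ≤
      2 * Module.finrank ℂ (Sys d m0 m p0 p) + m0 * (m0 + 1) + n * (m * (m + 1)) := by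
  have h1 := finrank_Hom d
  have h2 := codim (m := m0) h0 (le_refl (Hom d))
  have h3 := codims (m := m) Finset.univ hp (W := Hom d ⊓ multPoint m0 p0) inf_le_left
  have h5 : ⨅ i ∈ (Finset.univ : Finset (Fin n)), multPoint m (p i) = ⨅ i, multPoint m (p i) := by
    simp
  rw [h5, Finset.card_univ, Fintype.card_fin] at h3
  have h4 : Sys d m0 m p0 p = Hom d ⊓ multPoint m0 p0 ⊓ ⨅ i, multPoint m (p i) := rfl
  rw [h4]
  omega

theorem Sys_mul {d m0 m d1 m1 μ1 d2 m2 μ2 n : ℕ} {p0 : Fin 3 → ℂ} {p : Fin n → Fin 3 → ℂ} {G : Pol}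
    (hG : G ∈ Sys d1 m1 μ1 p0 p) (hG0 : G ≠ 0) (hd : d1 + d2 = d) (hm0 : m1 + m2 = m0)
    (hm : μ1 + μ2 = m) :
    Module.finrank ℂ (Sys d2 m2 μ2 p0 p) ≤ Module.finrank ℂ (Sys d m0 m p0 p) := by
  subst hd hm0 hm
  have := finOf (Sys_le (d := d1 + d2) (m0 := m1 + m2) (m := μ1 + μ2) (p0 := p0) (p := p))
  let φ : Pol →ₗ[ℂ] Pol := LinearMap.mulLeft ℂ G
  have hinj : Function.Injective φ := fun a b h => mul_left_cancel₀ hG0 h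
  have hmem : ∀ F ∈ Sys d2 m2 μ2 p0 p, φ F ∈ Sys (d1 + d2) (m1 + m2) (μ1 + μ2) p0 p := by
    intro F hF
    rw [mem_Sys] at *
    exact ⟨hG.1.mul hF.1, hG.2.1.mul hF.2.1, fun i => (hG.2.2 i).mul (hF.2.2 i)⟩
  apply LinearMap.finrank_le_finrank_of_injective (f := φ.restrict hmem)
  intro a b h
  exact Subtype.ext (hinj (congrArg Subtype.val h))

end QH

namespace QH

theorem aeval_ex {d : ℕ} {E : Finset (ℕ × ℕ)} {G : Pol} (q : ℂ × ℂ)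
    (h : ∀ s, coeff s G ≠ 0 → ∃ u ∈ E, ex d u = s) :
    aeval ![q.1, 1, q.2] G = ∑ u ∈ E, coeff (ex d u) G * mon q u := by
  classical
  rw [aeval_def, eval₂_eq']
  have hs : G.support ⊆ E.image (ex d) := by
    intro s hs
    rw [Finset.mem_image]
    exact h s (mem_support_iff.mp hs)
  rw [Finset.sum_subset hs, Finset.sum_image (fun a _ b _ hab => ex_inj d hab)]
  · refine Finset.sum_congr rfl fun u _ => ?_
    simp [Fin.prod_univ_three, mon]
  · intro s _ hs
    rw [notMem_support_iff.mp hs]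
    simp

theorem good_kill {d n : ℕ} {E : Finset (ℕ × ℕ)} {F : Pol} {q : Fin n → ℂ × ℂ}
    (hq : ∀ f : ℕ × ℕ → ℂ, (∀ k, ∀ Q : Tri, ∑ u ∈ E, f u * (cub Q u * mon (q k) u) = 0) →
      ∀ u ∈ E, f u = 0)
    (h : ∀ s, coeff s F ≠ 0 → ∃ u ∈ E, ex d u = s)
    (hM : ∀ i, isM 4 ![(q i).1, 1, (q i).2] F) : F = 0 := by
  have h0 := hq (fun u => coeff (ex d u) F) (by
    intro k Q
    have h1 := (((hM k).Top Q.2.2).Top Q.2.1).Top Q.1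
    have h2 := h1.1
    rw [aeval_ex (d := d) (E := E)] at h2
    · refine Eq.trans ?_ h2
      refine Finset.sum_congr rfl fun u _ => ?_
      simp only [coeff_Top, ex0, ex2, cub, aff]
      ring
    · intro s hs
      apply h
      intro hc
      simp [coeff_Top, hc] at hs)
  ext s
  by_contra hs
  rw [coeff_zero] at hs
  obtain ⟨u, hu, rfl⟩ := h s hs
  exact hs (h0 u hu)

theorem supp_TF {m0 k : ℕ} {F : Pol} (hF : F.IsHomogeneous (m0 + k)) (h : isM m0 ![0, 0, 1] F)
    (s : Fin 3 →₀ ℕ) (hs : coeff s F ≠ 0) : ∃ u ∈ TF (m0 + 1) k, ex (m0 + k) u = s := by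
  have hd : s.degree = m0 + k := by
    by_contra hc
    exact hs (hF.coeff_eq_zero hc)
  refine ⟨(s 0, s 2), ?_, (eq_ex hd).symm⟩
  have h1 : ¬ s 0 + s 1 < m0 := fun hc => hs (coeff_p0 hF h hc)
  rw [degree3] at hd
  rw [mem_TF]
  dsimp only
  omega

theorem upper {m0 k n : ℕ} {E : Finset (ℕ × ℕ)} (hE : E ⊆ TF (m0 + 1) k) (h : GoodF E n) :
    ∃ p : Fin n → Fin 3 → ℂ, (∀ i, p i ≠ 0) ∧
      Module.finrank ℂ (Sys (m0 + k) m0 4 ![0, 0, 1] p) + E.card ≤ (TF (m0 + 1) k).card := by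
  classical
  obtain ⟨q, _, hq⟩ := h
  refine ⟨fun i => ![(q i).1, 1, (q i).2], fun i hi => ?_, ?_⟩
  · have := congrFun hi 1
    simp at this
  · set V := Sys (m0 + k) m0 4 ![0, 0, 1] (fun i => ![(q i).1, 1, (q i).2]) with hV
    let φ : V →ₗ[ℂ] (↥(TF (m0 + 1) k \ E) → ℂ) := LinearMap.pi fun u =>
      (lcoeff ℂ (ex (m0 + k) u.1)).comp V.subtype
    have hφ : Function.Injective φ := by
      rw [injective_iff_map_eq_zero]
      intro F hF
      have hmem := mem_Sys.mp F.2
      apply Subtype.ext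
      refine good_kill (d := m0 + k) (E := E) hq ?_ hmem.2.2
      intro s hs
      obtain ⟨u, hu, rfl⟩ := supp_TF hmem.1 hmem.2.1 s hs
      refine ⟨u, ?_, rfl⟩
      by_contra hc
      apply hs
      have := congrFun hF ⟨u, Finset.mem_sdiff.mpr ⟨hu, hc⟩⟩
      simpa [φ] using this
    have h1 := LinearMap.finrank_le_finrank_of_injective hφ
    rw [Module.finrank_fintype_fun_eq_card, Fintype.card_coe] at h1
    have h2 := Finset.card_sdiff_add_card_eq_card hE
    omega

theorem upperS {m0 k n n0 : ℕ} (h : Surj (TF (m0 + 1) k) n0) (hn : n ≤ n0) :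
    ∃ p : Fin n → Fin 3 → ℂ, (∀ i, p i ≠ 0) ∧
      Module.finrank ℂ (Sys (m0 + k) m0 4 ![0, 0, 1] p) + 10 * n ≤ (TF (m0 + 1) k).card := by
  obtain ⟨E, hE, hc, hg⟩ := h
  obtain ⟨p, hp, hr⟩ := upper hE hg
  obtain ⟨r, rfl⟩ := Nat.exists_eq_add_of_le hn
  refine ⟨fun i => p (Fin.castAdd r i), fun i => hp _, ?_⟩
  have h1 := codims (m := 4) Finset.univ (p := fun i : Fin r => p (Fin.natAdd n i)) (fun i => hp _)
    (Sys_le (d := m0 + k) (m0 := m0) (m := 4) (p0 := ![0, 0, 1]) (p := fun i => p (Fin.castAdd r i)))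
  have h2 : Sys (m0 + k) m0 4 ![0, 0, 1] (fun i => p (Fin.castAdd r i)) ⊓
      ⨅ i ∈ (Finset.univ : Finset (Fin r)), multPoint 4 (p (Fin.natAdd n i)) =
      Sys (m0 + k) m0 4 ![0, 0, 1] p := by
    ext F
    simp only [Submodule.mem_inf, mem_Sys, Submodule.mem_iInf, mem_mult, Finset.mem_univ,
      forall_true_left, and_assoc]
    rw [Fin.forall_fin_add]
  rw [h2, Finset.card_univ, Fintype.card_fin] at h1
  omega

theorem upper_big {d m0 n : ℕ} (h : d < m0) (p : Fin n → Fin 3 → ℂ) :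
    Module.finrank ℂ (Sys d m0 4 ![0, 0, 1] p) = 0 := by
  have : Sys d m0 4 ![0, 0, 1] p = ⊥ := by
    rw [eq_bot_iff]
    intro F hF
    have hmem := mem_Sys.mp hF
    rw [Submodule.mem_bot]
    ext s
    rw [coeff_zero]
    by_cases hs : s.degree = d
    · apply coeff_p0 hmem.1 hmem.2.1
      rw [degree3] at hs
      omega
    · exact hmem.1.coeff_eq_zero hs
  rw [this, finrank_bot]

end QH

namespace QH

/-- existence of a nonzero member of a system -/
def NZ {n : ℕ} (p0 : Fin 3 → ℂ) (p : Fin n → Fin 3 → ℂ) (d m0 m : ℕ) : Prop :=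
  ∃ G ∈ Sys d m0 m p0 p, G ≠ 0

section

variable {n : ℕ} {p0 : Fin 3 → ℂ} {p : Fin n → Fin 3 → ℂ}

theorem NZ.of (h0 : p0 ≠ 0) (hp : ∀ i, p i ≠ 0) {d m0 m : ℕ}
    (h : m0 * (m0 + 1) + n * (m * (m + 1)) < (d + 1) * (d + 2)) : NZ p0 p d m0 m := by
  have h1 := Sys_lower (d := d) (m0 := m0) (m := m) h0 hp
  by_contra hc
  have : Sys d m0 m p0 p = ⊥ := by
    rw [eq_bot_iff]
    intro F hF
    by_contra hF0
    exact hc ⟨F, hF, hF0⟩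
  rw [this, finrank_bot] at h1
  omega

theorem NZ.mul {d m0 m d1 m1 μ1 : ℕ} (h : NZ p0 p d m0 m) (h' : NZ p0 p d1 m1 μ1) :
    NZ p0 p (d + d1) (m0 + m1) (m + μ1) := by
  obtain ⟨G, hG, hG0⟩ := h
  obtain ⟨F, hF, hF0⟩ := h'
  refine ⟨G * F, ?_, mul_ne_zero hG0 hF0⟩
  rw [mem_Sys] at *
  exact ⟨hG.1.mul hF.1, hG.2.1.mul hF.2.1, fun i => (hG.2.2 i).mul (hF.2.2 i)⟩

/-- What the special systems satisfy. -/
def Big (p0 : Fin 3 → ℂ) (p : Fin n → Fin 3 → ℂ) (d m0 : ℕ) : Prop :=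
  1 ≤ Module.finrank ℂ (Sys d m0 4 p0 p) ∧
    (d + 1) * (d + 2) + 2 ≤ 2 * Module.finrank ℂ (Sys d m0 4 p0 p) + m0 * (m0 + 1) + 20 * n

theorem Big.of (h0 : p0 ≠ 0) (hp : ∀ i, p i ≠ 0) {d m0 d1 m1 μ1 d2 m2 μ2 : ℕ}
    (h : NZ p0 p d1 m1 μ1) (hd : d1 + d2 = d) (hm0 : m1 + m2 = m0) (hm : μ1 + μ2 = 4)
    (h1 : m2 * (m2 + 1) + n * (μ2 * (μ2 + 1)) + 2 ≤ (d2 + 1) * (d2 + 2))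
    (h2 : (d + 1) * (d + 2) + 2 + (m2 * (m2 + 1) + n * (μ2 * (μ2 + 1))) ≤
      (d2 + 1) * (d2 + 2) + m0 * (m0 + 1) + 20 * n) : Big p0 p d m0 := by
  obtain ⟨G, hG, hG0⟩ := h
  have h3 := Sys_mul hG hG0 hd hm0 hm
  have h4 := Sys_lower (d := d2) (m0 := m2) (m := μ2) h0 hp
  constructor <;> omega

theorem nz_lines (h0 : p0 ≠ 0) (hp : ∀ i, p i ≠ 0) : NZ p0 p n n 1 :=
  NZ.of h0 hp (by nlinarith)

theorem big1 (h0 : p0 ≠ 0) (hp : ∀ i, p i ≠ 0) (hn : 1 ≤ n) {d : ℕ} (h : 4 * n ≤ d) :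
    Big p0 p d d := by
  obtain ⟨r, rfl⟩ := Nat.exists_eq_add_of_le h
  have L := nz_lines h0 hp
  exact Big.of h0 hp (((L.mul L).mul L).mul L) (d2 := r) (m2 := r) (μ2 := 0) (by omega) (by omega)
    (by omega) (by nlinarith) (by nlinarith)

theorem big2 (h0 : p0 ≠ 0) (hp : ∀ i, p i ≠ 0) (hn : 1 ≤ n) {d m0 : ℕ} (hm : m0 + 1 = d)
    (h : 7 * n ≤ 2 * d) : Big p0 p d m0 := by
  obtain ⟨r, rfl⟩ : ∃ r, m0 = 3 * n + r := Nat.exists_eq_add_of_le (by omega)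
  subst hm
  have L := nz_lines h0 hp
  exact Big.of h0 hp ((L.mul L).mul L) (d2 := r + 1) (m2 := r) (μ2 := 1) (by omega) (by omega)
    (by omega) (by nlinarith) (by nlinarith)

theorem big3 (h0 : p0 ≠ 0) (hp : ∀ i, p i ≠ 0) (hn : 1 ≤ n) {d m0 : ℕ} (hm : m0 + 2 = d)
    (h : 9 * n + 1 ≤ 3 * d) : Big p0 p d m0 := by
  obtain ⟨r, rfl⟩ : ∃ r, m0 = 2 * n + r := Nat.exists_eq_add_of_le (by omega)
  subst hm
  have L := nz_lines h0 hp
  exact Big.of h0 hp (L.mul L) (d2 := r + 2) (m2 := r) (μ2 := 2) (by omega) (by omega)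
    (by omega) (by nlinarith) (by nlinarith)

theorem big4 (h0 : p0 ≠ 0) (hp : ∀ i, p i ≠ 0) {d m0 e : ℕ} (he : 1 ≤ e) (hn : n = 2 * e)
    (h : (d = 6 * e ∧ m0 + 2 = 6 * e) ∨
         (d = 5 * e ∧ m0 + 3 = 5 * e) ∨
         (d = 5 * e + 1 ∧ m0 + 2 = 5 * e) ∨
         (d = 4 * e ∧ m0 + 4 = 4 * e) ∨
         (d = 4 * e + 1 ∧ m0 + 3 = 4 * e) ∨
         (d = 4 * e + 2 ∧ m0 + 2 = 4 * e)) : Big p0 p d m0 := by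
  obtain ⟨r, rfl⟩ : ∃ r, e = r + 1 := ⟨e - 1, by omega⟩
  have L := nz_lines h0 hp
  have F : NZ p0 p (r + 1) r 1 := NZ.of h0 hp (by rw [hn]; nlinarith)
  rcases h with ⟨rfl, hm⟩ | ⟨rfl, hm⟩ | ⟨rfl, hm⟩ | ⟨rfl, hm⟩ | ⟨rfl, hm⟩ | ⟨rfl, hm⟩
  · obtain rfl : m0 = 6 * r + 4 := by omega
    exact Big.of h0 hp ((L.mul L).mul F) (d2 := r + 1) (m2 := r) (μ2 := 1) (by omega) (by omega)
      (by omega) (by rw [hn]; nlinarith) (by rw [hn]; nlinarith)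
  · obtain rfl : m0 = 5 * r + 2 := by omega
    exact Big.of h0 hp ((L.mul F).mul F) (d2 := r + 1) (m2 := r) (μ2 := 1) (by omega) (by omega)
      (by omega) (by rw [hn]; nlinarith) (by rw [hn]; nlinarith)
  · obtain rfl : m0 = 5 * r + 3 := by omega
    exact Big.of h0 hp ((L.mul F).mul F) (d2 := r + 2) (m2 := r + 1) (μ2 := 1) (by omega) (by omega)
      (by omega) (by rw [hn]; nlinarith) (by rw [hn]; nlinarith)
  · obtain rfl : m0 = 4 * r := by omega
    exact Big.of h0 hp ((F.mul F).mul F) (d2 := r + 1) (m2 := r) (μ2 := 1) (by omega) (by omega)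
      (by omega) (by rw [hn]; nlinarith) (by rw [hn]; nlinarith)
  · obtain rfl : m0 = 4 * r + 1 := by omega
    exact Big.of h0 hp ((F.mul F).mul F) (d2 := r + 2) (m2 := r + 1) (μ2 := 1) (by omega) (by omega)
      (by omega) (by rw [hn]; nlinarith) (by rw [hn]; nlinarith)
  · obtain rfl : m0 = 4 * r + 2 := by omega
    exact Big.of h0 hp (F.mul F) (d2 := 2 * r + 4) (m2 := 2 * r + 2) (μ2 := 2) (by omega)
      (by omega) (by omega) (by rw [hn]; nlinarith) (by rw [hn]; nlinarith)

/-- Sporadic case: the square of a curve with simple points times a system with double points. -/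
theorem big5 (h0 : p0 ≠ 0) (hp : ∀ i, p i ≠ 0) {d m0 : ℕ} (d1 m1 d2 m2 : ℕ)
    (hd : 2 * d1 + d2 = d) (hm : 2 * m1 + m2 = m0)
    (h : m1 * (m1 + 1) + n * 2 < (d1 + 1) * (d1 + 2))
    (h1 : m2 * (m2 + 1) + n * 6 + 2 ≤ (d2 + 1) * (d2 + 2))
    (h2 : (d + 1) * (d + 2) + 2 + (m2 * (m2 + 1) + n * 6) ≤
      (d2 + 1) * (d2 + 2) + m0 * (m0 + 1) + 20 * n) : Big p0 p d m0 := by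
  have F : NZ p0 p d1 m1 1 := NZ.of h0 hp (by omega)
  exact Big.of h0 hp (F.mul F) (d2 := d2) (m2 := m2) (μ2 := 2) (by omega) (by omega) (by omega)
    (by omega) (by omega)

/-- Sporadic case: the cube of a curve with simple points times a system with simple points. -/
theorem big6 (h0 : p0 ≠ 0) (hp : ∀ i, p i ≠ 0) {d m0 : ℕ} (d1 m1 d2 m2 : ℕ)
    (hd : 3 * d1 + d2 = d) (hm : 3 * m1 + m2 = m0)
    (h : m1 * (m1 + 1) + n * 2 < (d1 + 1) * (d1 + 2))
    (h1 : m2 * (m2 + 1) + n * 2 + 2 ≤ (d2 + 1) * (d2 + 2))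
    (h2 : (d + 1) * (d + 2) + 2 + (m2 * (m2 + 1) + n * 2) ≤
      (d2 + 1) * (d2 + 2) + m0 * (m0 + 1) + 20 * n) : Big p0 p d m0 := by
  have F : NZ p0 p d1 m1 1 := NZ.of h0 hp (by omega)
  exact Big.of h0 hp ((F.mul F).mul F) (d2 := d2) (m2 := m2) (μ2 := 1) (by omega) (by omega)
    (by omega) (by omega) (by omega)

/-- Sporadic case: the square of a curve with double points. -/
theorem big7 (h0 : p0 ≠ 0) (hp : ∀ i, p i ≠ 0) {d m0 : ℕ} (d1 m1 : ℕ)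
    (hd : 2 * d1 = d) (hm : 2 * m1 = m0)
    (h : m1 * (m1 + 1) + n * 6 < (d1 + 1) * (d1 + 2))
    (h1 : m1 * (m1 + 1) + n * 6 + 2 ≤ (d1 + 1) * (d1 + 2))
    (h2 : (d + 1) * (d + 2) + 2 + (m1 * (m1 + 1) + n * 6) ≤
      (d1 + 1) * (d1 + 2) + m0 * (m0 + 1) + 20 * n) : Big p0 p d m0 := by
  have F : NZ p0 p d1 m1 2 := NZ.of h0 hp (by omega)
  exact Big.of h0 hp F (d2 := d1) (m2 := m1) (μ2 := 2) (by omega) (by omega)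
    (by omega) (by omega) (by omega)

end

theorem big_spor {d m0 n : ℕ} {p0 : Fin 3 → ℂ} {p : Fin n → Fin 3 → ℂ} (h0 : p0 ≠ 0)
    (hp : ∀ i, p i ≠ 0)
    (h : (d, m0, n) = (5, 0, 2) ∨ (d, m0, n) = (6, 1, 2) ∨ (d, m0, n) = (8, 3, 4) ∨
      (d, m0, n) = (9, 4, 4) ∨ (d, m0, n) = (12, 7, 6) ∨ (d, m0, n) = (15, 10, 8) ∨
      (d, m0, n) = (6, 0, 2) ∨ (d, m0, n) = (6, 0, 3) ∨ (d, m0, n) = (8, 2, 4) ∨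
      (d, m0, n) = (12, 6, 7) ∨ (d, m0, n) = (9, 2, 5) ∨ (d, m0, n) = (8, 0, 5) ∨
      (d, m0, n) = (9, 1, 5) ∨ (d, m0, n) = (9, 0, 5)) : Big p0 p d m0 := by
  simp only [Prod.mk.injEq] at h
  rcases h with ⟨rfl, rfl, rfl⟩ | ⟨rfl, rfl, rfl⟩ | ⟨rfl, rfl, rfl⟩ | ⟨rfl, rfl, rfl⟩ |
    ⟨rfl, rfl, rfl⟩ | ⟨rfl, rfl, rfl⟩ | ⟨rfl, rfl, rfl⟩ | ⟨rfl, rfl, rfl⟩ | ⟨rfl, rfl, rfl⟩ |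
    ⟨rfl, rfl, rfl⟩ | ⟨rfl, rfl, rfl⟩ | ⟨rfl, rfl, rfl⟩ | ⟨rfl, rfl, rfl⟩ | ⟨rfl, rfl, rfl⟩
  · apply big6 h0 hp 1 0 2 0 <;> norm_num
  · apply big5 h0 hp 1 0 4 1 <;> norm_num
  · apply big6 h0 hp 2 1 2 0 <;> norm_num
  · apply big5 h0 hp 2 1 5 2 <;> norm_num
  · apply big5 h0 hp 3 2 6 3 <;> norm_num
  · apply big5 h0 hp 4 3 7 4 <;> norm_num
  · apply big5 h0 hp 1 0 4 0 <;> norm_num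
  · have F : NZ p0 p 3 0 2 := by
      exact NZ.of h0 hp (by norm_num)
    exact Big.of h0 hp F (d2 := 3) (m2 := 0) (μ2 := 2) rfl rfl rfl (by norm_num) (by norm_num)
  · apply big5 h0 hp 2 1 4 0 <;> norm_num
  · apply big7 h0 hp 6 3 <;> norm_num
  · apply big5 h0 hp 2 0 5 2 <;> norm_num
  · apply big6 h0 hp 2 0 2 0 <;> norm_num
  · apply big5 h0 hp 2 0 5 1 <;> norm_num
  · apply big5 h0 hp 2 0 5 0 <;> norm_num

theorem linSys_eq {d m0 n : ℕ} (p0 : Fin 3 → ℂ) (p : Fin n → Fin 3 → ℂ) :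
    linSys d m0 p0 p = Sys d m0 4 p0 p := rfl

/-- Existence of a configuration with at most the expected dimension. -/
def Small (d m0 n : ℕ) : Prop :=
  ∃ p : Fin n → Fin 3 → ℂ, (∀ i, p i ≠ 0) ∧ (Module.finrank ℂ (Sys d m0 4 ![0, 0, 1] p) = 0 ∨
    2 * Module.finrank ℂ (Sys d m0 4 ![0, 0, 1] p) + m0 * (m0 + 1) + 20 * n ≤ (d + 1) * (d + 2))

theorem Small.good {m0 k n : ℕ} (h : GoodF (TF (m0 + 1) k) n) : Small (m0 + k) m0 n := by
  obtain ⟨p, hp, h1⟩ := upper (le_refl _) h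
  exact ⟨p, hp, Or.inl (by omega)⟩

theorem Small.surj {m0 k n n0 : ℕ} (h : Surj (TF (m0 + 1) k) n0) (hn : n ≤ n0) :
    Small (m0 + k) m0 n := by
  obtain ⟨p, hp, h1⟩ := upperS h hn
  refine ⟨p, hp, Or.inr ?_⟩
  have h2 := TF_card (m0 + 1) k
  nlinarith

theorem Small.big {d m0 n : ℕ} (h : d < m0) : Small d m0 n :=
  ⟨fun _ => ![0, 0, 1], fun _ hc => by simpa using congrFun hc 2, Or.inl (upper_big h _)⟩

theorem small_k {m0 k n : ℕ} (hn : 1 ≤ n) (h0 : ¬ (k = 0 ∧ 4 * n ≤ m0 + k))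
    (h1 : ¬ (k = 1 ∧ 7 * n ≤ 2 * (m0 + k))) (h2 : ¬ (k = 2 ∧ 9 * n + 1 ≤ 3 * (m0 + k)))
    (h3 : ∀ e, 1 ≤ e → n = 2 * e → ¬ (
         (m0 + k = 6 * e ∧ m0 + 2 = 6 * e) ∨
         (m0 + k = 5 * e ∧ m0 + 3 = 5 * e) ∨
         (m0 + k = 5 * e + 1 ∧ m0 + 2 = 5 * e) ∨
         (m0 + k = 4 * e ∧ m0 + 4 = 4 * e) ∨
         (m0 + k = 4 * e + 1 ∧ m0 + 3 = 4 * e) ∨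
         (m0 + k = 4 * e + 2 ∧ m0 + 2 = 4 * e)))
    (h4 : isSp (m0 + 1) k n = false) : Small (m0 + k) m0 n := by
  have h3' := h3 (n / 2)
  by_cases hk5 : 5 ≤ k
  · by_cases hl : n ≤ crit true (m0 + 1) k
    · exact Small.surj (mainS k (m0 + 1) hk5 (by omega)) hl
    · have : crit false (m0 + 1) k ≤ n := by
        simp only [crit, if_true, Bool.false_eq_true, if_false] at hl ⊢
        generalize (k + 1) * (2 * (m0 + 1) + k) / 2 = M at hl ⊢
        have e1 : n ≠ M / 10 ∨ isSp (m0 + 1) k (M / 10) = false := by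
          by_cases he : n = M / 10
          · right; rw [← he]; exact h4
          · left; exact he
        have e2 : n ≠ (M + 9) / 10 ∨ isSp (m0 + 1) k ((M + 9) / 10) = false := by
          by_cases he : n = (M + 9) / 10
          · right; rw [← he]; exact h4
          · left; exact he
        rcases e1 with e1 | e1 <;> rcases e2 with e2 | e2 <;>
          (try simp only [e1, e2, Bool.false_eq_true, if_false] at hl ⊢) <;>
          (try split_ifs at hl) <;> (try split_ifs) <;> omega
      exact Small.good ((mainI k (m0 + 1) hk5 (by omega)).more this)
  · obtain rfl | rfl | rfl | rfl | rfl : k = 0 ∨ k = 1 ∨ k = 2 ∨ k = 3 ∨ k = 4 := by omega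
    · exact Small.good (good0 _ _ (by omega))
    · exact Small.good (good1 _ _ (by omega))
    · refine Small.good (good2 _ _ (by omega) ?_)
      rintro ⟨⟨e, rfl⟩, h⟩
      exact h3 e (by omega) rfl (by omega)
    · by_cases hl : if n % 2 = 0 then 5 * (n / 2) ≤ m0 + 1 else 5 * (n / 2) + 1 ≤ m0 + 1
      · exact Small.surj (surj3 _ _ hl) le_rfl
      · apply Small.good (good3 _ _ _)
        split_ifs at hl ⊢ <;> omega
    · by_cases hl : 4 * (n / 2) ≤ m0 + 1
      · exact Small.surj (surj4 _ _ hl) le_rfl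
      · apply Small.good (good4 _ _ _)
        split_ifs <;> omega

theorem spor_list {m0 k n d : ℕ} (hd : m0 + k = d) (h : isSp (m0 + 1) k n = true) :
    (d, m0, n) = (5, 0, 2) ∨ (d, m0, n) = (6, 1, 2) ∨ (d, m0, n) = (8, 3, 4) ∨
      (d, m0, n) = (9, 4, 4) ∨ (d, m0, n) = (12, 7, 6) ∨ (d, m0, n) = (15, 10, 8) ∨
      (d, m0, n) = (6, 0, 2) ∨ (d, m0, n) = (6, 0, 3) ∨ (d, m0, n) = (8, 2, 4) ∨
      (d, m0, n) = (12, 6, 7) ∨ (d, m0, n) = (9, 2, 5) ∨ (d, m0, n) = (8, 0, 5) ∨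
      (d, m0, n) = (9, 1, 5) ∨ (d, m0, n) = (9, 0, 5) := by
  simp only [isSp, spor, List.any_cons, List.any_nil, Bool.or_eq_true, Bool.and_eq_true,
    beq_iff_eq, Bool.false_eq_true, or_false] at h
  rcases h with ⟨h, rfl, rfl⟩ | ⟨h, rfl, rfl⟩ | ⟨h, rfl, rfl⟩ | ⟨h, rfl, rfl⟩ |
    ⟨h, rfl, rfl⟩ | ⟨h, rfl, rfl⟩ | ⟨h, rfl, rfl⟩ | ⟨h, rfl, rfl⟩ | ⟨h, rfl, rfl⟩ |
    ⟨h, rfl, rfl⟩ | ⟨h, rfl, rfl⟩ | ⟨h, rfl, rfl⟩ | ⟨h, rfl, rfl⟩ | ⟨h, rfl, rfl⟩ <;>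
  · obtain rfl : m0 = _ := (Nat.succ.inj h).symm
    subst hd
    decide

end QH

/-- Main theorem: `L(d, m0, n, 4)` is special if and only if it is one of the
`(-1)` special systems on the explicit list. -/
theorem special_iff_minus_one_special (d m0 n : ℕ) (hd : 1 ≤ d) (hn : 1 ≤ n) :
    (((sInf {k : ℕ | ∃ (p0 : Fin 3 → ℂ) (p : Fin n → Fin 3 → ℂ),
          p0 ≠ 0 ∧ (∀ i, p i ≠ 0) ∧ Module.finrank ℂ ↥(linSys d m0 p0 p) = k} : ℕ) : ℤ) - 1
        > max (-1) ((d : ℤ) * ((d : ℤ) + 3) / 2 - (m0 : ℤ) * ((m0 : ℤ) + 1) / 2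
            - 10 * (n : ℤ))) ↔
      ((m0 = d ∧ 4 * n ≤ d) ∨
      (m0 + 1 = d ∧ 7 * n ≤ 2 * d) ∨
      (m0 + 2 = d ∧ 9 * n + 1 ≤ 3 * d) ∨
      (∃ e : ℕ, 1 ≤ e ∧
        ((d = 6 * e ∧ m0 + 2 = 6 * e ∧ n = 2 * e) ∨
         (d = 5 * e ∧ m0 + 3 = 5 * e ∧ n = 2 * e) ∨
         (d = 5 * e + 1 ∧ m0 + 2 = 5 * e ∧ n = 2 * e) ∨
         (d = 4 * e ∧ m0 + 4 = 4 * e ∧ n = 2 * e) ∨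
         (d = 4 * e + 1 ∧ m0 + 3 = 4 * e ∧ n = 2 * e) ∨
         (d = 4 * e + 2 ∧ m0 + 2 = 4 * e ∧ n = 2 * e))) ∨
      (d, m0, n) = (5, 0, 2) ∨ (d, m0, n) = (6, 1, 2) ∨ (d, m0, n) = (8, 3, 4) ∨
      (d, m0, n) = (9, 4, 4) ∨ (d, m0, n) = (12, 7, 6) ∨ (d, m0, n) = (15, 10, 8) ∨
      (d, m0, n) = (6, 0, 2) ∨ (d, m0, n) = (6, 0, 3) ∨ (d, m0, n) = (8, 2, 4) ∨
      (d, m0, n) = (12, 6, 7) ∨ (d, m0, n) = (9, 2, 5) ∨ (d, m0, n) = (8, 0, 5) ∨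
      (d, m0, n) = (9, 1, 5) ∨ (d, m0, n) = (9, 0, 5)) := by
  have hset : {k : ℕ | ∃ (p0 : Fin 3 → ℂ) (p : Fin n → Fin 3 → ℂ),
          p0 ≠ 0 ∧ (∀ i, p i ≠ 0) ∧ Module.finrank ℂ ↥(linSys d m0 p0 p) = k}.Nonempty :=
    ⟨_, fun _ => 1, fun _ _ => 1, one_ne_zero, fun _ => one_ne_zero, rfl⟩
  have hv1 : (d : ℤ) * ((d : ℤ) + 3) / 2 * 2 = (d : ℤ) * ((d : ℤ) + 3) := by
    apply Int.ediv_mul_cancel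
    rcases Int.even_or_odd' (d : ℤ) with ⟨r, hr | hr⟩
    · rw [hr]; exact ⟨r * (2 * r + 3), by ring⟩
    · rw [hr]; exact ⟨(2 * r + 1) * (r + 2), by ring⟩
  have hv2 : (m0 : ℤ) * ((m0 : ℤ) + 1) / 2 * 2 = (m0 : ℤ) * ((m0 : ℤ) + 1) := by
    apply Int.ediv_mul_cancel
    rcases Int.even_or_odd' (m0 : ℤ) with ⟨r, hr | hr⟩
    · rw [hr]; exact ⟨r * (2 * r + 1), by ring⟩
    · rw [hr]; exact ⟨(2 * r + 1) * (r + 1), by ring⟩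
  constructor
  · intro hsp
    by_contra hlist
    have hsmall : QH.Small d m0 n := by
      by_cases hdm : d < m0
      · exact QH.Small.big hdm
      · obtain ⟨k, rfl⟩ := Nat.exists_eq_add_of_le (not_lt.mp hdm)
        simp only [not_or] at hlist
        obtain ⟨l1, l2, l3, l4, l5⟩ := hlist
        apply QH.small_k hn
        · intro h; exact l1 ⟨by omega, by omega⟩
        · intro h; exact l2 ⟨by omega, by omega⟩
        · intro h; exact l3 ⟨by omega, by omega⟩
        · intro e he hne hc
          refine l4 ⟨e, he, ?_⟩
          simp only [hne, and_true]
          exact hc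
        · rw [← Bool.not_eq_true]
          intro hc
          have := QH.spor_list rfl hc
          simp only [l5, or_self] at this
    obtain ⟨p, hp, hfr⟩ := hsmall
    have hle := Nat.sInf_le (show _ ∈ {k : ℕ | ∃ (p0 : Fin 3 → ℂ) (p : Fin n → Fin 3 → ℂ),
          p0 ≠ 0 ∧ (∀ i, p i ≠ 0) ∧ Module.finrank ℂ ↥(linSys d m0 p0 p) = k} from
        ⟨![0, 0, 1], p, fun hc => by simpa using congrFun hc 2, hp, rfl⟩)
    rw [QH.linSys_eq] at hle
    rw [gt_iff_lt, max_lt_iff] at hsp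
    generalize sInf {k : ℕ | ∃ (p0 : Fin 3 → ℂ) (p : Fin n → Fin 3 → ℂ),
          p0 ≠ 0 ∧ (∀ i, p i ≠ 0) ∧ Module.finrank ℂ ↥(linSys d m0 p0 p) = k} = S at hsp hle
    generalize Module.finrank ℂ (QH.Sys d m0 4 ![0, 0, 1] p) = r at hfr hle
    rcases hfr with hfr | hfr
    · omega
    · zify at hfr hle
      nlinarith
  · intro hlist
    obtain ⟨p0, p, h0, hp, hS⟩ := Nat.sInf_mem hset
    rw [← hS, QH.linSys_eq]
    have hbig : QH.Big p0 p d m0 := by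
      rcases hlist with ⟨rfl, h⟩ | ⟨h, h'⟩ | ⟨h, h'⟩ | ⟨e, he, h⟩ | h
      · exact QH.big1 h0 hp hn h
      · exact QH.big2 h0 hp hn h h'
      · exact QH.big3 h0 hp hn h h'
      · have hne : n = 2 * e := by
          rcases h with h | h | h | h | h | h <;> exact h.2.2
        simp only [hne, and_true] at h
        exact QH.big4 h0 hp he hne h
      · exact QH.big_spor h0 hp h
    obtain ⟨hb1, hb2⟩ := hbig
    generalize Module.finrank ℂ (QH.Sys d m0 4 p0 p) = r at hb1 hb2
    rw [gt_iff_lt, max_lt_iff]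
    constructor
    · omega
    · zify at hb2
      nlinarith
end
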